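/- Assume additionally m ≥ 2 and r ≠ [m, 2], and let s, s′ be distinct rational numbers in I_1(r;n) ∪ I_2(r;n) such that u_s is conjugate in Heck(r;n) to u_{s′} or to u_{s′}^{−1}. Then the derived rationals s̃ and s̃′ are defined and s̃, s̃′ ∈ I_1(r̃;n) ∪ I_2(r̃;n). -/

import Mathlib

/- Formalization of statements from "Homotopically equivalent simple loops on
2-bridge spheres in Heckoid orbifolds for 2-bridge links (II)" by Lee-Sakuma.

We work in the free group `F` on two generators `a = gen 0`, `b = gen 1`.
For a rational `s` (in lowest terms `q/p`, with `0 ≤ s ≤ 1`), `uWord s` is the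
word `u_s = a b^{ε₁} a^{ε₂} ⋯ b^{ε_{2p-1}}` with `ε_i = (-1)^⌊i·s⌋`.
`CS s` is (a linear representative of) the cyclic sequence of lengths of
maximal constant-sign runs of exponents of `u_s`; since `u_s` begins with a
positive letter and (for `0 < s ≤ 1`) ends with a negative letter, the linear
run-length sequence represents the cyclic one.  `CyclicContains L T` says the
cyclic sequence represented by `L` contains `T` as a block of consecutive
terms.  `cfQ [m₁,…,m_k]` is the continued fraction `1/(m₁+1/(m₂+⋯+1/m_k))`.
`memI1 M n s` / `memI2 M n s` express `s ∈ I₁(r;n)` / `s ∈ I₂(r;n)` where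
`r = cfQ M`, and `memI1hat` / `memI2hat` express `s ∈ I₁(r)` / `s ∈ I₂(r)`.
The Heckoid group `Heck(r;n) = ⟨a,b | u_r^n⟩` is the quotient of `F` by the
normal closure `heckN r n` of `u_r^n`, with quotient map `heckQ r n`. -/

namespace Heckoid

abbrev F : Type := FreeGroup (Fin 2)

/-- The generators: `gen 0 = a`, `gen 1 = b` (and `gen i` depends on parity). -/
def gen (i : ℕ) : F := FreeGroup.of ⟨i % 2, Nat.mod_lt _ (by norm_num)⟩

/-- The word `u_s = a b^{ε₁} a^{ε₂} b^{ε₃} ⋯ a^{ε_{2p-2}} b^{ε_{2p-1}}`,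
where `s = q/p` in lowest terms and `ε_i = (-1)^⌊iq/p⌋`. -/
def uWord (s : ℚ) : F :=
  ((List.range (2 * s.den)).map
    (fun i => gen i ^ ((-1 : ℤ) ^ (⌊(i : ℚ) * s⌋.toNat)))).prod

/-- The sequence of exponent signs `ε₀, ε₁, …, ε_{2p-1}` of `u_s`. -/
def signList (s : ℚ) : List ℤ :=
  (List.range (2 * s.den)).map (fun i => (-1 : ℤ) ^ (⌊(i : ℚ) * s⌋.toNat))

/-- Lengths of the maximal runs of equal consecutive entries. -/
def runLengths {α : Type} [BEq α] (l : List α) : List ℕ :=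
  (l.splitBy (· == ·)).map List.length

/-- `CS s = CS(u_s)`: the cyclic sequence of lengths of maximal constant-sign
runs of `u_s`, represented by a list. -/
def CS (s : ℚ) : List ℕ := runLengths (signList s)

/-- The cyclic sequence represented by `L` contains `T` as a block of
consecutive terms. -/
def CyclicContains (L T : List ℕ) : Prop := ∃ k, T <+: L.rotate k

/-- The continued fraction `[m₁, m₂, …, m_k] = 1/(m₁+1/(m₂+⋯+1/m_k))`. -/
def cfQ : List ℕ → ℚ
  | [] => 0
  | a :: l => 1 / ((a : ℚ) + cfQ l)

/-- `d⟨T, T'⟩`: `d` consecutive repetitions of the concatenation of `T` and `T'`. -/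
def rep2 (d : ℕ) (T T' : List ℕ) : List ℕ := (List.replicate d (T ++ T')).flatten

/-- `s ∈ I₁(r;n)` where `r = cfQ M`:  `[0, [m₁,…,m_{k-1},m_k-1,2]]` for `k` even,
`[0, [m₁,…,m_k,2n-2])` for `k` odd. -/
def memI1 (M : List ℕ) (n : ℕ) (s : ℚ) : Prop :=
  if Even M.length then 0 ≤ s ∧ s ≤ cfQ (M.dropLast ++ [M.getLast! - 1, 2])
  else 0 ≤ s ∧ s < cfQ (M ++ [2 * n - 2])

/-- `s ∈ I₂(r;n)` where `r = cfQ M`: `([m₁,…,m_k,2n-2], 1]` for `k` even,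
`[[m₁,…,m_{k-1},m_k-1,2], 1]` for `k` odd. -/
def memI2 (M : List ℕ) (n : ℕ) (s : ℚ) : Prop :=
  if Even M.length then cfQ (M ++ [2 * n - 2]) < s ∧ s ≤ 1
  else cfQ (M.dropLast ++ [M.getLast! - 1, 2]) ≤ s ∧ s ≤ 1

/-- `s ∈ I₁(r)` where `r = cfQ M`. -/
def memI1hat (M : List ℕ) (s : ℚ) : Prop :=
  if Even M.length then 0 ≤ s ∧ s ≤ cfQ (M.dropLast ++ [M.getLast! - 1])
  else 0 ≤ s ∧ s ≤ cfQ M.dropLast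

/-- `s ∈ I₂(r)` where `r = cfQ M`. -/
def memI2hat (M : List ℕ) (s : ℚ) : Prop :=
  if Even M.length then cfQ M.dropLast ≤ s ∧ s ≤ 1
  else cfQ (M.dropLast ++ [M.getLast! - 1]) ≤ s ∧ s ≤ 1

/-- The normal closure of `u_r^n`, so that `Heck(r;n) = F ⧸ heckN r n`. -/
abbrev heckN (r : ℚ) (n : ℕ) : Subgroup F := Subgroup.normalClosure {uWord r ^ n}

/-- The quotient map `F → Heck(r;n) = ⟨a, b | u_r^n⟩`. -/
def heckQ (r : ℚ) (n : ℕ) : F →* F ⧸ heckN r n := QuotientGroup.mk' (heckN r n)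

/-- The derived continued-fraction list: `[l₁,1,l₃,…,l_t] ↦ [l₃,…,l_t]` and
`[l₁,l₂,…,l_t] ↦ [l₂-1,l₃,…,l_t]` when `l₂ ≥ 2`. -/
def deriveCF : List ℕ → List ℕ
  | _ :: 1 :: rest => rest
  | _ :: l₂ :: rest => (l₂ - 1) :: rest
  | _ => []

/-- `L` is the continued fraction expansion of `s` (all entries positive,
last entry `≥ 2`). -/
def IsCFExp (s : ℚ) (L : List ℕ) : Prop :=
  L ≠ [] ∧ (∀ x ∈ L, 0 < x) ∧ 2 ≤ L.getLast! ∧ s = cfQ L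

/-- The inverse of a letter of a free group word. -/
def linv (x : Bool × Bool) : Bool × Bool := (x.1, !x.2)

@[simp] lemma linv_linv (x : Bool × Bool) : linv (linv x) = x := by simp [linv]

/-- `m` integrates `h` along the list of darts, starting from the value `c`. -/
def IsPath {A : Type} [Group A] (h m : ℕ → A) : A → List ℕ → Prop
  | _, [] => True
  | c, d :: l => m d = c ∧ IsPath h m (c * h d) l

section IsPath
variable {A : Type} [Group A] {h m : ℕ → A}

lemma isPath_append {c : A} {p q : List ℕ} :
    IsPath h m c (p ++ q) ↔ IsPath h m c p ∧ IsPath h m (c * (p.map h).prod) q := by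
  induction p generalizing c with
  | nil => simp [IsPath]
  | cons d l ih => simp [IsPath, ih, mul_assoc, and_assoc]

lemma isPath_congr {h' m' : ℕ → A} {p : List ℕ} (hh : ∀ d ∈ p, h d = h' d)
    (hm : ∀ d ∈ p, m d = m' d) {c : A} (hp : IsPath h m c p) : IsPath h' m' c p := by
  induction p generalizing c with
  | nil => trivial
  | cons d l ih =>
    simp only [List.mem_cons, forall_eq_or_imp] at hh hm
    exact ⟨hm.1 ▸ hp.1, hh.1 ▸ ih hh.2 hm.2 hp.2⟩

end IsPath

/-- A planar diagram: a spherical cell structure given by its darts, its edge involution `θ` and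
the lists of darts along the faces. Planarity is expressed by the solvability of all cocycle
equations. -/
structure Diagram (θ : ℕ → ℕ) (lab : ℕ → Bool × Bool) (faces : List (List ℕ)) : Prop where
  nodup : faces.flatten.Nodup
  mem : ∀ d ∈ faces.flatten, θ d ∈ faces.flatten
  invol : ∀ d ∈ faces.flatten, θ (θ d) = d
  lab_inv : ∀ d ∈ faces.flatten, lab (θ d) = linv (lab d)
  planar : ∀ (A : Type) [Group A] (h : ℕ → A),
    (∀ d ∈ faces.flatten, h (θ d) = (h d)⁻¹) → (∀ f ∈ faces, (f.map h).prod = 1) →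
    ∃ m : ℕ → A, (∀ d ∈ faces.flatten, m (θ d) = m d * h d) ∧ ∀ f ∈ faces, ∃ c, IsPath h m c f

namespace Diagram
variable {θ : ℕ → ℕ} {lab : ℕ → Bool × Bool} {faces : List (List ℕ)}

lemma perm {faces' : List (List ℕ)} (D : Diagram θ lab faces) (hp : faces.Perm faces') :
    Diagram θ lab faces' := by
  have hm : ∀ d, d ∈ faces'.flatten ↔ d ∈ faces.flatten := fun d => hp.flatten.mem_iff.symm
  have hm' : ∀ d, d ∈ faces' ↔ d ∈ faces := fun d => hp.mem_iff.symm
  refine ⟨hp.flatten.nodup_iff.1 D.nodup, ?_, ?_, ?_, ?_⟩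
  · simpa only [hm] using D.mem
  · simpa only [hm] using D.invol
  · simpa only [hm] using D.lab_inv
  · simpa only [hm, hm'] using D.planar

lemma lab_ne {d : ℕ} (D : Diagram θ lab faces) (hd : d ∈ faces.flatten) : θ d ≠ d := by
  intro h
  have := D.lab_inv d hd
  rw [h] at this
  have h2 := congrArg Prod.snd this
  simp [linv] at h2

lemma nil : Diagram id (fun _ => default) [[]] :=
  ⟨by simp, by simp, by simp, by simp, fun A _ h _ _ => ⟨fun _ => 1, by simp, by simp [IsPath]⟩⟩

lemma drop_nil (D : Diagram θ lab ([] :: faces)) : Diagram θ lab faces := by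
  refine ⟨by simpa using D.nodup, by simpa using D.mem, by simpa using D.invol,
    by simpa using D.lab_inv, fun A _ h h1 h2 => ?_⟩
  obtain ⟨m, hm1, hm2⟩ := D.planar A h (by simpa using h1) (by simpa using h2)
  exact ⟨m, by simpa using hm1, fun f hf => hm2 f (List.mem_cons_of_mem _ hf)⟩

lemma rotate {a b : List ℕ} (D : Diagram θ lab ((a ++ b) :: faces)) :
    Diagram θ lab ((b ++ a) :: faces) := by
  have hp : ((a ++ b) :: faces).flatten.Perm ((b ++ a) :: faces).flatten := by
    simp only [List.flatten_cons]
    exact List.Perm.append_right _ List.perm_append_comm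
  have hm : ∀ d, d ∈ ((b ++ a) :: faces).flatten ↔ d ∈ ((a ++ b) :: faces).flatten :=
    fun d => hp.mem_iff.symm
  refine ⟨hp.nodup_iff.1 D.nodup, ?_, ?_, ?_, ?_⟩
  · simpa only [hm] using D.mem
  · simpa only [hm] using D.invol
  · simpa only [hm] using D.lab_inv
  · intro A _ h h1 h2
    simp only [hm] at h1 ⊢
    simp only [List.mem_cons, forall_eq_or_imp, List.map_append, List.prod_append] at h2
    have e : (a.map h).prod * (b.map h).prod = 1 := by
      exact mul_eq_one_symm h2.1
    obtain ⟨m, hm1, hm2⟩ := D.planar A h h1 (by simpa [e] using h2.2)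
    refine ⟨m, hm1, ?_⟩
    simp only [List.mem_cons, forall_eq_or_imp] at hm2 ⊢
    refine ⟨?_, hm2.2⟩
    obtain ⟨c, hc⟩ := hm2.1
    rw [isPath_append] at hc
    exact ⟨c * (a.map h).prod, isPath_append.2 ⟨hc.2, by rw [mul_assoc, e, mul_one]; exact hc.1⟩⟩

lemma split {p r q : List ℕ} (D : Diagram θ lab ((p ++ r ++ q) :: faces)) :
    Diagram θ lab ((p ++ q) :: r :: faces) := by
  have hp : ((p ++ r ++ q) :: faces).flatten.Perm ((p ++ q) :: r :: faces).flatten := by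
    simp only [List.flatten_cons, List.append_assoc]
    refine List.Perm.append_left _ ?_
    rw [← List.append_assoc, ← List.append_assoc]
    exact List.Perm.append_right _ List.perm_append_comm
  have hm : ∀ d, d ∈ ((p ++ q) :: r :: faces).flatten ↔ d ∈ ((p ++ r ++ q) :: faces).flatten :=
    fun d => hp.mem_iff.symm
  refine ⟨hp.nodup_iff.1 D.nodup, ?_, ?_, ?_, ?_⟩
  · simpa only [hm] using D.mem
  · simpa only [hm] using D.invol
  · simpa only [hm] using D.lab_inv
  · intro A _ h h1 h2
    simp only [hm] at h1 ⊢
    simp only [List.mem_cons, forall_eq_or_imp, List.map_append, List.prod_append] at h2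
    obtain ⟨e1, e2, h2⟩ := h2
    obtain ⟨m, hm1, hm2⟩ := D.planar A h h1 (by simpa [e1, e2] using h2)
    refine ⟨m, hm1, ?_⟩
    simp only [List.mem_cons, forall_eq_or_imp] at hm2 ⊢
    obtain ⟨⟨c, hc⟩, hm2⟩ := hm2
    simp only [isPath_append, List.map_append, List.prod_append, e2, mul_one] at hc
    exact ⟨⟨c, isPath_append.2 ⟨hc.1.1, hc.2⟩⟩, ⟨_, hc.1.2⟩, hm2⟩

lemma merge {a b : List ℕ} {d : ℕ} (D : Diagram θ lab ((d :: a) :: (θ d :: b) :: faces)) :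
    Diagram θ lab ((a ++ b) :: faces) := by
  have hp : ((d :: a) :: (θ d :: b) :: faces).flatten.Perm
      (d :: θ d :: ((a ++ b) :: faces).flatten) := by
    simp only [List.flatten_cons, List.append_assoc, List.cons_append]
    exact List.Perm.cons _ List.perm_middle
  have nd := hp.nodup_iff.1 D.nodup
  rw [List.nodup_cons, List.nodup_cons, List.mem_cons, not_or] at nd
  obtain ⟨⟨hne, hd⟩, hd', nd⟩ := nd
  have hm : ∀ e, e ∈ ((d :: a) :: (θ d :: b) :: faces).flatten ↔
      e = d ∨ e = θ d ∨ e ∈ ((a ++ b) :: faces).flatten := fun e => by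
    rw [hp.mem_iff]; simp only [List.mem_cons]
  have D1 := D.mem
  have D2 := D.invol
  have D3 := D.lab_inv
  have D4 := D.planar
  simp only [hm, forall_eq_or_imp] at D1 D2 D3 D4
  have nh : ∀ {e}, e ∈ ((a ++ b) :: faces).flatten → e ≠ d ∧ e ≠ θ d :=
    fun he => ⟨fun h => hd (h ▸ he), fun h => hd' (h ▸ he)⟩
  have inj : ∀ {e}, e ∈ ((a ++ b) :: faces).flatten → θ e ≠ d ∧ θ e ≠ θ d := by
    intro e he
    refine ⟨fun h => (nh he).2 ?_, fun h => (nh he).1 ?_⟩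
    · rw [← h, D2.2.2 e he]
    · rw [← D2.2.2 e he, h, D2.1]
  refine ⟨nd, ?_, D2.2.2, D3.2.2, ?_⟩
  · intro e he
    exact ((D1.2.2 e he).resolve_left (inj he).1).resolve_left (inj he).2
  · intro A _ h h1 h2
    simp only [List.mem_cons, forall_eq_or_imp, List.map_append, List.prod_append] at h2
    let h' : ℕ → A := fun e => if e = d then ((a.map h).prod)⁻¹ else
      if e = θ d then (a.map h).prod else h e
    have hh : ∀ e ∈ ((a ++ b) :: faces).flatten, h' e = h e := fun e he => by
      simp [h', (nh he).1, (nh he).2]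
    have hd1 : h' d = ((a.map h).prod)⁻¹ := by simp [h']
    have hd2 : h' (θ d) = (a.map h).prod := by simp [h', Ne.symm hne]
    have hl : ∀ l : List ℕ, (∀ e ∈ l, e ∈ ((a ++ b) :: faces).flatten) →
        l.map h' = l.map h := fun l hl => List.map_congr_left fun e he => hh e (hl e he)
    have ma : ∀ e ∈ a, e ∈ ((a ++ b) :: faces).flatten := fun e he => by simp [he]
    have mb : ∀ e ∈ b, e ∈ ((a ++ b) :: faces).flatten := fun e he => by simp [he]
    have mf : ∀ f ∈ faces, ∀ e ∈ f, e ∈ ((a ++ b) :: faces).flatten := fun f hf e he => by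
      rw [List.flatten_cons, List.mem_append]
      exact Or.inr (List.mem_flatten.2 ⟨f, hf, he⟩)
    obtain ⟨m, hm1, hm2⟩ := D4 A h' (by
      refine ⟨by rw [hd1, hd2, inv_inv], by rw [D2.1, hd1, hd2], fun e he => ?_⟩
      have : h' (θ e) = h (θ e) := by simp [h', (inj he).1, (inj he).2]
      rw [this, hh e he, h1 e he]) (by
      simp only [List.mem_cons, forall_eq_or_imp, List.map_cons, List.prod_cons]
      refine ⟨by rw [hl a ma, hd1]; simp, by rw [hl b mb, hd2, h2.1], fun f hf => ?_⟩
      rw [hl f (mf f hf), h2.2 f hf])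
    refine ⟨m, fun e he => by rw [hm1.2.2 e he, hh e he], ?_⟩
    simp only [List.mem_cons, forall_eq_or_imp] at hm2 ⊢
    obtain ⟨⟨c1, hc1, hp1⟩, ⟨c2, hc2, hp2⟩, hm2⟩ := hm2
    refine ⟨⟨c1 * h' d, isPath_append.2 ⟨isPath_congr (fun e he => hh e (ma e he))
      (fun _ _ => rfl) hp1, ?_⟩⟩, fun f hf => ?_⟩
    · have e1 : c2 = c1 * h' d := by rw [← hc2, hm1.1, hc1]
      rw [e1] at hp2
      have : c1 * h' d * (a.map h).prod = c1 * h' d * h' (θ d) := by rw [hd2]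
      rw [this]
      exact isPath_congr (fun e he => hh e (mb e he)) (fun _ _ => rfl) hp2
    · obtain ⟨c, hc⟩ := hm2 f hf
      exact ⟨c, isPath_congr (fun e he => hh e (mf f hf e he)) (fun _ _ => rfl) hc⟩

lemma spur {p q : List ℕ} {l : Bool × Bool} {d d' : ℕ} (D : Diagram θ lab ((p ++ q) :: faces))
    (hd : d ∉ ((p ++ q) :: faces).flatten) (hd' : d' ∉ ((p ++ q) :: faces).flatten)
    (hne : d ≠ d') :
    Diagram (fun e => if e = d then d' else if e = d' then d else θ e)
      (fun e => if e = d then l else if e = d' then linv l else lab e)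
      ((p ++ d :: d' :: q) :: faces) := by
  have hp : ((p ++ d :: d' :: q) :: faces).flatten.Perm
      (d :: d' :: ((p ++ q) :: faces).flatten) := by
    simp only [List.flatten_cons, List.append_assoc, List.cons_append]
    refine List.perm_middle.trans (List.Perm.cons _ List.perm_middle)
  have hm : ∀ e, e ∈ ((p ++ d :: d' :: q) :: faces).flatten ↔
      e = d ∨ e = d' ∨ e ∈ ((p ++ q) :: faces).flatten := fun e => by
    rw [hp.mem_iff]; simp only [List.mem_cons]
  have nh : ∀ {e}, e ∈ ((p ++ q) :: faces).flatten → e ≠ d ∧ e ≠ d' :=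
    fun he => ⟨fun h => hd (h ▸ he), fun h => hd' (h ▸ he)⟩
  have nh' : ∀ {e}, e ∈ ((p ++ q) :: faces).flatten → θ e ≠ d ∧ θ e ≠ d' :=
    fun he => nh (D.mem _ he)
  refine ⟨hp.nodup_iff.2 ?_, ?_, ?_, ?_, ?_⟩
  · simp only [List.nodup_cons, List.mem_cons, not_or]
    exact ⟨⟨hne, hd⟩, hd', D.nodup⟩
  · simp only [hm, forall_eq_or_imp]
    refine ⟨by simp, by simp [hne.symm], fun e he => ?_⟩
    simp only [(nh he).1, (nh he).2, if_false]
    exact Or.inr (Or.inr (D.mem e he))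
  · simp only [hm, forall_eq_or_imp]
    refine ⟨by simp [hne.symm], by simp [hne.symm], fun e he => ?_⟩
    simp only [(nh he).1, (nh he).2, (nh' he).1, (nh' he).2, if_false]
    exact D.invol e he
  · simp only [hm, forall_eq_or_imp]
    refine ⟨by simp [hne.symm], by simp [hne.symm], fun e he => ?_⟩
    simp only [(nh he).1, (nh he).2, (nh' he).1, (nh' he).2, if_false]
    exact D.lab_inv e he
  · intro A _ h h1 h2
    simp only [hm, forall_eq_or_imp, if_true, hne.symm, if_false] at h1 ⊢
    simp only [List.mem_cons, forall_eq_or_imp, List.map_append, List.prod_append, List.map_cons,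
      List.prod_cons] at h2
    rw [h1.1, mul_inv_cancel_left] at h2
    obtain ⟨m, hm1, hm2⟩ := D.planar A h (fun e he => by
        have := h1.2.2 e he
        simpa only [(nh he).1, (nh he).2, if_false] using this)
      (by simpa using h2)
    simp only [List.mem_cons, forall_eq_or_imp] at hm2
    obtain ⟨⟨c, hc⟩, hm2⟩ := hm2
    rw [isPath_append] at hc
    let m' : ℕ → A := fun e => if e = d then c * (p.map h).prod else
      if e = d' then c * (p.map h).prod * h d else m e
    have hh : ∀ e ∈ ((p ++ q) :: faces).flatten, m e = m' e := fun e he => by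
      simp [m', (nh he).1, (nh he).2]
    refine ⟨m', ⟨by simp [m', hne.symm], by simp [m', hne.symm, h1.1], fun e he => ?_⟩, ?_⟩
    · simp only [(nh he).1, (nh he).2, if_false]
      rw [← hh _ he, ← hh _ (D.mem _ he), hm1 e he]
    · simp only [List.mem_cons, forall_eq_or_imp]
      refine ⟨⟨c, isPath_append.2 ⟨?_, ?_, ?_, ?_⟩⟩, fun f hf => ?_⟩
      · exact isPath_congr (fun _ _ => rfl) (fun e he => hh e (by simp [he])) hc.1
      · simp [m']
      · simp [m', hne.symm]
      · rw [h1.1, mul_inv_cancel_right]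
        exact isPath_congr (fun _ _ => rfl) (fun e he => hh e (by simp [he])) hc.2
      · obtain ⟨c, hc⟩ := hm2 f hf
        refine ⟨c, isPath_congr (fun _ _ => rfl) (fun e he => hh e ?_) hc⟩
        rw [List.flatten_cons, List.mem_append]
        exact Or.inr (List.mem_flatten.2 ⟨f, hf, he⟩)

lemma fold {p q : List ℕ} {d d' : ℕ} (D : Diagram θ lab ((p ++ d :: d' :: q) :: faces))
    (hl : lab d' = linv (lab d)) :
    ∃ θ', Diagram θ' lab ((p ++ q) :: faces) := by
  have hp : ((p ++ d :: d' :: q) :: faces).flatten.Perm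
      (d :: d' :: ((p ++ q) :: faces).flatten) := by
    simp only [List.flatten_cons, List.append_assoc, List.cons_append]
    refine List.perm_middle.trans (List.Perm.cons _ List.perm_middle)
  have nd := hp.nodup_iff.1 D.nodup
  rw [List.nodup_cons, List.nodup_cons, List.mem_cons, not_or] at nd
  obtain ⟨⟨hne, hd⟩, hd', nd⟩ := nd
  have hm : ∀ e, e ∈ ((p ++ d :: d' :: q) :: faces).flatten ↔
      e = d ∨ e = d' ∨ e ∈ ((p ++ q) :: faces).flatten := fun e => by
    rw [hp.mem_iff]; simp only [List.mem_cons]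
  have D1 := D.mem
  have D2 := D.invol
  have D3 := D.lab_inv
  have D4 := D.planar
  have D5 := fun e => D.lab_ne (d := e)
  simp only [hm, forall_eq_or_imp] at D1 D2 D3 D4 D5
  have D5d := D5.1
  have D5d' := D5.2.1
  have nh : ∀ {e}, e ∈ ((p ++ q) :: faces).flatten → e ≠ d ∧ e ≠ d' :=
    fun he => ⟨fun h => hd (h ▸ he), fun h => hd' (h ▸ he)⟩
  have mp : ∀ e ∈ p, e ∈ ((p ++ q) :: faces).flatten := fun e he => by simp [he]
  have mq : ∀ e ∈ q, e ∈ ((p ++ q) :: faces).flatten := fun e he => by simp [he]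
  have mf : ∀ f ∈ faces, ∀ e ∈ f, e ∈ ((p ++ q) :: faces).flatten := fun f hf e he => by
    rw [List.flatten_cons, List.mem_append]
    exact Or.inr (List.mem_flatten.2 ⟨f, hf, he⟩)
  by_cases hdd : θ d = d'
  · have hdd' : θ d' = d := by rw [← hdd, D2.1]
    have nh' : ∀ {e}, e ∈ ((p ++ q) :: faces).flatten → θ e ≠ d ∧ θ e ≠ d' := by
      intro e he
      refine ⟨fun h => (nh he).2 ?_, fun h => (nh he).1 ?_⟩
      · rw [← D2.2.2 e he, h, hdd]
      · rw [← D2.2.2 e he, h, hdd']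
    refine ⟨θ, nd, fun e he => ((D1.2.2 e he).resolve_left (nh' he).1).resolve_left (nh' he).2,
      D2.2.2, D3.2.2, ?_⟩
    intro A _ h h1 h2
    let h' : ℕ → A := fun e => if e = d then 1 else if e = d' then 1 else h e
    have hh : ∀ e ∈ ((p ++ q) :: faces).flatten, h' e = h e := fun e he => by
      simp [h', (nh he).1, (nh he).2]
    have hl : ∀ l : List ℕ, (∀ e ∈ l, e ∈ ((p ++ q) :: faces).flatten) →
        l.map h' = l.map h := fun l hl => List.map_congr_left fun e he => hh e (hl e he)
    simp only [List.mem_cons, forall_eq_or_imp, List.map_append, List.prod_append] at h2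
    have hd1 : h' d = 1 := by simp [h']
    have hd2 : h' d' = 1 := by simp [h']
    obtain ⟨m, hm1, hm2⟩ := D4 A h' (by
      refine ⟨by rw [hdd, hd1, hd2, inv_one], by rw [hdd', hd1, hd2, inv_one], fun e he => ?_⟩
      rw [show h' (θ e) = h (θ e) by simp [h', (nh' he).1, (nh' he).2], hh e he, h1 e he]) (by
      simp only [List.mem_cons, forall_eq_or_imp, List.map_append, List.map_cons,
        List.prod_append, List.prod_cons, hd1, hd2, one_mul]
      refine ⟨by rw [hl p mp, hl q mq, h2.1], fun f hf => by rw [hl f (mf f hf), h2.2 f hf]⟩)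
    refine ⟨m, fun e he => by rw [hm1.2.2 e he, hh e he], ?_⟩
    simp only [List.mem_cons, forall_eq_or_imp] at hm2 ⊢
    obtain ⟨⟨c, hc⟩, hm2⟩ := hm2
    refine ⟨⟨c, ?_⟩, fun f hf => ?_⟩
    · rw [isPath_append] at hc ⊢
      obtain ⟨hc1, -, -, hc2⟩ := hc
      rw [hd1, hd2, mul_one, mul_one, hl p mp] at hc2
      exact ⟨isPath_congr (fun e he => hh e (mp e he)) (fun _ _ => rfl) hc1,
        isPath_congr (fun e he => hh e (mq e he)) (fun _ _ => rfl) hc2⟩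
    · obtain ⟨c, hc⟩ := hm2 f hf
      exact ⟨c, isPath_congr (fun e he => hh e (mf f hf e he)) (fun _ _ => rfl) hc⟩
  · have hdd' : θ d' ≠ d := fun h => hdd (by rw [← h, D2.2.1])
    have hθ : θ d ≠ θ d' := fun h => hne (by rw [← D2.1, h, D2.2.1])
    have md : θ d ∈ ((p ++ q) :: faces).flatten :=
      (D1.1.resolve_left D5d).resolve_left hdd
    have md' : θ d' ∈ ((p ++ q) :: faces).flatten :=
      (D1.2.1.resolve_left hdd').resolve_left D5d'
    have nh' : ∀ {e}, e ∈ ((p ++ q) :: faces).flatten → e ≠ θ d → e ≠ θ d' →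
        θ e ∈ ((p ++ q) :: faces).flatten ∧ θ e ≠ θ d ∧ θ e ≠ θ d' := by
      intro e he h1 h2
      refine ⟨((D1.2.2 e he).resolve_left fun h => h1 ?_).resolve_left fun h => h2 ?_,
        fun h => (nh he).1 ?_, fun h => (nh he).2 ?_⟩
      · rw [← D2.2.2 e he, h]
      · rw [← D2.2.2 e he, h]
      · rw [← D2.2.2 e he, h, D2.1]
      · rw [← D2.2.2 e he, h, D2.2.1]
    let θ' : ℕ → ℕ := fun e => if e = θ d then θ d' else if e = θ d' then θ d else θ e
    have t1 : θ' (θ d) = θ d' := by simp [θ']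
    have t2 : θ' (θ d') = θ d := by simp [θ', hθ.symm]
    have t3 : ∀ e, e ≠ θ d → e ≠ θ d' → θ' e = θ e := fun e h1 h2 => by simp [θ', h1, h2]
    have key : ∀ {P : ℕ → Prop}, P (θ d) → P (θ d') →
        (∀ e ∈ ((p ++ q) :: faces).flatten, e ≠ θ d → e ≠ θ d' → P e) →
        ∀ e ∈ ((p ++ q) :: faces).flatten, P e := by
      intro P h1 h2 h3 e he
      by_cases c1 : e = θ d
      · rwa [c1]
      by_cases c2 : e = θ d'
      · rwa [c2]
      exact h3 e he c1 c2
    refine ⟨θ', nd, ?_, ?_, ?_, ?_⟩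
    · refine key (by rwa [t1]) (by rwa [t2]) fun e he h1 h2 => ?_
      rw [t3 e h1 h2]
      exact (nh' he h1 h2).1
    · refine key (by rw [t1, t2]) (by rw [t2, t1]) fun e he h1 h2 => ?_
      obtain ⟨_, h4, h5⟩ := nh' he h1 h2
      rw [t3 e h1 h2, t3 _ h4 h5, D2.2.2 e he]
    · refine key (by rw [t1, D3.1, D3.2.1, hl]) (by rw [t2, D3.1, D3.2.1, hl, linv_linv])
        fun e he h1 h2 => ?_
      rw [t3 e h1 h2, D3.2.2 e he]
    · intro A _ h h1 h2
      let h' : ℕ → A := fun e => if e = d then (h (θ d))⁻¹ else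
        if e = d' then (h (θ d'))⁻¹ else h e
      have hh : ∀ e ∈ ((p ++ q) :: faces).flatten, h' e = h e := fun e he => by
        simp [h', (nh he).1, (nh he).2]
      have hl : ∀ l : List ℕ, (∀ e ∈ l, e ∈ ((p ++ q) :: faces).flatten) →
          l.map h' = l.map h := fun l hl => List.map_congr_left fun e he => hh e (hl e he)
      simp only [List.mem_cons, forall_eq_or_imp, List.map_append, List.prod_append] at h2
      have hd1 : h' d = (h (θ d))⁻¹ := by simp [h']
      have hd2 : h' d' = (h (θ d'))⁻¹ := by simp [h', Ne.symm hne]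
      have hd3 : h (θ d') = (h (θ d))⁻¹ := by rw [← h1 _ md, t1]
      have hd4 : h' d * h' d' = 1 := by rw [hd1, hd2, hd3]; simp
      obtain ⟨m, hm1, hm2⟩ := D4 A h' (by
        refine ⟨by rw [hh _ md, hd1, inv_inv], by rw [hh _ md', hd2, inv_inv], ?_⟩
        refine key (by rw [D2.1, hh _ md, hd1]) (by rw [D2.2.1, hh _ md', hd2])
          fun e he g1 g2 => ?_
        rw [hh _ (nh' he g1 g2).1, hh e he, ← h1 e he, t3 e g1 g2]) (by
        simp only [List.mem_cons, forall_eq_or_imp, List.map_append, List.map_cons,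
          List.prod_append, List.prod_cons]
        rw [← mul_assoc (h' d), hd4, one_mul]
        refine ⟨by rw [hl p mp, hl q mq, h2.1], fun f hf => by rw [hl f (mf f hf), h2.2 f hf]⟩)
      simp only [List.mem_cons, forall_eq_or_imp] at hm2 ⊢
      obtain ⟨⟨c, hc⟩, hm2⟩ := hm2
      rw [isPath_append] at hc
      obtain ⟨hc1, hc3, hc4, hc2⟩ := hc
      refine ⟨m, ?_, ⟨c, ?_⟩, fun f hf => ?_⟩
      · have e1 : m (θ d) = m d' := by rw [hm1.1, hc4, hc3]
        have e2 : m (θ d') = m d' * h (θ d) := by rw [hm1.2.1, hd2, hd3, inv_inv]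
        refine key (by rw [t1, e1, e2]) (by rw [t2, e1, e2, hd3, mul_inv_cancel_right])
          fun e he g1 g2 => ?_
        rw [t3 e g1 g2, hm1.2.2 e he, hh e he]
      · rw [mul_assoc _ (h' d), hd4, mul_one, hl p mp] at hc2
        exact isPath_append.2 ⟨isPath_congr (fun e he => hh e (mp e he)) (fun _ _ => rfl) hc1,
          isPath_congr (fun e he => hh e (mq e he)) (fun _ _ => rfl) hc2⟩
      · obtain ⟨c, hc⟩ := hm2 f hf
        exact ⟨c, isPath_congr (fun e he => hh e (mf f hf e he)) (fun _ _ => rfl) hc⟩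

end Diagram
open FreeGroup in
/-- There is a planar diagram with the face boundary words `ws`. -/
def WD (ws : List (List (Bool × Bool))) : Prop :=
  ∃ θ lab faces, Diagram θ lab faces ∧ faces.map (List.map lab) = ws

lemma Diagram.foldAll {θ : ℕ → ℕ} {lab : ℕ → Bool × Bool} {faces : List (List ℕ)}
    {a b q : List ℕ} (D : Diagram θ lab ((a ++ b ++ q) :: faces))
    (h : b.map lab = FreeGroup.invRev (a.map lab)) :
    ∃ θ', Diagram θ' lab (q :: faces) := by
  induction a using List.reverseRecOn generalizing θ b with
  | nil =>
    have : b = [] := by simpa [FreeGroup.invRev] using h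
    subst this
    exact ⟨θ, by simpa using D⟩
  | append_singleton a d ih =>
    cases b with
    | nil => simp [FreeGroup.invRev] at h
    | cons d' b =>
      simp only [List.map_append, List.map_cons, List.map_nil, FreeGroup.invRev,
        List.reverse_append, List.reverse_cons, List.reverse_nil, List.nil_append,
        List.cons_append, List.cons.injEq] at h
      obtain ⟨θ1, D1⟩ := Diagram.fold (p := a) (q := b ++ q) (d := d) (d' := d')
        (by simpa using D) h.1
      exact ih (b := b) (by simpa using D1) (by simpa [FreeGroup.invRev] using h.2)

lemma exists_fresh (l : List ℕ) : ∃ d d', d ∉ l ∧ d' ∉ l ∧ d ≠ d' := by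
  obtain ⟨d, hd⟩ := Infinite.exists_notMem_finset l.toFinset
  obtain ⟨d', hd'⟩ := Infinite.exists_notMem_finset (d :: l).toFinset
  simp only [List.mem_toFinset, List.mem_cons, not_or] at hd hd'
  exact ⟨d, d', hd, hd'.2, fun h => hd'.1 h.symm⟩

namespace WD
variable {ws : List (List (Bool × Bool))} {p q r : List (Bool × Bool)}

lemma nil : WD [[]] := ⟨_, _, _, Diagram.nil, rfl⟩

lemma spur {l : Bool × Bool} (h : WD ((p ++ q) :: ws)) : WD ((p ++ l :: linv l :: q) :: ws) := by
  obtain ⟨θ, lab, faces, D, e⟩ := h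
  obtain ⟨f, faces, rfl, e1, e2⟩ := List.map_eq_cons_iff.1 e
  obtain ⟨P, Q, rfl, e3, e4⟩ := List.map_eq_append_iff.1 e1
  obtain ⟨d, d', hd, hd', hne⟩ := exists_fresh ((P ++ Q) :: faces).flatten
  have D' := D.spur (l := l) hd hd' hne
  refine ⟨_, _, _, D', ?_⟩
  have hc : ∀ L : List ℕ, (∀ e ∈ L, e ∈ ((P ++ Q) :: faces).flatten) →
      L.map (fun e => if e = d then l else if e = d' then linv l else lab e) = L.map lab := by
    intro L hL
    refine List.map_congr_left fun e he => ?_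
    have h1 : e ≠ d := fun h => hd (h ▸ hL e he)
    have h2 : e ≠ d' := fun h => hd' (h ▸ hL e he)
    simp [h1, h2]
  rw [List.map_cons, List.map_append, List.map_cons, List.map_cons, hc P (by simp +contextual),
    hc Q (by simp +contextual), e3, e4]
  simp only [if_true, hne.symm, if_false, ← e2]
  congr 1
  refine List.map_congr_left fun f hf => hc f fun e he => ?_
  rw [List.flatten_cons, List.mem_append]
  exact Or.inr (List.mem_flatten.2 ⟨f, hf, he⟩)

lemma fold {l : Bool × Bool} (h : WD ((p ++ l :: linv l :: q) :: ws)) : WD ((p ++ q) :: ws) := by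
  obtain ⟨θ, lab, faces, D, e⟩ := h
  obtain ⟨f, faces, rfl, e1, e2⟩ := List.map_eq_cons_iff.1 e
  obtain ⟨P, Q, rfl, e3, e4⟩ := List.map_eq_append_iff.1 e1
  obtain ⟨d, Q, rfl, e5, e6⟩ := List.map_eq_cons_iff.1 e4
  obtain ⟨d', Q, rfl, e7, e8⟩ := List.map_eq_cons_iff.1 e6
  obtain ⟨θ', D'⟩ := D.fold (by rw [e7, e5])
  exact ⟨θ', lab, _, D', by simp [e3, e8, e2]⟩

lemma split (h : WD ((p ++ r ++ q) :: ws)) : WD ((p ++ q) :: r :: ws) := by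
  obtain ⟨θ, lab, faces, D, e⟩ := h
  obtain ⟨f, faces, rfl, e1, e2⟩ := List.map_eq_cons_iff.1 e
  obtain ⟨P, Q, rfl, e3, e4⟩ := List.map_eq_append_iff.1 e1
  obtain ⟨P, R, rfl, e5, e6⟩ := List.map_eq_append_iff.1 e3
  exact ⟨θ, lab, _, D.split, by simp [e5, e6, e2, e4]⟩

end WD

/-- `x` bounds a planar diagram all of whose cells have boundary words in `Rel`. -/
def Bounds (Rel : Set (List (Bool × Bool))) (k : ℕ) (x : List (Bool × Bool)) : Prop :=
  ∃ ws : List (List (Bool × Bool)), ws.length = k ∧ (∀ w ∈ ws, w ∈ Rel) ∧ WD (x :: ws)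

section
variable {Rel : Set (List (Bool × Bool))}

lemma bounds_of_step {k : ℕ} {x y : List (Bool × Bool)} (h : FreeGroup.Red.Step x y) :
    Bounds Rel k x ↔ Bounds Rel k y := by
  cases h with
  | @not L₁ L₂ x b =>
    have e : (x, !b) = linv (x, b) := rfl
    constructor
    · rintro ⟨ws, h1, h2, h3⟩
      exact ⟨ws, h1, h2, WD.fold h3⟩
    · rintro ⟨ws, h1, h2, h3⟩
      exact ⟨ws, h1, h2, WD.spur h3⟩

lemma bounds_of_mk_eq {k : ℕ} {x y : List (Bool × Bool)} (h : FreeGroup.mk x = FreeGroup.mk y) :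
    Bounds Rel k x ↔ Bounds Rel k y := by
  have h' : Relation.EqvGen FreeGroup.Red.Step x y := Quot.eqvGen_exact h
  clear h
  induction h' with
  | rel x y h => exact bounds_of_step h
  | refl x => rfl
  | symm x y _ ih => exact ih.symm
  | trans x y z h1 h2 ih1 ih2 => exact ih1.trans ih2

lemma Bounds.conj_mul (hRel : ∀ w ∈ Rel, FreeGroup.invRev w ∈ Rel) {k : ℕ}
    {x w : List (Bool × Bool)} (hw : w ∈ Rel) (b : List (Bool × Bool)) (h : Bounds Rel k x) :
    Bounds Rel (k + 1) (b ++ w ++ (FreeGroup.invRev b ++ x)) := by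
  have h' : Bounds Rel k (b ++ w ++ FreeGroup.invRev w ++ (FreeGroup.invRev b ++ x)) := by
    refine (bounds_of_mk_eq ?_).2 h
    simp only [← FreeGroup.mul_mk, ← FreeGroup.inv_mk]
    group
  obtain ⟨ws, h1, h2, h3⟩ := h'
  exact ⟨_ :: ws, by simp [h1], by simpa [hRel w hw] using h2, h3.split⟩

lemma exists_bounds (hRel : ∀ w ∈ Rel, FreeGroup.invRev w ∈ Rel) {g : FreeGroup Bool}
    (hg : g ∈ Subgroup.normalClosure (FreeGroup.mk '' Rel)) :
    ∃ k, ∀ x, FreeGroup.mk x = g → Bounds Rel k x := by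
  have step : ∀ c w, w ∈ Rel → ∀ y : FreeGroup Bool,
      (∃ k, ∀ x, FreeGroup.mk x = y → Bounds Rel k x) →
      ∃ k, ∀ x, FreeGroup.mk x = c * FreeGroup.mk w * c⁻¹ * y → Bounds Rel k x := by
    rintro c w hw y ⟨k, hk⟩
    refine ⟨k + 1, fun x hx => ?_⟩
    obtain ⟨z, rfl⟩ : ∃ z, FreeGroup.mk z = y := Quot.exists_rep y
    obtain ⟨b, rfl⟩ : ∃ b, FreeGroup.mk b = c := Quot.exists_rep c
    refine (bounds_of_mk_eq ?_).1 (Bounds.conj_mul hRel hw b (hk z rfl))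
    rw [hx, ← FreeGroup.mul_mk, ← FreeGroup.mul_mk, ← FreeGroup.mul_mk, ← FreeGroup.inv_mk,
      mul_assoc _ _ (FreeGroup.mk z)]
  induction hg using Subgroup.closure_induction_left with
  | one =>
    refine ⟨0, fun x hx => ?_⟩
    exact (bounds_of_mk_eq (hx.trans (FreeGroup.one_eq_mk))).2 ⟨[], rfl, by simp, WD.nil⟩
  | mul_left x hx y hy ih =>
    obtain ⟨_, ⟨w, hw, rfl⟩, c, rfl⟩ := by
      simpa only [Group.mem_conjugatesOfSet_iff, isConj_iff] using hx
    exact step c w hw y ih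
  | inv_mul_cancel x hx y hy ih =>
    obtain ⟨_, ⟨w, hw, rfl⟩, c, rfl⟩ := by
      simpa only [Group.mem_conjugatesOfSet_iff, isConj_iff] using hx
    have := step c _ (hRel w hw) y ih
    rwa [← FreeGroup.inv_mk, show c * (FreeGroup.mk w)⁻¹ * c⁻¹ = (c * FreeGroup.mk w * c⁻¹)⁻¹ by
      group] at this

/-- A dart `d` on the face `a.1 ++ d :: a.2`, and the mirrored dart on another face, such that the
two faces are mirror images of each other: the pair of faces can be cancelled. -/
lemma bounds_cancel {θ : ℕ → ℕ} {lab : ℕ → Bool × Bool} {f₀ : List ℕ} {faces : List (List ℕ)}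
    {a₁ a₂ b₁ b₂ : List ℕ} {d : ℕ} {k : ℕ}
    (D : Diagram θ lab (f₀ :: (a₁ ++ d :: a₂) :: (b₁ ++ θ d :: b₂) :: faces))
    (hlen : faces.length = k) (hR : ∀ f ∈ faces, f.map lab ∈ Rel)
    (h : (b₂ ++ b₁).map lab = FreeGroup.invRev ((a₂ ++ a₁).map lab)) :
    Bounds Rel k (f₀.map lab) := by
  have D1 := (D.perm (faces' := (a₁ ++ d :: a₂) :: (b₁ ++ θ d :: b₂) :: f₀ :: faces)
    ((List.Perm.swap _ _ _).trans (List.Perm.cons _ (List.Perm.swap _ _ _)))).rotate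
  have D2 := (D1.perm (List.Perm.swap _ _ _)).rotate.perm (List.Perm.swap _ _ _)
  simp only [List.cons_append] at D2
  have D3 := D2.merge
  obtain ⟨θ', D4⟩ := Diagram.foldAll (q := []) (by simpa using D3) h
  exact ⟨faces.map (List.map lab), by simpa using hlen, by simpa using hR,
    θ', lab, _, D4.drop_nil, rfl⟩

end

/-- The sign `±1` of a direction. -/
def sg (c : Bool) : ℤ := if c then 1 else -1

@[simp] lemma sg_not (c : Bool) : sg (!c) = -sg c := by cases c <;> simp [sg]
@[simp] lemma sg_true : sg true = 1 := rfl
@[simp] lemma sg_false : sg false = -1 := rfl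

/-- A set of phases with a cyclic step and a two-colouring separated by `K + 1` steps.
The relators of the associated group are the colour words of full turns of length `L`. -/
structure Track where
  Ph : Type
  N : Equiv.Perm Ph
  col : Ph → Bool
  L : ℕ
  K : ℕ
  K_pos : 1 ≤ K
  L_large : 4 * K + 4 ≤ L
  period : N ^ L = 1
  sep : ∀ φ ψ, (∀ i : ℕ, i ≤ K → col ((N ^ (i : ℤ)) φ) = col ((N ^ (i : ℤ)) ψ)) → φ = ψ

namespace Track
variable (T : Track)

instance : NeZero T.L := ⟨by have := T.L_large; omega⟩

/-- The relator word read from the phase `φ` in the direction `c`. -/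
def rel (φ : T.Ph) (c : Bool) : List (Bool × Bool) :=
  (List.range T.L).map fun i : ℕ => (T.col ((T.N ^ (sg c * (i : ℤ))) φ), c)

/-- All relator words. -/
def Rel : Set (List (Bool × Bool)) := {w | ∃ φ c, w = T.rel φ c}

lemma rel_length (φ : T.Ph) (c : Bool) : (T.rel φ c).length = T.L := by simp [rel]

lemma zperiod (z : ℤ) : T.N ^ (T.L * z) = 1 := by
  rw [zpow_mul, zpow_natCast, T.period, one_zpow]

lemma zpow_congr {y z : ℤ} (h : (T.L : ℤ) ∣ y - z) : T.N ^ y = T.N ^ z := by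
  obtain ⟨w, hw⟩ := h
  rw [show y = z + T.L * w by omega, zpow_add, T.zperiod, mul_one]

lemma invRev_tail (φ : T.Ph) (c : Bool) :
    (T.rel φ (!c)).tail = FreeGroup.invRev (T.rel φ c).tail := by
  apply List.ext_getElem
  · simp [rel]
  · intro i h1 h2
    simp only [List.length_tail, rel_length] at h1
    simp only [FreeGroup.invRev, List.getElem_reverse, List.getElem_map, List.getElem_tail, rel,
      List.getElem_range, List.length_map, List.length_tail, List.length_range, Prod.mk.injEq,
      and_true]
    congr 2
    refine T.zpow_congr ⟨-sg c, ?_⟩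
    rw [sg_not]
    have : ((T.L - 1 - 1 - i + 1 : ℕ) : ℤ) = T.L - 1 - i := by omega
    rw [this]
    push_cast
    ring

lemma invRev_rel (φ : T.Ph) (c : Bool) :
    FreeGroup.invRev (T.rel φ c) = T.rel ((T.N ^ (-sg c)) φ) (!c) := by
  symm
  apply List.ext_getElem
  · simp [rel]
  · intro i h1 h2
    simp only [rel_length] at h1
    simp only [FreeGroup.invRev, List.getElem_reverse, List.getElem_map, rel,
      List.getElem_range, List.length_map, List.length_range, Prod.mk.injEq,
      and_true]
    rw [← Equiv.Perm.mul_apply, ← zpow_add]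
    congr 2
    refine T.zpow_congr ⟨-sg c, ?_⟩
    rw [sg_not]
    have : ((T.L - 1 - i : ℕ) : ℤ) = T.L - 1 - i := by omega
    rw [this]
    ring

lemma invRev_mem_Rel (w : List (Bool × Bool)) (hw : w ∈ T.Rel) : FreeGroup.invRev w ∈ T.Rel := by
  obtain ⟨φ, c, rfl⟩ := hw
  exact ⟨_, _, T.invRev_rel φ c⟩

lemma rotate_rel (φ : T.Ph) (c : Bool) (i : ℕ) (hi : i < T.L) :
    (T.rel φ c).drop i ++ (T.rel φ c).take i = T.rel ((T.N ^ (sg c * i)) φ) c := by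
  apply List.ext_getElem
  · simp [rel]; omega
  · intro t h1 h2
    simp only [rel_length] at h2
    rw [List.getElem_append]
    simp only [rel, List.length_drop, List.length_map, List.length_range, List.getElem_drop,
      List.getElem_take, List.getElem_map, List.getElem_range]
    rw [← Equiv.Perm.mul_apply, ← zpow_add]
    split_ifs with h
    · congr 4; push_cast; ring
    · simp only [Prod.mk.injEq, and_true]
      congr 2
      refine T.zpow_congr ⟨-sg c, ?_⟩
      have : ((t - (T.L - i) : ℕ) : ℤ) = t - (T.L - i) := by omega
      rw [this]
      ring

/-- The normal closure of the relators. -/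
abbrev R : Subgroup (FreeGroup Bool) := Subgroup.normalClosure (FreeGroup.mk '' T.Rel)

/-- The group presented by the relators. -/
abbrev G : Type := FreeGroup Bool ⧸ T.R

/-- The quotient map. -/
abbrev toG : FreeGroup Bool →* T.G := QuotientGroup.mk' T.R

end Track

lemma zmod_val_succ {n : ℕ} [NeZero n] (i : ZMod n) : (i + 1).val = (i.val + 1) % n := by
  rw [ZMod.val_add, ZMod.val_one_eq_one_mod]; simp

lemma zmod_val_succ_cases {n : ℕ} [NeZero n] (i : ZMod n) :
    (i.val + 1 < n ∧ (i + 1).val = i.val + 1) ∨ (i.val + 1 = n ∧ (i + 1).val = 0) := by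
  have := ZMod.val_lt i
  rw [zmod_val_succ]
  rcases Nat.lt_or_ge (i.val + 1) n with h | h
  · exact Or.inl ⟨h, Nat.mod_eq_of_lt h⟩
  · have : i.val + 1 = n := by omega
    exact Or.inr ⟨this, by rw [this, Nat.mod_self]⟩

lemma prod_zmod {A : Type} [CommMonoid A] {n : ℕ} [NeZero n] (g : ℕ → A) :
    ∏ i : ZMod n, g i.val = ∏ i ∈ Finset.range n, g i := by
  refine Finset.prod_bij (fun i _ => i.val) (fun i _ => Finset.mem_range.2 (ZMod.val_lt i))
    (fun i _ j _ h => ZMod.val_injective n h) (fun b hb => ?_) (fun _ _ => rfl)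
  exact ⟨(b : ZMod n), Finset.mem_univ _, ZMod.val_cast_of_lt (Finset.mem_range.1 hb)⟩

lemma IsPath.getElem {A : Type} [Group A] {h m : ℕ → A} {f : List ℕ} {c : A}
    (hp : IsPath h m c f) (i : ℕ) (hi : i < f.length) :
    m f[i] = c * ((f.take i).map h).prod := by
  have e : f = f.take i ++ f[i] :: f.drop (i + 1) := by simp
  rw [e, isPath_append] at hp
  exact hp.2.1

lemma IsPath.succ {A : Type} [Group A] {h m : ℕ → A} {f : List ℕ} {c : A}
    (hp : IsPath h m c f) (hf : (f.map h).prod = 1) (i j : ℕ) (hi : i < f.length)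
    (hj : j < f.length) (hij : (i + 1 < f.length ∧ j = i + 1) ∨ (i + 1 = f.length ∧ j = 0)) :
    m f[j] = m f[i] * h f[i] := by
  have e : ((f.take (i + 1)).map h).prod = ((f.take i).map h).prod * h f[i] := by
    rw [List.take_succ_eq_append_getElem hi, List.map_append, List.prod_append]; simp
  rcases hij with ⟨h1, rfl⟩ | ⟨h1, rfl⟩
  · rw [hp.getElem _ h1, hp.getElem _ hi, e, mul_assoc]
  · rw [hp.getElem _ hj, hp.getElem _ hi, mul_assoc, ← e, h1]
    simp [hf]

/-- A reduced planar diagram over the track `T` with boundary word `x`. -/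
structure Disk (T : Track) (n : ℕ) (x : ZMod n → Bool × Bool) where
  k : ℕ
  c : Fin k → Bool
  ph : Fin k → ZMod T.L → T.Ph
  ph_succ : ∀ j i, ph j (i + 1) = (T.N ^ sg (c j)) (ph j i)
  θ : (Fin k × ZMod T.L) ⊕ ZMod n → (Fin k × ZMod T.L) ⊕ ZMod n
  invol : ∀ d, θ (θ d) = d
  lab : (Fin k × ZMod T.L) ⊕ ZMod n → Bool × Bool
  lab_inl : ∀ j i, lab (.inl (j, i)) = (T.col (ph j i), c j)
  lab_inr : ∀ t, lab (.inr t) = x t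
  lab_inv : ∀ d, lab (θ d) = linv (lab d)
  reduced : ∀ j i j' i', θ (.inl (j, i)) = .inl (j', i') → ph j i ≠ ph j' i'
  nx : (Fin k × ZMod T.L) ⊕ ZMod n → (Fin k × ZMod T.L) ⊕ ZMod n
  nx_inl : ∀ j i, nx (.inl (j, i)) = .inl (j, i + 1)
  nx_inr : ∀ t, nx (.inr t) = .inr (t + 1)
  planar : ∀ h : (Fin k × ZMod T.L) ⊕ ZMod n → ℚ, (∀ d, h (θ d) = -h d) →
    (∀ j, ∑ i, h (.inl (j, i)) = 0) → ∃ m : (Fin k × ZMod T.L) ⊕ ZMod n → ℚ,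
      ∀ d, m (nx d) = m d + h d ∧ m (θ d) = m d + h d
  μ : (Fin k × ZMod T.L) ⊕ ZMod n → T.G
  μ_nx : ∀ d, μ (nx d) = μ d * T.toG (FreeGroup.mk [lab d])
  μ_θ : ∀ d, μ (θ d) = μ d * T.toG (FreeGroup.mk [lab d])

lemma pair_perm {α : Type} {l : List α} {i j : ℕ} (hi : i < l.length) (hj : j < l.length)
    (hij : i ≠ j) : ∃ l', l.Perm (l[i] :: l[j] :: l') := by
  classical
  have h1 : l.Perm (l[i] :: l.eraseIdx i) := (List.getElem_cons_eraseIdx_perm hi).symm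
  obtain ⟨s, t, hst⟩ : ∃ s t, l.eraseIdx i = s ++ l[j] :: t := by
    apply List.append_of_mem
    rw [List.mem_eraseIdx_iff_getElem]
    exact ⟨j, hj, hij.symm, rfl⟩
  exact ⟨s ++ t, h1.trans (List.Perm.cons _ (hst ▸ List.perm_middle))⟩

theorem exists_disk (T : Track) {n : ℕ} [NeZero n] (w : List (Bool × Bool)) (hn : w.length = n)
    (hw : FreeGroup.mk w ∈ T.R) :
    Nonempty (Disk T n fun t => w[t.val]'(hn ▸ ZMod.val_lt t)) := by
  classical
  have hex : ∃ k, Bounds T.Rel k w := by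
    obtain ⟨k, hk⟩ := exists_bounds T.invRev_mem_Rel hw
    exact ⟨k, hk w rfl⟩
  obtain ⟨k, hkf⟩ : ∃ k, k = Nat.find hex := ⟨_, rfl⟩
  obtain ⟨ws, hws, hwR, θ₀, lab₀, faces, D, hf⟩ := Nat.find_spec hex
  have hmin : ∀ k', k' < k → ¬ Bounds T.Rel k' w := fun k' h => Nat.find_min hex (hkf ▸ h)
  rw [← hkf] at hws
  obtain ⟨f₀, Fs, rfl, hf₀, hFs⟩ := List.map_eq_cons_iff.1 hf
  have hk : Fs.length = k := by rw [← hws, ← hFs, List.length_map]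
  have hkj : ∀ j : Fin k, j.val < Fs.length := fun j => by rw [hk]; exact j.2
  have hFR : ∀ f ∈ Fs, ∃ φ c, f.map lab₀ = T.rel φ c := fun f hf =>
    hwR _ (by rw [← hFs]; exact List.mem_map_of_mem hf)
  have hFL : ∀ f ∈ Fs, f.length = T.L := fun f hf => by
    obtain ⟨φ, c, h⟩ := hFR f hf
    rw [← T.rel_length φ c, ← h, List.length_map]
  have hjm : ∀ j : Fin k, Fs[j.val]'(hkj j) ∈ Fs := fun j => List.getElem_mem _
  have hjl : ∀ j : Fin k, (Fs[j.val]'(hkj j)).length = T.L := fun j => hFL _ (hjm j)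
  have h0l : f₀.length = n := by rw [← hn, ← hf₀, List.length_map]
  let pos : (Fin k × ZMod T.L) ⊕ ZMod n → ℕ := Sum.elim
    (fun d => (Fs[d.1.val]'(hkj d.1))[d.2.val]'(by rw [hjl]; exact ZMod.val_lt _))
    (fun t => f₀[t.val]'(by rw [h0l]; exact ZMod.val_lt _))
  have pos_mem : ∀ d, pos d ∈ (f₀ :: Fs).flatten := by
    rintro (⟨j, i⟩ | t)
    · rw [List.flatten_cons, List.mem_append]
      exact Or.inr (List.mem_flatten.2 ⟨_, hjm j, List.getElem_mem _⟩)
    · rw [List.flatten_cons, List.mem_append]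
      exact Or.inl (List.getElem_mem _)
  have pos_surj : ∀ y ∈ (f₀ :: Fs).flatten, ∃ d, pos d = y := by
    intro y hy
    rw [List.flatten_cons, List.mem_append, List.mem_flatten] at hy
    rcases hy with hy | ⟨f, hf, hy⟩
    · obtain ⟨t, ht, rfl⟩ := List.getElem_of_mem hy
      refine ⟨.inr (t : ZMod n), ?_⟩
      simp only [pos, Sum.elim_inr, ZMod.val_cast_of_lt (h0l ▸ ht)]
    · obtain ⟨j, hj, rfl⟩ := List.getElem_of_mem hf
      obtain ⟨t, ht, rfl⟩ := List.getElem_of_mem hy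
      rw [hFL _ hf] at ht
      refine ⟨.inl (⟨j, hk ▸ hj⟩, (t : ZMod T.L)), ?_⟩
      simp only [pos, Sum.elim_inl, ZMod.val_cast_of_lt ht]
  have nd := D.nodup
  rw [List.nodup_flatten, List.pairwise_cons, List.pairwise_iff_getElem] at nd
  obtain ⟨nd1, nd2, nd3⟩ := nd
  have nd3' : ∀ i j (hi : i < Fs.length) (hj : j < Fs.length), i ≠ j →
      List.Disjoint Fs[i] Fs[j] := by
    intro i j hi hj hij
    rcases lt_or_gt_of_ne hij with h | h
    · exact nd3 i j hi hj h
    · exact (nd3 j i hj hi h).symm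
  have pos_inj : Function.Injective pos := by
    rintro (⟨j, i⟩ | t) (⟨j', i'⟩ | t') h
    · simp only [pos, Sum.elim_inl] at h
      have hjj : j = j' := by
        by_contra hne
        have hb : i.val < (Fs[j.val]'(hkj j)).length := by rw [hjl]; exact ZMod.val_lt i
        have m2 : (Fs[j.val]'(hkj j))[i.val]'hb ∈ Fs[j'.val]'(hkj j') := by
          rw [h]; exact List.getElem_mem _
        exact nd3' j.val j'.val (hkj j) (hkj j') (fun h => hne (Fin.ext h))
          (List.getElem_mem hb) m2
      subst hjj
      have := (nd1 _ (List.mem_cons_of_mem _ (hjm j))).getElem_inj_iff.1 h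
      rw [ZMod.val_injective _ this]
    · simp only [pos, Sum.elim_inl, Sum.elim_inr] at h
      exact (nd2 _ (hjm j) (List.getElem_mem _) (h ▸ List.getElem_mem _)).elim
    · simp only [pos, Sum.elim_inl, Sum.elim_inr] at h
      exact (nd2 _ (hjm j') (List.getElem_mem _) (h.symm ▸ List.getElem_mem _)).elim
    · simp only [pos, Sum.elim_inr] at h
      have := (nd1 _ (List.mem_cons_self ..)).getElem_inj_iff.1 h
      rw [ZMod.val_injective _ this]
  have hθ : ∀ d, ∃ e, pos e = θ₀ (pos d) := fun d => pos_surj _ (D.mem _ (pos_mem d))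
  choose θ hθ using hθ
  let nx : (Fin k × ZMod T.L) ⊕ ZMod n → (Fin k × ZMod T.L) ⊕ ZMod n := Sum.elim
    (fun d => .inl (d.1, d.2 + 1)) (fun t => .inr (t + 1))
  have path : ∀ (A : Type) [Group A] (h : ℕ → A),
      (∀ d ∈ (f₀ :: Fs).flatten, h (θ₀ d) = (h d)⁻¹) → (∀ f ∈ f₀ :: Fs, (f.map h).prod = 1) →
      ∃ m : (Fin k × ZMod T.L) ⊕ ZMod n → A,
        ∀ d, m (nx d) = m d * h (pos d) ∧ m (θ d) = m d * h (pos d) := by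
    intro A _ h h1 h2
    obtain ⟨m, hm1, hm2⟩ := D.planar A h h1 h2
    refine ⟨fun d => m (pos d), fun d => ⟨?_, ?_⟩⟩
    · rcases d with ⟨j, i⟩ | t
      · obtain ⟨c, hc⟩ := hm2 _ (List.mem_cons_of_mem _ (hjm j))
        refine hc.succ (h2 _ (List.mem_cons_of_mem _ (hjm j))) _ _ _ _ ?_
        rw [hjl]
        exact zmod_val_succ_cases i
      · obtain ⟨c, hc⟩ := hm2 _ (List.mem_cons_self ..)
        refine hc.succ (h2 _ (List.mem_cons_self ..)) _ _ _ _ ?_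
        rw [h0l]
        exact zmod_val_succ_cases t
    · show m (pos (θ d)) = m (pos d) * h (pos d)
      rw [hθ, hm1 _ (pos_mem d)]
  choose φ₀ c₀ hφ₀ using fun j : Fin k => hFR _ (hjm j)
  have lab_pos : ∀ j i, lab₀ (pos (.inl (j, i))) =
      (T.col ((T.N ^ (sg (c₀ j) * i.val)) (φ₀ j)), c₀ j) := by
    intro j i
    have h1 : i.val < ((Fs[j.val]'(hkj j)).map lab₀).length := by
      rw [List.length_map, hjl]; exact ZMod.val_lt _
    have h2 : ((Fs[j.val]'(hkj j)).map lab₀)[i.val] = (T.rel (φ₀ j) (c₀ j))[i.val]'(by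
        rw [T.rel_length]; exact ZMod.val_lt _) := by
      congr 1; exact hφ₀ j
    rw [List.getElem_map] at h2
    simp only [Track.rel, List.getElem_map, List.getElem_range] at h2
    exact h2
  have lab_θ : ∀ d, lab₀ (pos (θ d)) = linv (lab₀ (pos d)) := fun d => by
    rw [hθ, D.lab_inv _ (pos_mem d)]
  obtain ⟨μ, hμ⟩ := path T.G (fun y => T.toG (FreeGroup.mk [lab₀ y]))
    (fun d hd => by
      rw [D.lab_inv d hd, ← map_inv, FreeGroup.inv_mk]; rfl)
    (fun f hf => by
      have key : ∀ l : List ℕ, (l.map fun y => T.toG (FreeGroup.mk [lab₀ y])).prod =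
          T.toG (FreeGroup.mk (l.map lab₀)) := by
        intro l
        induction l with
        | nil => rw [List.map_nil, List.map_nil, List.prod_nil, ← FreeGroup.one_eq_mk, map_one]
        | cons a l ih =>
          rw [List.map_cons, List.prod_cons, ih, ← map_mul, FreeGroup.mul_mk]; rfl
      rw [key, QuotientGroup.mk'_apply, QuotientGroup.eq_one_iff]
      rcases List.mem_cons.1 hf with rfl | hf
      · rwa [hf₀]
      · obtain ⟨φ, c, h⟩ := hFR f hf
        exact Subgroup.subset_normalClosure ⟨_, ⟨φ, c, rfl⟩, by rw [h]⟩)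
  refine ⟨{ k := k, c := c₀, ph := fun j i => (T.N ^ (sg (c₀ j) * i.val)) (φ₀ j), ph_succ := ?_,
            θ := θ, invol := ?_, lab := fun d => lab₀ (pos d), lab_inl := lab_pos, lab_inr := ?_,
            lab_inv := lab_θ, reduced := ?_, nx := nx, nx_inl := fun _ _ => rfl,
            nx_inr := fun _ => rfl, planar := ?_, μ := μ, μ_nx := fun d => (hμ d).1,
            μ_θ := fun d => (hμ d).2 }⟩
  · intro j i
    rw [← Equiv.Perm.mul_apply, ← zpow_add]
    congr 1
    refine T.zpow_congr ?_
    rcases zmod_val_succ_cases i with ⟨_, h⟩ | ⟨h', h⟩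
    · rw [h]; push_cast; ring_nf; simp
    · rw [h]
      refine ⟨-sg (c₀ j), ?_⟩
      have h2 : (i.val : ℤ) + 1 = T.L := by exact_mod_cast h'
      rw [← h2]; push_cast; ring
  · intro d
    apply pos_inj
    rw [hθ, hθ, D.invol _ (pos_mem d)]
  · intro t
    simp only [pos, Sum.elim_inr, ← hf₀, List.getElem_map]
  · intro j i j' i' he hph
    have hc : c₀ j' = !c₀ j := by
      have := lab_θ (.inl (j, i))
      rw [he, lab_pos, lab_pos] at this
      exact congrArg Prod.snd this
    have hjj : j.val ≠ j'.val := fun h => by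
      have h' : j = j' := Fin.ext h
      subst h'
      simp at hc
    obtain ⟨F', hF'⟩ := pair_perm (l := Fs) (hkj j) (hkj j') hjj
    let P := pos (.inl (j, i))
    have hi : i.val < (Fs[j.val]'(hkj j)).length := by rw [hjl]; exact ZMod.val_lt _
    have hi' : i'.val < (Fs[j'.val]'(hkj j')).length := by rw [hjl]; exact ZMod.val_lt _
    have e1 : Fs[j.val]'(hkj j) = (Fs[j.val]'(hkj j)).take i.val ++
        pos (.inl (j, i)) :: (Fs[j.val]'(hkj j)).drop (i.val + 1) := by
      simp [pos]
    have e2 : Fs[j'.val]'(hkj j') = (Fs[j'.val]'(hkj j')).take i'.val ++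
        θ₀ (pos (.inl (j, i))) :: (Fs[j'.val]'(hkj j')).drop (i'.val + 1) := by
      rw [← hθ, he]
      simp [pos]
    have D' := D.perm (List.Perm.cons _ hF')
    rw [e1, e2] at D'
    have hlen : F'.length + 2 = k := by rw [← hk, hF'.length_eq]; rfl
    refine hmin F'.length (by omega) (hf₀ ▸ bounds_cancel D' rfl (fun f hf => ?_) ?_)
    · obtain ⟨φ, c, h⟩ := hFR f (hF'.mem_iff.2 (by simp [hf]))
      exact ⟨φ, c, h⟩
    · have rot : ∀ (f : List ℕ) (φ : T.Ph) (c : Bool) (i : ℕ), f.map lab₀ = T.rel φ c → i < T.L →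
          (f.drop (i + 1) ++ f.take i).map lab₀ = (T.rel ((T.N ^ (sg c * i)) φ) c).tail := by
        intro f φ c i h hi
        rw [← T.rotate_rel φ c i hi, ← h, ← List.map_drop, ← List.map_take, ← List.map_append,
          ← List.map_tail]
        congr 1
        have hfl : f.length = T.L := by rw [← T.rel_length φ c, ← h, List.length_map]
        rw [List.tail_append_of_ne_nil (by rw [ne_eq, List.drop_eq_nil_iff]; omega),
          List.tail_drop]
      rw [rot _ _ _ _ (hφ₀ j) (ZMod.val_lt _), rot _ _ _ _ (hφ₀ j') (ZMod.val_lt _), hc]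
      rw [hc] at hph
      rw [← hph, T.invRev_tail]
  · intro h h1 h2
    let h' : ℕ → Multiplicative ℚ := fun y =>
      Function.extend pos (fun d => Multiplicative.ofAdd (h d)) 1 y
    have hh : ∀ d, h' (pos d) = Multiplicative.ofAdd (h d) := fun d => pos_inj.extend_apply _ _ d
    have psum : ∀ (N : ℕ) [NeZero N] (f : List ℕ) (hl : f.length = N),
        (f.map h').prod = ∏ i : ZMod N, h' (f[i.val]'(by rw [hl]; exact ZMod.val_lt _)) := by
      intro N _ f hl
      have := prod_zmod (n := N) (fun i => h' (f.getD i 0))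
      have e : ∀ i : ZMod N, f.getD i.val 0 = f[i.val]'(by rw [hl]; exact ZMod.val_lt _) := by
        intro i
        rw [List.getD_eq_getElem]
      simp only [e] at this
      rw [this]
      subst hl
      rw [Finset.prod_range, ← List.prod_ofFn]
      congr 1
      apply List.ext_getElem <;> simp
    have hcell : ∀ f ∈ Fs, (f.map h').prod = 1 := by
      intro f hf
      obtain ⟨j, hj, rfl⟩ := List.getElem_of_mem hf
      rw [psum T.L _ (hFL _ hf)]
      have := fun i => hh (.inl (⟨j, hk ▸ hj⟩, i))
      simp only [pos, Sum.elim_inl] at this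
      simp only [this]
      rw [← ofAdd_sum, h2]; rfl
    have htot : ∑ d, h d = 0 := by
      have e : ∑ d, h (θ d) = ∑ d, h d :=
        Function.Bijective.sum_comp (Function.Involutive.bijective fun d => ?_) h
      · simp only [h1, Finset.sum_neg_distrib] at e
        linarith
      · apply pos_inj
        rw [hθ, hθ, D.invol _ (pos_mem d)]
    have hout : (f₀.map h').prod = 1 := by
      rw [psum n _ h0l]
      have := fun i => hh (.inr i)
      simp only [pos, Sum.elim_inr] at this
      simp only [this]
      rw [Fintype.sum_sum_type, Fintype.sum_prod_type] at htot
      simp only [h2, Finset.sum_const_zero, zero_add] at htot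
      rw [← ofAdd_sum, htot]; rfl
    obtain ⟨m, hm⟩ := path (Multiplicative ℚ) h' (fun y hy => by
        obtain ⟨d, rfl⟩ := pos_surj y hy
        rw [← hθ, hh, hh, h1, ofAdd_neg])
      (by simpa using ⟨hout, hcell⟩)
    refine ⟨fun d => (m d).toAdd, fun d => ?_⟩
    simp only [hm, hh, toAdd_mul, toAdd_ofAdd, and_self]

section
open Finset

lemma four_le_sum {α : Type} [Fintype α] [DecidableEq α] {ν : Equiv.Perm α} {dir : α → Bool}
    {bad : α → Prop} [DecidablePred bad] (hν : ∀ d, ¬ bad (ν d) → dir (ν d) = !dir d)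
    (s : Finset α) (d : α) (hd : d ∈ s) (hs : ∀ d ∈ s, ν d ∈ s) :
    4 ≤ ∑ d ∈ s, (if bad d then 4 else if ν (ν d) = d then 2 else 1) := by
  classical
  set w : α → ℕ := fun d => if bad d then 4 else if ν (ν d) = d then 2 else 1 with hw
  by_cases hb : ∃ e ∈ s, bad e
  · obtain ⟨e, he, hbe⟩ := hb
    calc 4 = w e := by simp [hw, hbe]
      _ ≤ _ := single_le_sum (f := w) (fun _ _ => Nat.zero_le _) he
  · push Not at hb
    have hdir : ∀ d ∈ s, dir (ν d) = !dir d := fun d hd => hν d (hb _ (hs d hd))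
    have h1 := hs d hd
    have h2 := hs _ h1
    have h3 := hs _ h2
    have n1 : d ≠ ν d := fun h => by
      have := hdir d hd
      rw [← h] at this; simp at this
    by_cases hf : ν (ν d) = d
    · calc 4 = ∑ e ∈ {d, ν d}, w e := by
            rw [sum_pair n1]; simp [hw, hb d hd, hb _ h1, hf]
        _ ≤ _ := sum_le_sum_of_subset (by simp [insert_subset_iff, hd, h1])
    · have n3 : d ≠ ν (ν (ν d)) := fun h => by
        have e3 := hdir _ h2
        rw [hdir _ h1, hdir d hd, ← h] at e3; simp at e3
      have hc : ({d, ν d, ν (ν d), ν (ν (ν d))} : Finset α).card = 4 := by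
        rw [card_insert_of_notMem, card_insert_of_notMem, card_insert_of_notMem, card_singleton]
        · simpa using n1
        · simp only [mem_insert, mem_singleton, not_or, EmbeddingLike.apply_eq_iff_eq]
          exact ⟨n1, fun h => hf h.symm⟩
        · simp only [mem_insert, mem_singleton, not_or]
          exact ⟨n1, fun h => hf h.symm, n3⟩
      calc 4 = ({d, ν d, ν (ν d), ν (ν (ν d))} : Finset α).card • 1 := by rw [hc]; rfl
        _ ≤ ∑ e ∈ {d, ν d, ν (ν d), ν (ν (ν d))}, w e :=
            card_nsmul_le_sum _ _ _ fun e _ => by simp only [hw]; split_ifs <;> norm_num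
        _ ≤ _ := sum_le_sum_of_subset (by simp [insert_subset_iff, hd, h1, h2, h3])

namespace Disk
variable {T : Track} {n : ℕ} [NeZero n] {x : ZMod n → Bool × Bool} (D : Disk T n x)

/-- The darts of the diagram. -/
abbrev Dart : Type := (Fin D.k × ZMod T.L) ⊕ ZMod n

/-- The direction of a dart. -/
def dir (d : D.Dart) : Bool := (D.lab d).2

lemma dir_θ (d : D.Dart) : D.dir (D.θ d) = !D.dir d := by
  rw [dir, D.lab_inv]; rfl

lemma dir_inl (j : Fin D.k) (i : ZMod T.L) : D.dir (.inl (j, i)) = D.c j := by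
  rw [dir, D.lab_inl]

lemma dir_inr (t : ZMod n) : D.dir (.inr t) = (x t).2 := by
  rw [dir, D.lab_inr]

lemma nx_injective : Function.Injective D.nx := by
  rintro (⟨j, i⟩ | t) (⟨j', i'⟩ | t') h
  · simpa [D.nx_inl] using h
  · simp [D.nx_inl, D.nx_inr] at h
  · simp [D.nx_inl, D.nx_inr] at h
  · simpa [D.nx_inr] using h

lemma θ_injective : Function.Injective D.θ := Function.LeftInverse.injective D.invol

/-- The rotation around the vertices. -/
noncomputable def ν : Equiv.Perm D.Dart :=
  Equiv.ofBijective (fun d => D.nx (D.θ d))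
    (Finite.injective_iff_bijective.1 (D.nx_injective.comp D.θ_injective))

lemma ν_apply (d : D.Dart) : D.ν d = D.nx (D.θ d) := rfl

/-- Outer darts at which the boundary word changes direction. -/
def bad (x : ZMod n → Bool × Bool) : Finset (ZMod n) := univ.filter fun t => (x t).2 ≠ (x (t - 1)).2

/-- Darts which are outer and at a change of direction. -/
def Bad (d : D.Dart) : Prop := ∃ t ∈ bad x, d = .inr t

lemma dir_ν (d : D.Dart) (h : ¬ D.Bad (D.ν d)) : D.dir (D.ν d) = !D.dir d := by
  rw [← D.dir_θ]
  rw [ν_apply] at h ⊢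
  rcases hd : D.θ d with ⟨j, i⟩ | t
  · rw [D.nx_inl, dir_inl, dir_inl]
  · rw [hd, D.nx_inr] at h
    rw [D.nx_inr, dir_inr, dir_inr]
    by_contra hne
    exact h ⟨t + 1, by simpa [bad] using hne, rfl⟩

lemma card_dart : Fintype.card D.Dart =
    2 * Fintype.card {d : D.Dart // D.dir d = true} := by
  have h1 := Fintype.card_subtype_compl (fun d : D.Dart => D.dir d = true)
  have h3 := Fintype.card_subtype_le (fun d : D.Dart => D.dir d = true)
  have h2 : Fintype.card {d : D.Dart // ¬ D.dir d = true} =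
      Fintype.card {d : D.Dart // D.dir d = true} := by
    refine Fintype.card_congr ⟨fun d => ⟨D.θ d.1, ?_⟩, fun d => ⟨D.θ d.1, ?_⟩, ?_, ?_⟩
    · have := d.2; rw [dir_θ]; simpa using this
    · have := d.2; rw [dir_θ]; simpa using this
    · intro d; ext1; exact D.invol _
    · intro d; ext1; exact D.invol _
  omega

/-- The vertices of the diagram. -/
abbrev Vert : Type := Quotient (Equiv.Perm.SameCycle.setoid D.ν)

theorem euler [Fintype D.Vert] : Fintype.card {d : D.Dart // D.dir d = true} + 1 ≤
    Fintype.card D.Vert + D.k := by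
  classical
  let cl : D.Dart → D.Vert := Quotient.mk _
  let P := {d : D.Dart // D.dir d = true}
  let Φ : (D.Vert → ℚ) →ₗ[ℚ] (D.Dart → ℚ) :=
    { toFun := fun f d => f (cl (D.nx d)) - f (cl d)
      map_add' := fun f g => by ext d; simp; ring
      map_smul' := fun a f => by ext d; simp; ring }
  let Ψ : (P → ℚ) →ₗ[ℚ] (D.Dart → ℚ) :=
    { toFun := fun g d => if h : D.dir d = true then g ⟨d, h⟩ else
        - g ⟨D.θ d, by rw [D.dir_θ]; simpa using h⟩
      map_add' := fun f g => by ext d; simp only [Pi.add_apply]; split_ifs <;> ring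
      map_smul' := fun a f => by
        ext d; simp only [Pi.smul_apply, smul_eq_mul, RingHom.id_apply]; split_ifs <;> ring }
  have hΨ : Function.Injective Ψ := by
    intro f g h
    ext d
    have := congrFun h d.1
    simpa [Ψ, d.2] using this
  let σ : (D.Dart → ℚ) →ₗ[ℚ] (Fin D.k → ℚ) :=
    { toFun := fun h j => ∑ i, h (.inl (j, i))
      map_add' := fun f g => by ext j; simp [sum_add_distrib]
      map_smul' := fun a f => by ext j; simp [mul_sum] }
  let S := LinearMap.ker (σ ∘ₗ Ψ)
  have hS : Fintype.card P ≤ Module.finrank ℚ S + D.k := by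
    show Fintype.card P ≤ Module.finrank ℚ (LinearMap.ker (σ ∘ₗ Ψ)) + D.k
    have h1 := LinearMap.finrank_range_add_finrank_ker (σ ∘ₗ Ψ)
    have h2 := Submodule.finrank_le (LinearMap.range (σ ∘ₗ Ψ))
    rw [Module.finrank_fintype_fun_eq_card] at h1
    rw [Module.finrank_fintype_fun_eq_card, Fintype.card_fin] at h2
    omega
  have hle : S.map Ψ ≤ LinearMap.range Φ := by
    rintro _ ⟨g, hg, rfl⟩
    obtain ⟨m, hm⟩ := D.planar (Ψ g) (fun d => by
      simp only [Ψ, LinearMap.coe_mk, AddHom.coe_mk, D.dir_θ, D.invol]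
      by_cases hd : D.dir d = true <;> simp [hd]) (fun j => congrFun (LinearMap.mem_ker.1 hg) j)
    have hν : ∀ d, m (D.ν d) = m d := fun d => by
      have h3 := (hm (D.θ d)).2
      rw [D.invol] at h3
      rw [ν_apply, (hm (D.θ d)).1, h3]
    have hc : ∀ d e, D.ν.SameCycle d e → m d = m e := by
      rintro d _ ⟨z, rfl⟩
      have hz : ∀ N : ℕ, ∀ d, m ((D.ν ^ N) d) = m d := by
        intro N
        induction N with
        | zero => intro d; rfl
        | succ N ih => intro d; rw [pow_succ, Equiv.Perm.mul_apply, ih, hν]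
      rcases z with N | N
      · exact (hz N d).symm
      · rw [zpow_negSucc]
        have := hz (N + 1) ((D.ν ^ (N + 1))⁻¹ d)
        rw [← Equiv.Perm.mul_apply, mul_inv_cancel] at this
        exact this
    refine ⟨Quotient.lift m hc, ?_⟩
    ext d
    show m (D.nx d) - m d = _
    rw [(hm d).1]; ring
  have hker : 1 ≤ Module.finrank ℚ (LinearMap.ker Φ) := by
    rw [Nat.one_le_iff_ne_zero, ← Nat.pos_iff_ne_zero, Module.finrank_pos_iff]
    refine ⟨⟨⟨fun _ => 1, ?_⟩, 0, ?_⟩⟩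
    · rw [LinearMap.mem_ker]; ext d; simp [Φ]
    · intro h
      have h := congrArg Subtype.val h
      have := congrFun h (cl (.inr 0))
      simp at this
  have h1 := LinearMap.finrank_range_add_finrank_ker Φ
  rw [Module.finrank_fintype_fun_eq_card] at h1
  have h2 := Submodule.finrank_mono hle
  rw [← (Submodule.equivMapOfInjective Ψ hΨ S).finrank_eq] at h2
  show Fintype.card P + 1 ≤ _
  omega

open Classical in
theorem gauss_bonnet :
    #{d : D.Dart | ¬ D.Bad d ∧ D.ν (D.ν d) ≠ d} + 4 ≤ 4 * D.k + 2 * #(bad x) := by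
  classical
  let _ : Fintype D.Vert := Fintype.ofFinite _
  let cl : D.Dart → D.Vert := Quotient.mk _
  let w : D.Dart → ℕ := fun d => if D.Bad d then 4 else if D.ν (D.ν d) = d then 2 else 1
  have h1 := D.euler
  have h2 := D.card_dart
  have h3 : 4 * Fintype.card D.Vert ≤ ∑ d, w d := by
    rw [← sum_fiberwise univ cl w, ← card_univ, mul_comm, ← smul_eq_mul]
    refine card_nsmul_le_sum _ _ _ fun v _ => ?_
    obtain ⟨d, rfl⟩ := Quotient.exists_rep v
    refine four_le_sum D.dir_ν _ d ?_ fun e he => ?_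
    · simp [cl]
    · simp only [mem_filter, mem_univ, true_and] at he ⊢
      rw [← he]
      exact Quotient.sound (Equiv.Perm.sameCycle_apply_left.2 (Equiv.Perm.SameCycle.refl _ _))
  have hb : #{d : D.Dart | D.Bad d} = #(bad x) := by
    symm
    refine card_bij (fun t _ => .inr t) (fun t ht => ?_) (fun a _ b _ h => Sum.inr_injective h)
      (fun d hd => ?_)
    · exact mem_filter.2 ⟨mem_univ _, t, ht, rfl⟩
    · obtain ⟨t, ht, rfl⟩ := (mem_filter.1 hd).2
      exact ⟨t, ht, rfl⟩
  have h4 : ∑ d, w d + #{d : D.Dart | ¬ D.Bad d ∧ D.ν (D.ν d) ≠ d} =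
      2 * Fintype.card D.Dart + 2 * #(bad x) := by
    rw [← hb, card_filter, card_filter, ← card_univ, card_eq_sum_ones, mul_sum, mul_sum,
      ← sum_add_distrib, ← sum_add_distrib]
    refine sum_congr rfl fun d _ => ?_
    by_cases hd : D.Bad d <;> by_cases hf : D.ν (D.ν d) = d <;> simp [w, hd, hf]
  omega

/-- The corner before the dart `i` of the cell `j` is not the meeting point of just two edges. -/
def Turn (j : Fin D.k) (i : ZMod T.L) : Prop :=
  D.nx (D.θ (.inl (j, i))) ≠ D.θ (.inl (j, i - 1))

/-- The dart is glued to the boundary. -/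
def Out (j : Fin D.k) (i : ZMod T.L) : Prop := ∃ t, D.θ (.inl (j, i)) = .inr t

lemma turn_iff (j : Fin D.k) (i : ZMod T.L) :
    D.Turn j i ↔ D.ν (D.ν (.inl (j, i))) ≠ .inl (j, i) := by
  rw [Turn, not_iff_not, ν_apply D (D.ν _), ν_apply]
  have e : (Sum.inl (j, i) : D.Dart) = D.nx (.inl (j, i - 1)) := by rw [D.nx_inl]; simp
  conv_rhs => rhs; rw [e]
  rw [D.nx_injective.eq_iff]
  constructor
  · intro h; rw [h, D.invol]
  · intro h; rw [← h, D.invol]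

open Classical in
/-- The turns of a cell. -/
noncomputable def turns (j : Fin D.k) : Finset (ZMod T.L) := univ.filter fun i => D.Turn j i

open Classical in
/-- The turns of a cell at edges glued to the boundary. -/
noncomputable def outTurns (j : Fin D.k) : Finset (ZMod T.L) :=
  univ.filter fun i => D.Turn j i ∧ D.Out j i

open Classical in
theorem curvature :
    ∑ j, ((#(D.turns j) : ℤ) + #(D.outTurns j) - 4) + 4 ≤ 3 * #(bad x) := by
  classical
  have h := D.gauss_bonnet
  have hk : ∑ j, (#(D.turns j)) + #{t : ZMod n | t ∉ bad x ∧ D.ν (D.ν (.inr t)) ≠ .inr t} =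
      #{d : D.Dart | ¬ D.Bad d ∧ D.ν (D.ν d) ≠ d} := by
    simp only [turns, card_filter]
    rw [Fintype.sum_sum_type, Fintype.sum_prod_type]
    congr 1
    · refine sum_congr rfl fun j _ => sum_congr rfl fun i _ => ?_
      simp [turn_iff, Bad]
    · refine sum_congr rfl fun t _ => ?_
      simp [Bad]
  have ho : ∑ j, (#(D.outTurns j)) ≤
      #{t : ZMod n | t ∉ bad x ∧ D.ν (D.ν (.inr t)) ≠ .inr t} + #(bad x) := by
    calc ∑ j, (#(D.outTurns j)) = #(univ.sigma fun j => D.outTurns j) := (card_sigma _ _).symm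
      _ ≤ #(univ.filter (fun t : ZMod n => D.ν (D.ν (.inr t)) ≠ .inr t)) := by
        have hout : ∀ p : (_ : Fin D.k) × ZMod T.L, p ∈ univ.sigma (fun j => D.outTurns j) →
            ∃ t, D.θ (.inl (p.1, p.2)) = .inr t := fun p hp => by
          simp only [outTurns, mem_sigma, mem_univ, true_and, mem_filter] at hp
          exact hp.2
        choose f hf using hout
        refine card_le_card_of_injOn (fun p => if hp : p ∈ univ.sigma (fun j => D.outTurns j) then
          f p hp + 1 else 0) (fun p hp => ?_) (fun p hp p' hp' h => ?_)
        · have hp' : p ∈ univ.sigma (fun j => D.outTurns j) := hp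
          have e : D.ν (.inl (p.1, p.2)) = .inr (f p hp' + 1) := by
            rw [ν_apply, hf, D.nx_inr]
          simp only [dif_pos hp', coe_filter, mem_univ, true_and, Set.mem_ofPred_eq]
          rw [← e, ne_eq, EmbeddingLike.apply_eq_iff_eq]
          simp only [outTurns, mem_sigma, mem_univ, true_and, mem_filter] at hp'
          exact (D.turn_iff _ _).1 hp'.1
        · have hq : p ∈ univ.sigma (fun j => D.outTurns j) := hp
          have hq' : p' ∈ univ.sigma (fun j => D.outTurns j) := hp'
          simp only [dif_pos hq, dif_pos hq', add_left_inj] at h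
          have h1 := hf p hq
          rw [h, ← hf p' hq'] at h1
          have := D.θ_injective h1
          simp only [Sum.inl.injEq, Prod.mk.injEq] at this
          exact Sigma.ext this.1 (heq_of_eq this.2)
      _ ≤ #((univ.filter fun t : ZMod n => t ∉ bad x ∧ D.ν (D.ν (.inr t)) ≠ .inr t) ∪ bad x) := by
        refine card_le_card fun t ht => ?_
        by_cases hb : t ∈ bad x
        · simp [hb]
        · simpa [hb] using ht
      _ ≤ _ := card_union_le _ _
  have e : ∑ j, ((#(D.turns j) : ℤ) + #(D.outTurns j) - 4) =
      ((∑ j, #(D.turns j) : ℕ) : ℤ) + (∑ j, #(D.outTurns j) : ℕ) - 4 * D.k := by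
    push_cast
    rw [sum_sub_distrib, sum_add_distrib]; simp; ring
  rw [e]
  omega

end Disk
namespace Track
variable (T : Track)

/-- The sign sequence `ω` follows the track from the phase `ψ` for `u` steps from `s`. -/
def Carry (ω : ℤ → Bool) (u : ℕ) (s : ℤ) (ψ : T.Ph) : Prop :=
  ∀ m : ℕ, m < u → ω (s + m) = T.col ((T.N ^ (m : ℤ)) ψ)

/-- A relator turn cannot be completed to `ω` by a single arc shared with another relator. -/
def Tame (ω : ℤ → Bool) : Prop :=
  ∀ (s : ℤ) (ψ : T.Ph) (u : ℕ), 1 ≤ u → u ≤ T.L → T.Carry ω u s ψ → u < T.L ∧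
    ∀ ψ', (∀ m : ℕ, m < T.L - u →
      T.col ((T.N ^ (m : ℤ)) ψ') = T.col ((T.N ^ (u + m : ℤ)) ψ)) → ψ' = (T.N ^ (u : ℤ)) ψ

/-- `ω` never follows the track for long. -/
def Short (ω : ℤ → Bool) : Prop :=
  ∀ (s : ℤ) (ψ : T.Ph) (u : ℕ), T.Carry ω u s ψ → u + 2 * T.K < T.L

lemma Short.tame {T : Track} {ω : ℤ → Bool} (h : T.Short ω) : T.Tame ω := by
  intro s ψ u _ _ hc
  have := h s ψ u hc
  refine ⟨by omega, fun ψ' h' => T.sep _ _ fun i hi => ?_⟩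
  have := T.K_pos
  rw [h' i (by omega), ← Equiv.Perm.mul_apply, ← zpow_add, add_comm]

end Track

/-- Two sign sequences written on parts of a cyclic word. -/
structure Regions (n : ℕ) (x : ZMod n → Bool × Bool) where
  ω : Bool → ℤ → Bool
  δ : Bool → Bool
  reg : ZMod n → Option Bool
  idx : ZMod n → ℤ
  hx : ∀ t b, reg t = some b → x t = (ω b (idx t), δ b)
  step : ∀ t b b', reg t = some b → reg (t + 1) = some b' → b' = b ∧ idx (t + 1) = idx t + sg (δ b)

namespace Disk
variable {T : Track} {n : ℕ} [NeZero n] {x : ZMod n → Bool × Bool} (D : Disk T n x)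

lemma ph_add (j : Fin D.k) (i : ZMod T.L) (m : ℕ) :
    D.ph j (i + m) = (T.N ^ (sg (D.c j) * m)) (D.ph j i) := by
  induction m with
  | zero => simp
  | succ m ih =>
    rw [Nat.cast_succ, ← add_assoc, D.ph_succ, ih, ← Equiv.Perm.mul_apply, ← zpow_add]
    congr 2; push_cast; ring

lemma run_out {j : Fin D.k} {i : ZMod T.L} {u : ℕ} {t : ZMod n}
    (h : ∀ m : ℕ, 1 ≤ m → m < u → ¬ D.Turn j (i + m)) (ht : D.θ (.inl (j, i)) = .inr t) :
    ∀ m : ℕ, m < u → D.θ (.inl (j, i + m)) = .inr (t - m) := by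
  intro m
  induction m with
  | zero => simp [ht]
  | succ m ih =>
    intro hm
    have h1 := h (m + 1) (by omega) hm
    rw [Turn, not_not] at h1
    rw [Nat.cast_succ, ← add_assoc, add_sub_cancel_right, ih (by omega)] at h1
    rw [Nat.cast_succ, ← add_assoc]
    apply D.nx_injective
    rw [h1, D.nx_inr]; congr 1; push_cast; ring

lemma run_in {j : Fin D.k} {i : ZMod T.L} {u : ℕ} {j' : Fin D.k} {i' : ZMod T.L}
    (h : ∀ m : ℕ, 1 ≤ m → m < u → ¬ D.Turn j (i + m)) (ht : D.θ (.inl (j, i)) = .inl (j', i')) :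
    ∀ m : ℕ, m < u → D.θ (.inl (j, i + m)) = .inl (j', i' - m) := by
  intro m
  induction m with
  | zero => simp [ht]
  | succ m ih =>
    intro hm
    have h1 := h (m + 1) (by omega) hm
    rw [Turn, not_not] at h1
    rw [Nat.cast_succ, ← add_assoc, add_sub_cancel_right, ih (by omega)] at h1
    rw [Nat.cast_succ, ← add_assoc]
    apply D.nx_injective
    rw [h1, D.nx_inl]; congr 2; ring

lemma out_iff {j : Fin D.k} {i : ZMod T.L} (h : ¬ D.Turn j i) : D.Out j i ↔ D.Out j (i - 1) := by
  rw [Turn, not_not] at h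
  rw [Out, Out, ← h]
  constructor
  · rintro ⟨t, ht⟩; exact ⟨t + 1, by rw [ht, D.nx_inr]⟩
  · rintro ⟨t, ht⟩
    refine ⟨t - 1, D.nx_injective ?_⟩
    rw [ht, D.nx_inr]; simp

lemma exists_inner {j : Fin D.k} {i : ZMod T.L} (h : ¬ D.Out j i) :
    ∃ p : Fin D.k × ZMod T.L, D.θ (.inl (j, i)) = .inl p := by
  rcases hd : D.θ (.inl (j, i)) with p | t
  · exact ⟨p, rfl⟩
  · exact (h ⟨t, hd⟩).elim

lemma glue_inner {j j' : Fin D.k} {i i' : ZMod T.L} (h : D.θ (.inl (j, i)) = .inl (j', i')) :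
    D.c j' = !D.c j ∧ T.col (D.ph j' i') = T.col (D.ph j i) := by
  have := D.lab_inv (.inl (j, i))
  rw [h, D.lab_inl, D.lab_inl] at this
  exact ⟨congrArg Prod.snd this, congrArg Prod.fst this⟩

/-- Two cells sharing an arc have equally coloured phases along the arc, read forwards. -/
lemma arc_inner {j j' : Fin D.k} {i i' : ZMod T.L} {u : ℕ} (hu : 1 ≤ u)
    (h : ∀ m : ℕ, m < u → D.θ (.inl (j, i + m)) = .inl (j', i' - m)) :
    ∃ a a' : ZMod T.L, D.θ (.inl (j, a)) = .inl (j', a') ∧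
      (a = if D.c j then i else i + (u - 1 : ℕ)) ∧
      ∀ m : ℕ, m < u → T.col ((T.N ^ (m : ℤ)) (D.ph j' a')) = T.col ((T.N ^ (m : ℤ)) (D.ph j a)) := by
  have hc := (D.glue_inner (h 0 (by omega))).1
  cases hj : D.c j
  · refine ⟨i + (u - 1 : ℕ), i' - (u - 1 : ℕ), h _ (by omega), by simp, fun m hm => ?_⟩
    have h1 := (D.glue_inner (h (u - 1 - m) (by omega))).2
    have e1 := D.ph_add j (i + (u - 1 - m : ℕ)) m
    have e2 := D.ph_add j' (i' - (u - 1 : ℕ)) m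
    rw [hc, hj] at e2
    rw [hj] at e1
    simp only [sg_false, Bool.not_false, sg_true, one_mul] at e1 e2
    have e3 : i + (u - 1 - m : ℕ) + m = i + (u - 1 : ℕ) := by
      rw [add_assoc, ← Nat.cast_add]; congr 2; omega
    have e4 : i' - (u - 1 : ℕ) + m = i' - (u - 1 - m : ℕ) := by
      have : ((u - 1 : ℕ) : ZMod T.L) = (u - 1 - m : ℕ) + m := by
        rw [← Nat.cast_add]; congr 1; omega
      rw [this]; ring
    rw [← e2, e4, h1, ← e3, e1, ← Equiv.Perm.mul_apply, ← zpow_add]; simp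
  · refine ⟨i, i', by simpa using h 0 (by omega), by simp, fun m hm => ?_⟩
    have h1 := (D.glue_inner (h m hm)).2
    have e1 := D.ph_add j i m
    have e2 := D.ph_add j' (i' - m) m
    rw [hc, hj] at e2
    rw [hj] at e1
    simp only [sg_false, Bool.not_true, sg_true, one_mul] at e1 e2
    rw [← e1, ← h1]
    have e4 : i' - (m : ZMod T.L) + m = i' := by ring
    rw [e4] at e2
    rw [e2, ← Equiv.Perm.mul_apply, ← zpow_add]; simp

lemma inner_run_short {j : Fin D.k} {i : ZMod T.L} (ho : ¬ D.Out j i)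
    (h : ∀ m : ℕ, 1 ≤ m → m < T.K + 1 → ¬ D.Turn j (i + m)) : False := by
  obtain ⟨⟨j', i'⟩, hp⟩ := D.exists_inner ho
  obtain ⟨a, a', h1, _, h2⟩ := D.arc_inner (by omega) (D.run_in h hp)
  exact D.reduced _ _ _ _ h1 (T.sep _ _ fun m hm => (h2 m (by omega)).symm)

open Classical in
/-- The turns of a cell at inner edges. -/
noncomputable def inTurns (j : Fin D.k) : Finset (ZMod T.L) :=
  univ.filter fun i => D.Turn j i ∧ ¬ D.Out j i

lemma card_turns (j : Fin D.k) : #(D.turns j) = #(D.outTurns j) + #(D.inTurns j) := by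
  classical
  rw [turns, outTurns, inTurns, ← card_filter_add_card_filter_not (fun i => D.Out j i),
    filter_filter, filter_filter]

open Classical in
lemma card_inner_le (j : Fin D.k) : #{i | ¬ D.Out j i} ≤ T.K * #(D.inTurns j) := by
  have hsub : ({i | ¬ D.Out j i} : Finset (ZMod T.L)) ⊆
      (range T.K ×ˢ D.inTurns j).image fun p => p.2 + (p.1 : ZMod T.L) := by
    intro i hi
    have hi : ¬ D.Out j i := by simpa using hi
    have hout : ∀ M : ℕ, (∀ m < M, ¬ D.Turn j (i - m)) → ¬ D.Out j (i - M) := by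
      intro M
      induction M with
      | zero => intro _; simpa using hi
      | succ M ih =>
        intro h
        have := ih fun m hm => h m (by omega)
        rw [D.out_iff (h M (by omega))] at this
        rwa [Nat.cast_succ, ← sub_sub]
    have hex : ∃ m, m < T.K ∧ D.Turn j (i - m) := by
      by_contra hne
      push Not at hne
      refine D.inner_run_short (hout T.K hne) fun m h1 h2 => ?_
      have := hne (T.K - m) (by omega)
      rw [Nat.cast_sub (by omega)] at this
      convert this using 1
      ring
    have hmin := Nat.find_spec hex
    rw [mem_image]
    refine ⟨(Nat.find hex, i - Nat.find hex), ?_, by simp⟩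
    rw [mem_product, mem_range, inTurns, mem_filter]
    refine ⟨hmin.1, mem_univ _, hmin.2, hout _ fun m hm ht => ?_⟩
    exact Nat.find_min hex hm ⟨hm.trans hmin.1, ht⟩
  calc _ ≤ _ := card_le_card hsub
    _ ≤ _ := card_image_le
    _ = _ := by rw [card_product, card_range]

lemma all_of_step {L : ℕ} [NeZero L] {P : ZMod L → Prop} {i : ZMod L} (h0 : P i)
    (h : ∀ i, P i → P (i - 1)) (a : ZMod L) : P a := by
  have : ∀ m : ℕ, P (i - m) := by
    intro m
    induction m with
    | zero => simpa using h0
    | succ m ih => rw [Nat.cast_succ, ← sub_sub]; exact h _ ih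
  have := this (i - a).val
  rw [ZMod.natCast_zmod_val] at this
  simpa using this

lemma no_turns {j : Fin D.k} (ho : D.outTurns j = ∅) {i : ZMod T.L} (hi : D.Out j i) :
    (∀ i, D.Out j i) ∧ ∀ i, ¬ D.Turn j i := by
  have hno : ∀ i, D.Turn j i → ¬ D.Out j i := fun i h h' => by
    have : i ∈ D.outTurns j := by simp [outTurns, h, h']
    rw [ho] at this; simp at this
  have hall : ∀ i, D.Out j i := all_of_step hi fun i h =>
    (D.out_iff fun h' => hno i h' h).1 h
  exact ⟨hall, fun i h => hno i h (hall i)⟩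

/-- A cell without turns that meets the boundary is glued to all of it. -/
lemma full {j : Fin D.k} (h : ∀ i, ¬ D.Turn j i) {i : ZMod T.L} {t : ZMod n}
    (ht : D.θ (.inl (j, i)) = .inr t) : ∀ m : ℕ, D.θ (.inl (j, i + m)) = .inr (t - m) := fun m =>
  D.run_out (u := m + 1) (fun _ _ _ => h _) ht m (by omega)

end Disk
lemma add_natCast_inj {L : ℕ} [NeZero L] {i : ZMod L} {a b : ℕ} (ha : a < L) (hb : b < L)
    (h : i + a = i + b) : a = b := by
  have := congrArg ZMod.val (add_left_cancel h)
  rwa [ZMod.val_cast_of_lt ha, ZMod.val_cast_of_lt hb] at this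

lemma exists_add_natCast {L : ℕ} [NeZero L] (i a : ZMod L) : ∃ m : ℕ, m < L ∧ a = i + m :=
  ⟨(a - i).val, ZMod.val_lt _, by rw [ZMod.natCast_zmod_val]; ring⟩

namespace Disk
variable {T : Track} {n : ℕ} [NeZero n] {x : ZMod n → Bool × Bool} (D : Disk T n x)
  (Γ : Regions n x)

/-- The cell is glued to a dart outside of the regions. -/
def Special (j : Fin D.k) : Prop := ∃ i t, D.θ (.inl (j, i)) = .inr t ∧ Γ.reg t = none

lemma glue_outer {j : Fin D.k} {i : ZMod T.L} {t : ZMod n} (h : D.θ (.inl (j, i)) = .inr t) :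
    x t = (T.col (D.ph j i), !D.c j) := by
  have := D.lab_inv (.inl (j, i))
  rwa [h, D.lab_inl, D.lab_inr] at this

lemma arc_outer {j : Fin D.k} {i : ZMod T.L} {t : ZMod n} {u : ℕ} (hu : 1 ≤ u)
    (hs : ¬ D.Special Γ j) (h : ∀ m : ℕ, m < u → D.θ (.inl (j, i + m)) = .inr (t - m)) :
    ∃ b, Γ.δ b = (!D.c j) ∧ ∀ m : ℕ, m < u → Γ.reg (t - m) = some b ∧
      Γ.idx (t - m) = Γ.idx t + sg (D.c j) * m ∧
      Γ.ω b (Γ.idx t + sg (D.c j) * m) = T.col (D.ph j (i + m)) := by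
  have hreg : ∀ m : ℕ, m < u → ∃ b, Γ.reg (t - m) = some b := fun m hm => by
    rcases hr : Γ.reg (t - m) with _ | b
    · exact (hs ⟨_, _, h m hm, hr⟩).elim
    · exact ⟨b, rfl⟩
  obtain ⟨b, hb⟩ := hreg 0 (by omega)
  rw [Nat.cast_zero, sub_zero] at hb
  have h0 := h 0 (by omega)
  rw [Nat.cast_zero, add_zero, Nat.cast_zero, sub_zero] at h0
  have hδ : Γ.δ b = !D.c j := by
    have h1 := D.glue_outer h0
    rw [Γ.hx _ _ hb] at h1
    exact congrArg Prod.snd h1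
  have key : ∀ m : ℕ, m < u → Γ.reg (t - m) = some b ∧
      Γ.idx (t - m) = Γ.idx t + sg (D.c j) * m := by
    intro m
    induction m with
    | zero => intro _; simpa using hb
    | succ m ih =>
      intro hm
      obtain ⟨b', hb'⟩ := hreg (m + 1) hm
      obtain ⟨h1, h2⟩ := ih (by omega)
      have e : t - ((m + 1 : ℕ) : ZMod n) + 1 = t - m := by push_cast; ring
      rw [← e] at h1
      obtain ⟨rfl, h3⟩ := Γ.step _ _ _ hb' h1
      refine ⟨hb', ?_⟩
      rw [e, h2, hδ, sg_not] at h3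
      have e5 : sg (D.c j) * ((m + 1 : ℕ) : ℤ) = sg (D.c j) * m + sg (D.c j) := by push_cast; ring
      rw [e5]; linarith
  refine ⟨b, hδ, fun m hm => ⟨(key m hm).1, (key m hm).2, ?_⟩⟩
  have h1 := D.glue_outer (h m hm)
  rw [Γ.hx _ _ (key m hm).1, (key m hm).2] at h1
  exact congrArg Prod.fst h1

lemma carry_of_arc {j : Fin D.k} {i : ZMod T.L} {u : ℕ} (hu : 1 ≤ u) {ω : ℤ → Bool} {s : ℤ}
    (h : ∀ m : ℕ, m < u → ω (s + sg (D.c j) * m) = T.col (D.ph j (i + m))) :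
    T.Carry ω u (if D.c j then s else s - (u - 1 : ℕ))
      (D.ph j (if D.c j then i else i + (u - 1 : ℕ))) := by
  intro m hm
  cases hc : D.c j
  · have h1 := h (u - 1 - m) (by omega)
    have e1 := D.ph_add j (i + (u - 1 - m : ℕ)) m
    rw [hc] at h1 e1
    simp only [sg_false, neg_mul, one_mul] at e1 h1
    have e3 : i + (u - 1 - m : ℕ) + m = i + (u - 1 : ℕ) := by
      rw [add_assoc, ← Nat.cast_add]; congr 2; omega
    rw [e3] at e1
    have e4 : s + -((u - 1 - m : ℕ) : ℤ) = s - (u - 1 : ℕ) + m := by omega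
    rw [e4] at h1
    simp only [Bool.false_eq_true, if_false]
    rw [h1, e1, ← Equiv.Perm.mul_apply, ← zpow_add]; simp
  · have h1 := h m hm
    rw [D.ph_add, hc] at h1
    simpa using h1

lemma single_out {j : Fin D.k} {i₀ : ZMod T.L} (h : D.outTurns j = {i₀}) :
    D.Turn j i₀ ∧ ∃ u : ℕ, 1 ≤ u ∧ u ≤ T.L ∧ (∀ m : ℕ, m < u → D.Out j (i₀ + m)) ∧
      (∀ m : ℕ, 1 ≤ m → m < u → ¬ D.Turn j (i₀ + m)) ∧
      ∀ m : ℕ, u ≤ m → m < T.L → ¬ D.Out j (i₀ + m) := by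
  classical
  have hL := T.L_large
  have hmem : ∀ i, D.Turn j i → D.Out j i → i = i₀ := fun i h1 h2 => by
    have : i ∈ D.outTurns j := by simp [outTurns, h1, h2]
    rwa [h, mem_singleton] at this
  have h0 : D.Turn j i₀ ∧ D.Out j i₀ := by
    have : i₀ ∈ D.outTurns j := by rw [h]; simp
    simpa [outTurns] using this
  have hne : ∀ m : ℕ, 1 ≤ m → m < T.L → i₀ + (m : ZMod T.L) ≠ i₀ := fun m h1 h2 h3 => by
    have := add_natCast_inj (a := m) (b := 0) h2 (by omega) (i := i₀) (by simpa using h3)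
    omega
  have hex : ∃ u : ℕ, 1 ≤ u ∧ (u = T.L ∨ ¬ D.Out j (i₀ + u)) := ⟨T.L, by omega, Or.inl rfl⟩
  have hmin : ∀ m : ℕ, 1 ≤ m → m < Nat.find hex → D.Out j (i₀ + m) := fun m h1 h2 => by
    have := Nat.find_min hex h2
    by_contra h3
    exact this ⟨h1, Or.inr h3⟩
  have hle : Nat.find hex ≤ T.L := Nat.find_min' hex ⟨by omega, Or.inl rfl⟩
  obtain ⟨hu1, hu2⟩ := Nat.find_spec hex
  refine ⟨h0.1, Nat.find hex, hu1, hle, fun m hm => ?_, fun m h1 h2 h3 => ?_, fun m h1 => ?_⟩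
  · rcases Nat.eq_zero_or_pos m with rfl | h1
    · simpa using h0.2
    · exact hmin m h1 hm
  · exact hne m h1 (by omega) (hmem _ h3 (hmin m h1 h2))
  · induction m, h1 using Nat.le_induction with
    | base =>
      intro h2
      rcases hu2 with h3 | h3
      · omega
      · exact h3
    | succ m h1 ih =>
      intro h2 h3
      refine hne (m + 1) (by omega) h2 (hmem _ (fun h4 => ?_) h3)
      have := (D.out_iff (by rw [Turn, not_not]; exact h4)).1 h3
      rw [Nat.cast_succ, ← add_assoc, add_sub_cancel_right] at this
      exact ih (by omega) this

/-- Cells away from the exceptional part of the boundary are non-negatively curved, and the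
flat ones are beads between two boundary arcs or lie along a sequence that is not short. -/
theorem classify (hΓ : ∀ b, T.Tame (Γ.ω b)) (hspec : ∃ t, Γ.reg t = none) {j : Fin D.k}
    (hs : ¬ D.Special Γ j) : 4 ≤ #(D.turns j) + #(D.outTurns j) ∧
      (#(D.turns j) + #(D.outTurns j) = 4 → ((∀ i, D.Out j i) ∧ #(D.turns j) = 2) ∨
        ∃ b, ¬ T.Short (Γ.ω b) ∧ ∀ i t, D.θ (.inl (j, i)) = .inr t → Γ.reg t = some b) := by
  classical
  have hL := T.L_large
  have hK := T.K_pos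
  have hcard := D.card_turns j
  have hin := D.card_inner_le j
  rcases Nat.lt_trichotomy (#(D.outTurns j)) 1 with ho | ho | ho
  · have ho : D.outTurns j = ∅ := by rw [← card_eq_zero]; omega
    have hout : ∀ i, ¬ D.Out j i := fun i hi => by
      obtain ⟨t, ht⟩ := hi
      obtain ⟨t₀, ht₀⟩ := hspec
      have := D.full (D.no_turns ho ⟨t, ht⟩).2 ht (t - t₀).val
      rw [ZMod.natCast_zmod_val, sub_sub_cancel] at this
      exact hs ⟨_, _, this, ht₀⟩
    have h1 : #{i | ¬ D.Out j i} = T.L := by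
      rw [filter_true_of_mem fun i _ => hout i, card_univ, ZMod.card]
    rw [h1] at hin
    have h5 : 4 < #(D.inTurns j) := by
      by_contra h
      have := Nat.mul_le_mul_left T.K (not_lt.1 h)
      omega
    rw [ho] at hcard ⊢
    simp only [card_empty] at hcard ⊢
    omega
  · obtain ⟨i₀, hi₀⟩ := card_eq_one.1 ho
    obtain ⟨hT, u, hu1, hu2, hout, hflat, hinn⟩ := D.single_out hi₀
    obtain ⟨t, ht⟩ := hout 0 (by omega)
    rw [Nat.cast_zero, add_zero] at ht
    have hrun := D.run_out hflat ht
    obtain ⟨b, hδ, hb⟩ := D.arc_outer Γ hu1 hs hrun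
    have hcarry := D.carry_of_arc hu1 fun m hm => (hb m hm).2.2
    obtain ⟨huL, hpiece⟩ := hΓ b _ _ u hu1 hu2 hcarry
    have hturn : D.Turn j (i₀ + u) := by
      by_contra h
      have h1 := D.out_iff h
      have e : i₀ + (u : ZMod T.L) - 1 = i₀ + (u - 1 : ℕ) := by
        rw [Nat.cast_sub hu1]; push_cast; ring
      rw [e] at h1
      exact hinn u le_rfl huL (h1.2 (hout _ (by omega)))
    have hmemu : i₀ + (u : ZMod T.L) ∈ D.inTurns j := by
      simp [inTurns, hturn, hinn u le_rfl huL]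
    have htwo : 2 ≤ #(D.inTurns j) := by
      by_contra hlt
      have hone : #(D.inTurns j) ≤ 1 := by omega
      have huniq : ∀ m : ℕ, 1 ≤ m → m < T.L - u → ¬ D.Turn j (i₀ + u + m) := fun m h1 h2 h3 => by
        have h4 : i₀ + u + (m : ZMod T.L) = i₀ + (u + m : ℕ) := by push_cast; ring
        rw [h4] at h3
        have h5 : i₀ + ((u + m : ℕ) : ZMod T.L) ∈ D.inTurns j := by
          have := hinn (u + m) (by omega) (by omega)
          simp only [inTurns, mem_filter, mem_univ, true_and]
          exact ⟨h3, this⟩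
        have := add_natCast_inj (by omega) (by omega) (card_le_one.1 hone _ hmemu _ h5)
        omega
      obtain ⟨⟨j', i'⟩, hp⟩ := D.exists_inner (hinn u le_rfl huL)
      obtain ⟨a, a', h1, h2, h3⟩ := D.arc_inner (by omega) (D.run_in huniq hp)
      have hph : D.ph j a = (T.N ^ (u : ℤ)) (D.ph j (if D.c j then i₀ else i₀ + (u - 1 : ℕ))) := by
        cases hc : D.c j
        · simp only [hc, Bool.false_eq_true, if_false] at h2 ⊢
          have e1 := D.ph_add j a u
          have e2 : a + u = i₀ + (u - 1 : ℕ) := by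
            have : ((T.L - u - 1 : ℕ) : ZMod T.L) + u = (u - 1 : ℕ) + ((T.L - u : ℕ) : ZMod T.L) := by
              rw [← Nat.cast_add, ← Nat.cast_add]; congr 1; omega
            have h0 : ((T.L - u : ℕ) : ZMod T.L) + u = 0 := by
              rw [← Nat.cast_add, Nat.sub_add_cancel hu2, ZMod.natCast_self]
            rw [h2, add_assoc, this, add_assoc, add_comm (u : ZMod T.L), add_assoc, h0, add_zero]
          rw [← e2, e1, hc, ← Equiv.Perm.mul_apply, ← zpow_add]; simp
        · simp only [hc, if_true] at h2 ⊢
          rw [h2, D.ph_add, hc]; simp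
      refine D.reduced _ _ _ _ h1 ?_
      rw [hph]
      symm
      refine hpiece _ fun m hm => ?_
      rw [h3 m hm, hph, ← Equiv.Perm.mul_apply, ← zpow_add, add_comm]
    refine ⟨by omega, fun h4 => Or.inr ⟨b, fun hsh => ?_, fun i t' ht' => ?_⟩⟩
    · have := hsh _ _ _ hcarry
      have hge : T.L - u ≤ #{i | ¬ D.Out j i} := by
        have hcI : #(Finset.Ico u T.L) = T.L - u := by simp
        rw [← hcI]
        refine card_le_card_of_injOn (fun m : ℕ => i₀ + (m : ZMod T.L)) (fun m hm => ?_)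
          (fun a ha b hb h => ?_)
        · simp only [coe_Ico, Set.mem_Ico] at hm
          simpa using hinn m hm.1 hm.2
        · simp only [coe_Ico, Set.mem_Ico] at ha hb
          exact add_natCast_inj ha.2 hb.2 h
      have h6 : T.K * #(D.inTurns j) ≤ T.K * 2 := Nat.mul_le_mul_left _ (by omega)
      omega
    · obtain ⟨m, hm, rfl⟩ := exists_add_natCast i₀ i
      have hmu : m < u := by
        by_contra h
        exact hinn m (by omega) hm ⟨t', ht'⟩
      rw [hrun m hmu] at ht'
      rw [← Sum.inr_injective ht']
      exact (hb m hmu).1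
  · refine ⟨by omega, fun h4 => Or.inl ⟨fun i => ?_, by omega⟩⟩
    have h0 : #(D.inTurns j) = 0 := by omega
    rw [h0, mul_zero, Nat.le_zero, card_eq_zero, filter_eq_empty_iff] at hin
    simpa using hin (mem_univ i)

end Disk
/-- The word read off the sign sequence `ω` from `a` in the direction `c`. -/
def word (ω : ℤ → Bool) (c : Bool) (a : ℤ) (n : ℕ) : List (Bool × Bool) :=
  (List.range n).map fun i : ℕ => (ω (a + sg c * i), c)

@[simp] lemma word_length (ω : ℤ → Bool) (c : Bool) (a : ℤ) (n : ℕ) :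
    (word ω c a n).length = n := by
  simp [word]

lemma word_getElem (ω : ℤ → Bool) (c : Bool) (a : ℤ) (n i : ℕ) (h : i < (word ω c a n).length) :
    (word ω c a n)[i] = (ω (a + sg c * i), c) := by
  simp [word]

lemma invRev_word (ω : ℤ → Bool) (c : Bool) (a : ℤ) (n : ℕ) :
    FreeGroup.invRev (word ω c a n) = word ω (!c) (a + sg c * (n - 1)) n := by
  apply List.ext_getElem
  · simp
  · intro i h1 h2
    simp only [FreeGroup.invRev, List.getElem_reverse, List.getElem_map, word_getElem,
      List.length_map, word_length, Prod.mk.injEq, and_true]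
    have h1 : i < n := by simpa using h1
    congr 1
    have : ((n - 1 - i : ℕ) : ℤ) = n - 1 - i := by omega
    rw [this, sg_not]; ring

namespace Disk
variable {T : Track} {n : ℕ} [NeZero n] {x : ZMod n → Bool × Bool} (D : Disk T n x)
  (Γ : Regions n x)

lemma μ_ν (d : D.Dart) : D.μ (D.nx (D.θ d)) = D.μ d := by
  have h := D.μ_θ (D.θ d)
  rw [D.invol] at h
  rw [D.μ_nx, ← h]

lemma μ_θ_eq (d : D.Dart) : D.μ (D.θ d) = D.μ (D.nx d) := by rw [D.μ_nx, D.μ_θ]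

open Classical in
lemma card_special : #{j | D.Special Γ j} ≤ #{t | Γ.reg t = none} := by
  have h : ∀ j : Fin D.k, D.Special Γ j → ∃ t, ∃ i, Γ.reg t = none ∧ D.θ (.inr t) = .inl (j, i) := by
    rintro j ⟨i, t, h1, h2⟩
    exact ⟨t, i, h2, by rw [← h1, D.invol]⟩
  choose f g hf using h
  refine card_le_card_of_injOn (fun j => if hj : D.Special Γ j then f j hj else 0)
    (fun j hj => ?_) (fun j hj j' hj' he => ?_)
  · have hj : D.Special Γ j := by simpa using hj
    simpa [hj] using (hf j hj).1
  · have hj : D.Special Γ j := by simpa using hj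
    have hj' : D.Special Γ j' := by simpa using hj'
    simp only [hj, hj', dif_pos] at he
    have h1 := (hf j hj).2
    rw [he, (hf j' hj').2] at h1
    simp only [Sum.inl.injEq, Prod.mk.injEq] at h1
    exact h1.1.symm

end Disk

theorem word_notMem {T : Track} {ω : ℤ → Bool} (hω : T.Tame ω) (a : ℤ) {n : ℕ} (hn : 1 ≤ n) :
    FreeGroup.mk (word ω true a n) ∉ T.R := by
  classical
  intro hmem
  have : NeZero n := ⟨by omega⟩
  obtain ⟨D⟩ := exists_disk T (word ω true a n) (word_length ..) hmem
  have hx : ∀ t : ZMod n, (word ω true a n)[t.val]'((word_length ω true a n).symm ▸ ZMod.val_lt t) =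
      (ω (a + t.val), true) := fun t => by
    rw [word_getElem]; simp
  let Γ : Regions n (fun t => (word ω true a n)[t.val]'((word_length ω true a n).symm ▸ ZMod.val_lt t)) :=
    { ω := fun _ => ω
      δ := fun _ => true
      reg := fun t => if t = 0 then none else some true
      idx := fun t => a + t.val
      hx := fun t b _ => hx t
      step := fun t b b' h1 h2 => by
        split_ifs at h1 h2 with h3 h4
        refine ⟨(Option.some.inj h2).symm.trans (Option.some.inj h1), ?_⟩
        rcases zmod_val_succ_cases t with ⟨_, h⟩ | ⟨_, h⟩
        · rw [h]; simp [add_assoc]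
        · exact (h4 ((ZMod.val_eq_zero _).1 h)).elim }
  have hbad : Disk.bad (fun t : ZMod n => (word ω true a n)[t.val]'((word_length ω true a n).symm ▸ ZMod.val_lt t)) = ∅ := by
    rw [Disk.bad, filter_eq_empty_iff]
    intro t _
    rw [hx, hx]; simp
  have hcurv := D.curvature
  rw [hbad, card_empty] at hcurv
  have hns : ∀ j, ¬ D.Special Γ j → (0 : ℤ) ≤ #(D.turns j) + #(D.outTurns j) - 4 := fun j hj => by
    have := (D.classify Γ (fun _ => hω) ⟨0, by simp [Γ]⟩ hj).1
    omega
  have hnone : #{t | Γ.reg t = none} = 1 := by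
    rw [card_eq_one]
    exact ⟨0, by ext t; simp [Γ]⟩
  have hsp := D.card_special Γ
  rw [hnone] at hsp
  obtain ⟨j, i, t, hji, ht⟩ : ∃ j, D.Special Γ j := by
    by_contra h
    push Not at h
    have := sum_nonneg fun j (_ : j ∈ univ) => hns j (h j)
    omega
  have ht0 : t = 0 := by by_contra h; simp [Γ, h] at ht
  have hj : D.Special Γ j := ⟨i, t, hji, ht⟩
  have hrest : (0 : ℤ) ≤ ∑ j' ∈ univ.erase j, ((#(D.turns j') : ℤ) + #(D.outTurns j') - 4) := by
    refine sum_nonneg fun j' hj' => hns j' fun h => ?_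
    exact (mem_erase.1 hj').1 (card_le_one.1 hsp _ (by simpa using h) _ (by simpa using hj))
  rw [← add_sum_erase _ _ (mem_univ j)] at hcurv
  have hturns : D.turns j = ∅ := by rw [← card_eq_zero]; omega
  have hnt : ∀ i, ¬ D.Turn j i := fun i hi => by
    have : i ∈ D.turns j := by simpa [Disk.turns] using hi
    rw [hturns] at this; simp at this
  have hfull := D.full hnt hji
  have e1 : n ∣ T.L := by
    have := hfull T.L
    rw [ZMod.natCast_self, add_zero, hji] at this
    rw [← ZMod.natCast_eq_zero_iff]
    have := Sum.inr_injective this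
    rwa [eq_comm, sub_eq_self] at this
  have e2 : T.L ∣ n := by
    have := hfull n
    rw [ZMod.natCast_self, sub_zero, ← hji] at this
    have := D.θ_injective this
    rw [← ZMod.natCast_eq_zero_iff]
    simpa using this
  have hnL : n = T.L := Nat.dvd_antisymm e1 e2
  have hfull' : ∀ m : ℕ, D.θ (.inl (j, i + 1 + m)) = .inr (-1 - m) := fun m => by
    have := hfull (m + 1)
    rw [ht0] at this
    rw [add_assoc, add_comm (1 : ZMod T.L), ← Nat.cast_succ, this]
    congr 1; push_cast; ring
  have hc : D.c j = false := by
    have := congrArg Prod.snd (D.glue_outer hji)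
    simp only [hx] at this
    simpa using this.symm
  refine lt_irrefl _ (hω _ _ T.L (by have := T.L_large; omega) le_rfl (D.carry_of_arc (j := j)
    (i := i + 1) (s := a + (n - 1)) (by have := T.L_large; omega) fun m hm => ?_)).1
  have h1 := congrArg Prod.fst (D.glue_outer (hfull' m))
  simp only [hx] at h1
  rw [← h1, hc]
  congr 1
  have : (-1 - m : ZMod n) = ((n - 1 - m : ℕ) : ZMod n) := by
    rw [Nat.cast_sub (by omega), Nat.cast_sub hn]; simp
  rw [this, ZMod.val_cast_of_lt (by omega)]
  simp only [sg_false]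
  omega

namespace Disk
variable {T : Track} {n : ℕ} [NeZero n] {x : ZMod n → Bool × Bool} (D : Disk T n x)
  (Γ : Regions n x)

lemma μ_ne {ω : ℤ → Bool} (hω : T.Tame ω) {t : ZMod n} {a : ℤ} {c : Bool} {m : ℕ} (hm : 1 ≤ m)
    (h : ∀ i : ℕ, i < m → x (t + i) = (ω (a + sg c * i), c)) :
    D.μ (.inr (t + m)) ≠ D.μ (.inr t) := by
  have key : ∀ l : ℕ, l ≤ m →
      D.μ (.inr (t + l)) = D.μ (.inr t) * T.toG (FreeGroup.mk (word ω c a l)) := by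
    intro l
    induction l with
    | zero => intro _; simp [word, ← FreeGroup.one_eq_mk]
    | succ l ih =>
      intro hl
      have h1 := D.μ_nx (.inr (t + l))
      rw [D.nx_inr, D.lab_inr, h l (by omega), ih (by omega), mul_assoc, ← map_mul,
        FreeGroup.mul_mk] at h1
      rw [Nat.cast_succ, ← add_assoc, h1]
      simp [word, List.range_succ]
  intro he
  have h1 := key m le_rfl
  rw [he, left_eq_mul, QuotientGroup.mk'_apply, QuotientGroup.eq_one_iff] at h1
  cases c
  · have h2 := inv_mem h1
    rw [FreeGroup.inv_mk, invRev_word] at h2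
    exact word_notMem hω _ hm h2
  · exact word_notMem hω _ hm h1

/-- Vertices along each region are distinct. -/
def Simple : Prop := ∀ b t t', Γ.reg t = some b → Γ.reg t' = some b →
  D.μ (.inr (t + 1)) = D.μ (.inr t') → t' = t + 1

/-- A boundary dart of the region `true` at an edge of a generic kind. -/
def Good (t : ZMod n) : Prop :=
  (∃ t' b, D.θ (.inr t) = .inr t' ∧ Γ.reg t' = some b) ∨
    ∃ j i, D.θ (.inr t) = .inl (j, i) ∧ ¬ D.Special Γ j ∧ (∀ i, D.Out j i) ∧ #(D.turns j) = 2

open Classical in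
theorem card_not_good (hΓ : T.Tame (Γ.ω false)) (hΓ' : T.Short (Γ.ω true))
    (hspec : ∃ t, Γ.reg t = none) : #{t | Γ.reg t = some true ∧ ¬ D.Good Γ t} ≤
      (1 + 11 * T.L) * #{t | Γ.reg t = none} := by
  have hT : ∀ b, T.Tame (Γ.ω b) := fun b => by cases b; exacts [hΓ, hΓ'.tame]
  set S : Finset (ZMod n) := {t | Γ.reg t = none} with hS
  have hbad : #(bad x) ≤ 2 * #S := by
    have hsub : bad x ⊆ S ∪ S.image (fun t => t + 1) := by
      intro t ht
      simp only [bad, mem_filter, mem_univ, true_and] at ht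
      rw [mem_union, mem_image]
      rcases h1 : Γ.reg t with _ | b
      · exact Or.inl (by simpa [hS] using h1)
      rcases h2 : Γ.reg (t - 1) with _ | b'
      · exact Or.inr ⟨t - 1, by simpa [hS] using h2, by ring⟩
      have e : t - 1 + 1 = t := by ring
      rw [← e] at h1
      obtain ⟨rfl, -⟩ := Γ.step _ _ _ h2 h1
      rw [e] at h1
      rw [Γ.hx _ _ h1, Γ.hx _ _ h2] at ht
      simp at ht
    calc _ ≤ _ := card_le_card hsub
      _ ≤ _ := card_union_le _ _
      _ ≤ #S + #S := Nat.add_le_add_left card_image_le _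
      _ = _ := by ring
  set J : Finset (Fin D.k) := {j | D.Special Γ j} with hJ
  have hJS : #J ≤ #S := D.card_special Γ
  set P : Finset (Fin D.k) := {j | ¬ D.Special Γ j ∧ 4 < #(D.turns j) + #(D.outTurns j)} with hP
  have hPJ : (#P : ℤ) ≤ 3 * #(bad x) + 4 * #J := by
    have h1 : ∑ j, ((if j ∈ P then (1 : ℤ) else 0) - if j ∈ J then 4 else 0) ≤
        ∑ j, ((#(D.turns j) : ℤ) + #(D.outTurns j) - 4) := by
      refine sum_le_sum fun j _ => ?_
      by_cases hj : D.Special Γ j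
      · have h2 : j ∉ P := by simp [hP, hj]
        have h3 : j ∈ J := by simp [hJ, hj]
        rw [if_neg h2, if_pos h3]
        omega
      · have h3 : j ∉ J := by simp [hJ, hj]
        have h4 := (D.classify Γ hT hspec hj).1
        rw [if_neg h3]
        split_ifs with h5
        · have := (mem_filter.1 h5).2.2
          omega
        · omega
    rw [sum_sub_distrib, sum_ite_mem, sum_ite_mem] at h1
    simp only [univ_inter, sum_const, nsmul_eq_mul, mul_one] at h1
    have := D.curvature
    omega
  have hsub : ({t | Γ.reg t = some true ∧ ¬ D.Good Γ t} : Finset (ZMod n)).image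
      (fun t => D.θ (.inr t)) ⊆ S.image .inr ∪ ((J ∪ P) ×ˢ univ).image .inl := by
    intro d hd
    obtain ⟨t, ht, rfl⟩ := mem_image.1 hd
    obtain ⟨ht1, ht2⟩ := (mem_filter.1 ht).2
    rw [mem_union, mem_image, mem_image]
    rcases he : D.θ (.inr t) with ⟨j, i⟩ | t'
    · refine Or.inr ⟨(j, i), ?_, rfl⟩
      rw [mem_product, mem_union]
      refine ⟨?_, mem_univ _⟩
      by_contra hne
      push Not at hne
      have hj : ¬ D.Special Γ j := by simpa [hJ] using hne.1
      obtain ⟨h4, h5⟩ := D.classify Γ hT hspec hj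
      have h6 : ¬ 4 < #(D.turns j) + #(D.outTurns j) := fun h => hne.2 (by simp [hP, hj, h])
      rcases h5 (by omega) with ⟨h7, h8⟩ | ⟨b, h7, h8⟩
      · exact ht2 (Or.inr ⟨j, i, he, hj, h7, h8⟩)
      · have := h8 i t (by rw [← he, D.invol])
        rw [ht1] at this
        rw [← Option.some.inj this] at h7
        exact h7 hΓ'
    · refine Or.inl ⟨t', ?_, rfl⟩
      rcases hr : Γ.reg t' with _ | b
      · simpa [hS] using hr
      · exact (ht2 (Or.inl ⟨t', b, he, hr⟩)).elim
  have h1 := card_le_card hsub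
  rw [card_image_of_injective _ (fun a b h => Sum.inr_injective (D.θ_injective h))] at h1
  have h2 : #(S.image (Sum.inr : _ → D.Dart) ∪ ((J ∪ P) ×ˢ univ).image .inl) ≤
      #S + (#J + #P) * T.L := by
    refine (card_union_le _ _).trans (Nat.add_le_add card_image_le (card_image_le.trans ?_))
    rw [card_product, card_univ, ZMod.card]
    exact Nat.mul_le_mul_right _ (card_union_le _ _)
  have h3 : #J + #P ≤ 11 * #S := by omega
  calc _ ≤ _ := h1.trans h2
    _ ≤ #S + 11 * #S * T.L := Nat.add_le_add_left (Nat.mul_le_mul_right _ h3) _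
    _ = _ := by ring

end Disk
/-- A chain of relator turns, each split into an arc along `ω` and an arc along `ω'`; the arcs
along `ω` are consecutive upwards from `a`, those along `ω'` are consecutive downwards from `c`. -/
def Track.Chain (T : Track) (ω ω' : ℤ → Bool) : ℕ → ℤ → ℤ → Prop
  | 0, _, _ => True
  | k + 1, a, c => ∃ (l : ℕ) (φ : T.Ph), 0 < l ∧ l < T.L ∧ T.Carry ω l a φ ∧
      T.Carry ω' (T.L - l) (c - (T.L - l)) ((T.N ^ (l : ℤ)) φ) ∧
      Track.Chain T ω ω' k (a + l) (c - (T.L - l))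

namespace Disk
variable {T : Track} {n : ℕ} [NeZero n] {x : ZMod n → Bool × Bool} (D : Disk T n x)
  (Γ : Regions n x)

lemma vertex_eq {j : Fin D.k} {i : ZMod T.L} {t t' : ZMod n} (h : D.θ (.inl (j, i)) = .inr t)
    (h' : D.θ (.inl (j, i - 1)) = .inr t') : D.μ (.inr (t + 1)) = D.μ (.inr t') := by
  have h1 := D.μ_ν (.inl (j, i))
  rw [h, D.nx_inr] at h1
  have h2 := D.μ_θ_eq (.inl (j, i - 1))
  rw [h', D.nx_inl, sub_add_cancel] at h2
  rw [h1, h2]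

lemma turn_regions (hS : D.Simple Γ) {j : Fin D.k} {i : ZMod T.L} (hT : D.Turn j i)
    {t t' : ZMod n} (h : D.θ (.inl (j, i)) = .inr t) (h' : D.θ (.inl (j, i - 1)) = .inr t')
    {b b' : Bool} (hb : Γ.reg t = some b) (hb' : Γ.reg t' = some b') : b ≠ b' := by
  rintro rfl
  have := hS b t t' hb hb' (D.vertex_eq h h')
  apply hT
  rw [h, h', D.nx_inr, this]

lemma region_of_not_special {j : Fin D.k} (hs : ¬ D.Special Γ j) {i : ZMod T.L} {t : ZMod n}
    (h : D.θ (.inl (j, i)) = .inr t) : ∃ b, Γ.reg t = some b ∧ Γ.δ b = !D.c j := by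
  rcases hr : Γ.reg t with _ | b
  · exact (hs ⟨i, t, h, hr⟩).elim
  · refine ⟨b, rfl, ?_⟩
    have h1 := D.glue_outer h
    rw [Γ.hx _ _ hr] at h1
    exact congrArg Prod.snd h1

lemma idx_add {t : ZMod n} {b : Bool} {M : ℕ} (h : ∀ m : ℕ, m < M → Γ.reg (t + m) = some b) :
    ∀ m : ℕ, m < M → Γ.idx (t + m) = Γ.idx t + sg (Γ.δ b) * m := by
  intro m
  induction m with
  | zero => simp
  | succ m ih =>
    intro hm
    have h1 := h (m + 1) hm
    rw [Nat.cast_succ, ← add_assoc] at h1 ⊢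
    rw [(Γ.step _ _ _ (h m (by omega)) h1).2, ih (by omega)]
    push_cast; ring

lemma idx_sub {t : ZMod n} {b : Bool} {M : ℕ} (h : ∀ m : ℕ, m < M → Γ.reg (t - m) = some b) :
    ∀ m : ℕ, m < M → Γ.idx (t - m) = Γ.idx t - sg (Γ.δ b) * m := by
  intro m
  induction m with
  | zero => simp
  | succ m ih =>
    intro hm
    have h1 := h m (by omega)
    have e : t - ((m + 1 : ℕ) : ZMod n) + 1 = t - m := by push_cast; ring
    rw [← e] at h1
    have h2 := (Γ.step _ _ _ (h (m + 1) hm) h1).2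
    rw [e, ih (by omega)] at h2
    have e5 : sg (Γ.δ b) * ((m + 1 : ℕ) : ℤ) = sg (Γ.δ b) * m + sg (Γ.δ b) := by push_cast; ring
    rw [e5]; linarith

lemma good_parallel (hS : D.Simple Γ) (hδ : Γ.δ true ≠ Γ.δ false) {t : ZMod n}
    (ht : Γ.reg t = some true) (hg : D.Good Γ t) :
    ∃ t', D.θ (.inr t) = .inr t' ∧ Γ.reg t' = some false := by
  rcases hg with ⟨t', b, h1, h2⟩ | ⟨j, i, _, h2, h3, h4⟩
  · refine ⟨t', h1, ?_⟩
    have := D.lab_inv (.inr t)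
    rw [h1, D.lab_inr, D.lab_inr, Γ.hx _ _ ht, Γ.hx _ _ h2] at this
    have := congrArg Prod.snd this
    cases b
    · exact h2
    · simp [linv] at this
  · obtain ⟨i₀, hi₀⟩ : (D.turns j).Nonempty := by rw [← card_pos]; omega
    have hT : D.Turn j i₀ := by simpa [turns] using hi₀
    obtain ⟨t₀, ht₀⟩ := h3 i₀
    obtain ⟨t₁, ht₁⟩ := h3 (i₀ - 1)
    obtain ⟨b, hb, hb'⟩ := D.region_of_not_special Γ h2 ht₀
    obtain ⟨b₁, hb₁, hb₁'⟩ := D.region_of_not_special Γ h2 ht₁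
    have hne := D.turn_regions Γ hS hT ht₀ ht₁ hb hb₁
    rw [← hb'] at hb₁'
    exfalso
    cases b <;> cases b₁ <;> simp_all

theorem parallel_window (hS : D.Simple Γ) (hδ : Γ.δ true ≠ Γ.δ false) {t : ZMod n} {M : ℕ}
    (h : ∀ m : ℕ, m < M → Γ.reg (t + m) = some true ∧ D.Good Γ (t + m)) :
    ∃ α β : ℤ, ∀ m : ℕ, m < M → Γ.ω true (α + m) = Γ.ω false (β + m) := by
  rcases Nat.eq_zero_or_pos M with rfl | hM
  · exact ⟨0, 0, by simp⟩
  have hex : ∀ m : ℕ, ∃ t', m < M → D.θ (.inr (t + m)) = .inr t' ∧ Γ.reg t' = some false := by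
    intro m
    by_cases hm : m < M
    · obtain ⟨t', ht'⟩ := D.good_parallel Γ hS hδ (h m hm).1 (h m hm).2
      exact ⟨t', fun _ => ht'⟩
    · exact ⟨0, fun h => (hm h).elim⟩
  choose f hf using hex
  have hf0 : ∀ m : ℕ, m < M → f m = f 0 - m := by
    intro m
    induction m with
    | zero => simp
    | succ m ih =>
      intro hm
      obtain ⟨h1, h2⟩ := hf (m + 1) hm
      obtain ⟨h3, h4⟩ := hf m (by omega)
      have e1 := D.μ_ν (.inr (t + (m + 1 : ℕ)))
      rw [h1, D.nx_inr] at e1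
      have e2 := D.μ_θ_eq (.inr (t + m))
      rw [h3, D.nx_inr, add_assoc, ← Nat.cast_succ, Nat.succ_eq_add_one] at e2
      have := hS _ _ _ h2 h4 (e1.trans e2.symm)
      rw [ih (by omega)] at this
      rw [Nat.cast_succ, ← sub_sub, this]; ring
  have hδ' : Γ.δ false = !Γ.δ true := by
    revert hδ; cases Γ.δ true <;> cases Γ.δ false <;> decide
  have i1 := idx_add Γ fun m hm => (h m hm).1
  have i2 := idx_sub Γ (t := f 0) fun m hm => by rw [← hf0 m hm]; exact (hf m hm).2
  have key : ∀ m : ℕ, m < M → Γ.ω true (Γ.idx t + sg (Γ.δ true) * m) =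
      Γ.ω false (Γ.idx (f 0) + sg (Γ.δ true) * m) := by
    intro m hm
    have h1 := D.lab_inv (.inr (t + m))
    rw [(hf m hm).1, D.lab_inr, D.lab_inr, Γ.hx _ _ (h m hm).1, Γ.hx _ _ (hf m hm).2, i1 m hm,
      hf0 m hm, i2 m hm, hδ', sg_not] at h1
    have h2 := congrArg Prod.fst h1
    simp only [linv] at h2
    rw [← h2]; congr 1; ring
  cases hd : Γ.δ true
  · refine ⟨Γ.idx t - (M - 1 : ℕ), Γ.idx (f 0) - (M - 1 : ℕ), fun m hm => ?_⟩
    have := key (M - 1 - m) (by omega)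
    rw [hd] at this
    convert this using 2 <;> simp only [sg_false] <;> omega
  · refine ⟨Γ.idx t, Γ.idx (f 0), fun m hm => ?_⟩
    simpa [hd] using key m hm

/-- An arc of a bead begins along the region `true` at `t`, and its other arc ends before `c`. -/
def Start (t : ZMod n) (c : ℤ) : Prop :=
  Γ.reg t = some true ∧ ∃ j i t₂, D.θ (.inr t) = .inl (j, i) ∧ ¬ D.Special Γ j ∧
    (∀ i, D.Out j i) ∧ #(D.turns j) = 2 ∧ D.Turn j (i + 1) ∧ D.θ (.inl (j, i + 1)) = .inr t₂ ∧
    Γ.reg t₂ = some false ∧ c = Γ.idx t₂ + 1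

lemma good_antiparallel (hδ : ∀ b, Γ.δ b = true) {t : ZMod n}
    (ht : Γ.reg t = some true) (hg : D.Good Γ t) :
    ∃ j i, D.θ (.inr t) = .inl (j, i) ∧ ¬ D.Special Γ j ∧ (∀ i, D.Out j i) ∧ #(D.turns j) = 2 := by
  rcases hg with ⟨t', b, h1, h2⟩ | hg
  · have := D.lab_inv (.inr t)
    rw [h1, D.lab_inr, D.lab_inr, Γ.hx _ _ ht, Γ.hx _ _ h2] at this
    have := congrArg Prod.snd this
    simp [linv, hδ] at this
  · exact hg

lemma start_of_turn (hS : D.Simple Γ) {t : ZMod n} (ht : Γ.reg t = some true)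
    {j : Fin D.k} {i : ZMod T.L} (h1 : D.θ (.inr t) = .inl (j, i)) (h2 : ¬ D.Special Γ j)
    (h3 : ∀ i, D.Out j i) (h4 : #(D.turns j) = 2) (h5 : D.Turn j (i + 1)) :
    ∃ t₂, D.θ (.inl (j, i + 1)) = .inr t₂ ∧ D.Start Γ t (Γ.idx t₂ + 1) ∧
      Γ.reg t₂ = some false := by
  obtain ⟨t₂, ht₂⟩ := h3 (i + 1)
  obtain ⟨b, hb, _⟩ := D.region_of_not_special Γ h2 ht₂
  have h6 : D.θ (.inl (j, i + 1 - 1)) = .inr t := by rw [add_sub_cancel_right, ← h1, D.invol]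
  have := D.turn_regions Γ hS h5 ht₂ h6 hb ht
  have hb' : b = false := by simpa using this
  rw [hb'] at hb
  exact ⟨t₂, ht₂, ⟨ht, j, i, t₂, h1, h2, h3, h4, h5, ht₂, hb, rfl⟩, hb⟩

theorem start_step (hS : D.Simple Γ) (hδ : ∀ b, Γ.δ b = true) {t : ZMod n} {c : ℤ}
    (h : D.Start Γ t c) : ∃ (l : ℕ) (φ : T.Ph), 0 < l ∧ l < T.L ∧
      T.Carry (Γ.ω true) l (Γ.idx t) φ ∧
      T.Carry (Γ.ω false) (T.L - l) (c - (T.L - l)) ((T.N ^ (l : ℤ)) φ) ∧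
      (Γ.reg (t + l) = some true → D.Good Γ (t + l) →
        D.Start Γ (t + l) (c - (T.L - l)) ∧ Γ.idx (t + l) = Γ.idx t + l) := by
  classical
  obtain ⟨ht, j, i, t₂, h1, h2, h3, h4, h5, h6, h7, rfl⟩ := h
  have h1' : D.θ (.inl (j, i)) = .inr t := by rw [← h1, D.invol]
  have hcj : D.c j = false := by
    obtain ⟨b, _, hb⟩ := D.region_of_not_special Γ h2 h1'
    rw [hδ] at hb
    simpa using hb.symm
  obtain ⟨i₁, hi₁, hne⟩ : ∃ i₁ ∈ D.turns j, i₁ ≠ i + 1 := exists_mem_ne (by omega) _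
  have hmem : i + 1 ∈ D.turns j := by simpa [turns] using h5
  have hall : ∀ a, D.Turn j a → a = i + 1 ∨ a = i₁ := fun a ha => by
    have ha : a ∈ D.turns j := by simpa [turns] using ha
    have e : D.turns j = {i + 1, i₁} := by
      symm
      apply eq_of_subset_of_card_le
      · simp [insert_subset_iff, hi₁, hmem]
      · rw [h4, card_pair hne.symm]
    rw [e] at ha
    simpa using ha
  have hT1 : D.Turn j i₁ := by simpa [turns] using hi₁
  obtain ⟨l, hl, hli⟩ := exists_add_natCast i₁ (i + 1)
  have hl0 : 0 < l := by
    rcases Nat.eq_zero_or_pos l with rfl | h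
    · rw [Nat.cast_zero, add_zero] at hli; exact (hne hli.symm).elim
    · exact h
  obtain ⟨t₀, ht₀⟩ := h3 i₁
  have hrun := D.run_out (u := l) (fun m hm1 hm2 hT => by
    rcases hall _ hT with h | h
    · rw [hli] at h
      have := add_natCast_inj (by omega) hl h
      omega
    · have := add_natCast_inj (a := m) (b := 0) (i := i₁) (by omega) (by omega) (by simpa using h)
      omega) ht₀
  have hil : i₁ + ((l - 1 : ℕ) : ZMod T.L) = i := by
    rw [Nat.cast_sub hl0, Nat.cast_one, ← add_sub_assoc, ← hli]; ring
  have htl : t = t₀ - ((l - 1 : ℕ) : ZMod n) := by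
    have := hrun (l - 1) (by omega)
    rw [hil, h1'] at this
    exact Sum.inr_injective this
  obtain ⟨b, hb, harc⟩ := D.arc_outer Γ hl0 h2 hrun
  have hbt : b = true := by
    have := (harc (l - 1) (by omega)).1
    rw [← htl, ht] at this
    exact (Option.some.inj this).symm
  subst hbt
  have hidx : Γ.idx t = Γ.idx t₀ - (l - 1 : ℕ) := by
    have := (harc (l - 1) (by omega)).2.1
    rw [← htl, hcj] at this
    rw [this]; simp only [sg_false]; ring
  have hc1 := D.carry_of_arc hl0 fun m hm => (harc m hm).2.2
  rw [hcj, hil] at hc1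
  simp only [Bool.false_eq_true, if_false] at hc1
  rw [← hidx] at hc1
  have hrun' := D.run_out (u := T.L - l) (fun m hm1 hm2 hT => by
    rcases hall _ hT with h | h
    · have := add_natCast_inj (a := m) (b := 0) (i := i + 1) (by omega) (by omega) (by simpa using h)
      omega
    · rw [hli, add_assoc, ← Nat.cast_add] at h
      have := add_natCast_inj (a := l + m) (b := 0) (i := i₁) (by omega) (by omega)
        (by simpa using h)
      omega) h6
  obtain ⟨b, hb', harc'⟩ := D.arc_outer Γ (by omega) h2 hrun'
  have hbf : b = false := by
    have := (harc' 0 (by omega)).1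
    rw [Nat.cast_zero, sub_zero, h7] at this
    exact (Option.some.inj this).symm
  subst hbf
  have hc2 := D.carry_of_arc (by omega) fun m hm => (harc' m hm).2.2
  have hsub : ((T.L - l - 1 : ℕ) : ℤ) = T.L - l - 1 := by omega
  have hlast : i + 1 + ((T.L - l - 1 : ℕ) : ZMod T.L) = i₁ - 1 := by
    rw [Nat.cast_sub (by omega), Nat.cast_sub hl.le, ZMod.natCast_self, hli]
    push_cast; ring
  have hph : D.ph j (i₁ - 1) = (T.N ^ (l : ℤ)) (D.ph j i) := by
    have e := D.ph_add j (i₁ - 1) l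
    have e2 : i₁ - 1 + (l : ZMod T.L) = i := by rw [← hil, Nat.cast_sub hl0]; push_cast; ring
    rw [e2, hcj] at e
    rw [e, ← Equiv.Perm.mul_apply, ← zpow_add]; simp
  rw [hcj, hlast] at hc2
  simp only [Bool.false_eq_true, if_false] at hc2
  rw [hph, hsub] at hc2
  have hc2' : Γ.idx t₂ - ((T.L : ℤ) - l - 1) = Γ.idx t₂ + 1 - (T.L - l) := by ring
  rw [hc2'] at hc2
  refine ⟨l, D.ph j i, hl0, hl, hc1, hc2, fun hr hg => ?_⟩
  have htl' : t + l = t₀ + 1 := by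
    rw [htl, Nat.cast_sub hl0]; push_cast; ring
  constructor
  · obtain ⟨j', i', g1, g2, g3, g4⟩ := D.good_antiparallel Γ hδ hr hg
    have hT' : D.Turn j' (i' + 1) := by
      rw [Turn]
      intro hno
      rw [add_sub_cancel_right] at hno
      have e1 : D.θ (.inl (j', i')) = .inr (t + l) := by rw [← g1, D.invol]
      rw [e1, htl', ← D.nx_inr, D.nx_injective.eq_iff, ← ht₀] at hno
      have e2 := D.θ_injective hno
      simp only [Sum.inl.injEq, Prod.mk.injEq] at e2
      obtain ⟨rfl, e2⟩ := e2
      rw [← e2] at hT1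
      apply hT1
      rw [hno, ht₀, D.nx_inr, add_sub_cancel_right, e1, htl']
    obtain ⟨t₃, k1, k2, k3⟩ := D.start_of_turn Γ hS hr g1 g2 g3 g4 hT'
    have v1 := D.vertex_eq k1 (t' := t + l) (by rw [add_sub_cancel_right, ← g1, D.invol])
    have hlast' := hrun' (T.L - l - 1) (by omega)
    rw [hlast] at hlast'
    have v2 := D.vertex_eq ht₀ hlast'
    have harcl := harc' (T.L - l - 1) (by omega)
    have k4 := hS _ _ _ k3 harcl.1 (by rw [v1, htl', v2])
    have k5 := harcl.1
    rw [k4] at k5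
    have k6 := (Γ.step _ _ _ k3 k5).2
    rw [hδ, ← k4, harcl.2.1, hcj, hsub] at k6
    simp only [sg_false, sg_true] at k6
    have : Γ.idx t₂ + 1 - ((T.L : ℤ) - l) = Γ.idx t₃ + 1 := by rw [← k6]; ring
    rw [this]
    exact k2
  · have hr0 := (harc 0 hl0).1
    rw [Nat.cast_zero, sub_zero] at hr0
    rw [htl'] at hr ⊢
    rw [(Γ.step _ _ _ hr0 hr).2, hδ, hidx, sg_true]
    omega

lemma chain_of_start (hS : D.Simple Γ) (hδ : ∀ b, Γ.δ b = true) (k : ℕ) :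
    ∀ {t : ZMod n} {c : ℤ}, D.Start Γ t c →
      (∀ m : ℕ, m ≤ k * T.L → Γ.reg (t + m) = some true ∧ D.Good Γ (t + m)) →
      T.Chain (Γ.ω true) (Γ.ω false) k (Γ.idx t) c := by
  induction k with
  | zero => intros; trivial
  | succ k ih =>
    intro t c hs hw
    obtain ⟨l, φ, h1, h2, h3, h4, h5⟩ := D.start_step Γ hS hδ hs
    have hkl : (k + 1) * T.L = k * T.L + T.L := by ring
    obtain ⟨h6, h7⟩ := h5 (hw l (by omega)).1 (hw l (by omega)).2
    refine ⟨l, φ, h1, h2, h3, h4, ?_⟩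
    rw [← h7]
    refine ih h6 fun m hm => ?_
    have := hw (l + m) (by omega)
    rwa [Nat.cast_add, ← add_assoc] at this

theorem antiparallel_window (hS : D.Simple Γ) (hδ : ∀ b, Γ.δ b = true) (k : ℕ) {t : ZMod n}
    (h : ∀ m : ℕ, m ≤ (k + 1) * T.L → Γ.reg (t + m) = some true ∧ D.Good Γ (t + m)) :
    ∃ a c : ℤ, T.Chain (Γ.ω true) (Γ.ω false) k a c := by
  have hkl : (k + 1) * T.L = k * T.L + T.L := by ring
  obtain ⟨M, hM, c, hc⟩ : ∃ M : ℕ, M ≤ T.L ∧ ∃ c, D.Start Γ (t + M) c := by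
    by_contra hno
    push Not at hno
    have h0 := h 0 (by omega)
    rw [Nat.cast_zero, add_zero] at h0
    obtain ⟨j, i, g1, g2, g3, g4⟩ := D.good_antiparallel Γ hδ h0.1 h0.2
    have key : ∀ m : ℕ, m ≤ T.L → D.θ (.inr (t + m)) = .inl (j, i - m) := by
      intro m
      induction m with
      | zero => intro _; simpa using g1
      | succ m ih =>
        intro hm
        have hm' := h (m + 1) (by omega)
        obtain ⟨j', i', g1', g2', g3', g4'⟩ := D.good_antiparallel Γ hδ hm'.1 hm'.2
        have hT : ¬ D.Turn j' (i' + 1) := fun hT => by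
          obtain ⟨t₃, _, k2, _⟩ := D.start_of_turn Γ hS hm'.1 g1' g2' g3' g4' hT
          exact hno (m + 1) hm _ k2
        rw [Turn, not_not, add_sub_cancel_right] at hT
        have e1 : D.θ (.inl (j', i')) = .inr (t + (m + 1 : ℕ)) := by rw [← g1', D.invol]
        rw [e1, Nat.cast_succ, ← add_assoc, ← D.nx_inr, D.nx_injective.eq_iff] at hT
        have e2 := ih (by omega)
        rw [← hT, D.invol] at e2
        simp only [Sum.inl.injEq, Prod.mk.injEq] at e2
        rw [g1', e2.1, ← add_sub_cancel_right i' 1, e2.2]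
        congr 2; push_cast; ring
    obtain ⟨i₀, hi₀⟩ : (D.turns j).Nonempty := by rw [← card_pos]; omega
    have hT : D.Turn j i₀ := by simpa [turns] using hi₀
    obtain ⟨m, hm, hmi⟩ := exists_add_natCast i₀ (i + 1)
    have hm' := h m (by omega)
    have e : i - m + 1 = i₀ := by rw [sub_add_eq_add_sub, hmi]; ring
    obtain ⟨t₃, _, k2, _⟩ := D.start_of_turn Γ hS hm'.1 (key m (by omega)) g2 g3 g4 (by rwa [e])
    exact hno m (by omega) _ k2
  refine ⟨_, c, D.chain_of_start Γ hS hδ k hc fun m hm => ?_⟩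
  have := h (M + m) (by omega)
  rwa [Nat.cast_add, ← add_assoc] at this

end Disk
lemma exists_block {n : ℕ} (B : Finset ℕ) (lo M : ℕ) (h : (#B + 1) * M ≤ n) :
    ∃ u, lo ≤ u ∧ u + M ≤ lo + n ∧ ∀ m < M, u + m ∉ B := by
  by_contra hno
  push Not at hno
  have h1 : ∀ i : Fin (#B + 1), ∃ b ∈ B, lo + i * M ≤ b ∧ b < lo + (i + 1) * M := by
    intro i
    have hi : ((i : ℕ) + 1) * M ≤ (#B + 1) * M := Nat.mul_le_mul_right _ i.2
    obtain ⟨m, hm, hb⟩ := hno (lo + i * M) (by omega) (by rw [add_mul] at hi; omega)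
    exact ⟨_, hb, by omega, by rw [add_mul]; omega⟩
  choose f hf hf1 hf2 using h1
  have hinj : Function.Injective f := by
    have key : ∀ i j : Fin (#B + 1), (i : ℕ) < j → f i ≠ f j := fun i j hij h => by
      have a := hf2 i
      have b := hf1 j
      have := Nat.mul_le_mul_right M (Nat.succ_le_of_lt hij)
      rw [Nat.succ_eq_add_one] at this
      omega
    intro i j h
    rcases lt_trichotomy (i : ℕ) j with h' | h' | h'
    · exact (key _ _ h' h).elim
    · exact Fin.ext h'
    · exact (key _ _ h' h.symm).elim
  have := card_le_card_of_injOn f (s := univ) (t := B) (fun i _ => hf i) hinj.injOn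
  simp at this

section
variable (ω ω' : ℤ → Bool) (δ : Bool) (a : ℤ) (n' n₁ : ℕ) (g : List (Bool × Bool))

/-- Two words of powers closed up by a conjugating word. -/
def closing : List (Bool × Bool) :=
  word ω' true 0 n' ++ (g ++ (word ω δ a n₁ ++ FreeGroup.invRev g))

lemma closing_length : (closing ω ω' δ a n' n₁ g).length = n' + (g.length + (n₁ + g.length)) := by
  simp [closing, word_length]

/-- The two regions of a closing word. -/
def closingReg (u : ℕ) : Option Bool :=
  if u < n' then some false
  else if n' + g.length ≤ u ∧ u < n' + g.length + n₁ then some true else none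

/-- The positions in the regions of a closing word. -/
def closingIdx (u : ℕ) : ℤ :=
  if u < n' then u else a + sg δ * ((u : ℤ) - (n' + g.length : ℕ))

lemma closing_getElem {u : ℕ} (hu : u < (closing ω ω' δ a n' n₁ g).length) {b : Bool}
    (hb : closingReg n' n₁ g u = some b) :
    (closing ω ω' δ a n' n₁ g)[u] =
      (cond b ω ω' (closingIdx δ a n' g u), cond b δ true) := by
  unfold closingReg at hb
  unfold closingIdx
  simp only [closing]
  split_ifs at hb with h1 h2
  · obtain rfl : false = b := by simpa using hb
    rw [List.getElem_append_left (by simpa [word_length] using h1), word_getElem]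
    simp [h1]
  · obtain rfl : true = b := by simpa using hb
    rw [List.getElem_append_right (by simpa [word_length] using h1),
      List.getElem_append_right (by simp [word_length]; omega),
      List.getElem_append_left (by simp [word_length]; omega), word_getElem]
    simp only [h1, if_false, word_length, cond_true]
    have : ((u - n' - g.length : ℕ) : ℤ) = (u : ℤ) - (n' + g.length : ℕ) := by omega
    rw [this]

lemma closingReg_bound {u : ℕ} {b : Bool} (hg : g ≠ []) (hb : closingReg n' n₁ g u = some b) :
    u + 1 < n' + (g.length + (n₁ + g.length)) := by
  have := List.length_pos_of_ne_nil hg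
  unfold closingReg at hb
  split_ifs at hb <;> omega

lemma closingReg_step {u : ℕ} {b b' : Bool} (hg : g ≠ []) (hb : closingReg n' n₁ g u = some b)
    (hb' : closingReg n' n₁ g (u + 1) = some b') :
    b' = b ∧ closingIdx δ a n' g (u + 1) = closingIdx δ a n' g u + sg (cond b δ true) := by
  have := List.length_pos_of_ne_nil hg
  unfold closingReg at hb hb'
  unfold closingIdx
  split_ifs at hb hb' with h1 h2 h3 h4 h5
  all_goals first | omega | skip
  all_goals
    simp only [Option.some.injEq] at hb hb'
    subst hb hb'
  · simp [h1, h2]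
  · simp only [h1, h5, if_false, cond_true, true_and]
    push_cast; ring

lemma closingReg_convex {u v w : ℕ} {b : Bool} (hu : closingReg n' n₁ g u = some b)
    (hw : closingReg n' n₁ g w = some b) (h1 : u ≤ v) (h2 : v ≤ w) :
    closingReg n' n₁ g v = some b := by
  unfold closingReg at *
  split_ifs at * <;> simp_all <;> omega

/-- The regions of the cyclic closing word. -/
def closingRegions (hg : g ≠ []) {n : ℕ} [NeZero n]
    (hn : (closing ω ω' δ a n' n₁ g).length = n) :
    Regions n fun t => (closing ω ω' δ a n' n₁ g)[t.val]'(hn ▸ ZMod.val_lt t) where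
  ω b := cond b ω ω'
  δ b := cond b δ true
  reg t := closingReg n' n₁ g t.val
  idx t := closingIdx δ a n' g t.val
  hx t b hb := closing_getElem ω ω' δ a n' n₁ g _ hb
  step t b b' hb hb' := by
    have h := closingReg_bound n' n₁ g hg hb
    rw [closing_length] at hn
    have h' : (t + 1).val = t.val + 1 := by
      rcases zmod_val_succ_cases t with h1 | h1 <;> omega
    rw [h'] at hb' ⊢
    exact closingReg_step δ a n' n₁ g hg hb hb'

end

namespace Disk
variable {T : Track} {n : ℕ} [NeZero n]

theorem simple_closing {ω ω' : ℤ → Bool} (hω : T.Tame ω) (hω' : T.Tame ω') (δ : Bool) (a : ℤ)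
    (n' n₁ : ℕ) {g : List (Bool × Bool)} (hg : g ≠ [])
    (hn : (closing ω ω' δ a n' n₁ g).length = n)
    (D : Disk T n fun t => (closing ω ω' δ a n' n₁ g)[t.val]'(hn ▸ ZMod.val_lt t)) :
    D.Simple (closingRegions ω ω' δ a n' n₁ g hg hn) := by
  have hT : ∀ b, T.Tame (cond b ω ω') := fun b => by cases b; exacts [hω', hω]
  have hn' := hn
  rw [closing_length] at hn'
  have key : ∀ (b : Bool) (u v : ZMod n) (m : ℕ), 1 ≤ m → v.val = u.val + m →
      (∀ i, i < m → closingReg n' n₁ g (u.val + i) = some b) →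
      D.μ (.inr v) ≠ D.μ (.inr u) := by
    intro b u v m hm hv hr
    have hval : ∀ i, i < m → (u + i).val = u.val + i := fun i hi => by
      have := ZMod.val_lt v
      rw [ZMod.val_add, ZMod.val_natCast, Nat.add_mod_mod, Nat.mod_eq_of_lt (by omega)]
    have e : v = u + m := by
      apply ZMod.val_injective
      have := ZMod.val_lt v
      rw [ZMod.val_add, ZMod.val_natCast, Nat.add_mod_mod, Nat.mod_eq_of_lt (by omega), hv]
    rw [e]
    have hreg : ∀ i : ℕ, i < m →
        (closingRegions ω ω' δ a n' n₁ g hg hn).reg (u + i) = some b := fun i hi => by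
      show closingReg n' n₁ g (u + i).val = _
      rw [hval i hi]; exact hr i hi
    have hidx := idx_add _ hreg
    refine D.μ_ne (hT b) (a := (closingRegions ω ω' δ a n' n₁ g hg hn).idx u)
      (c := cond b δ true) hm fun i hi => ?_
    rw [(closingRegions ω ω' δ a n' n₁ g hg hn).hx _ _ (hreg i hi), hidx i hi]
    rfl
  intro b t t' ht ht' hμ
  change closingReg n' n₁ g t.val = some b at ht
  change closingReg n' n₁ g t'.val = some b at ht'
  have hb := closingReg_bound n' n₁ g hg ht
  have hval : (t + 1).val = t.val + 1 := by
    rcases zmod_val_succ_cases t with h1 | h1 <;> omega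
  by_contra hne
  have hne' : t'.val ≠ t.val + 1 := fun h => hne (ZMod.val_injective _ (h.trans hval.symm))
  rcases Nat.lt_or_gt_of_ne hne' with h | h
  · refine key b t' (t + 1) (t.val + 1 - t'.val) (by omega) (by omega) (fun i hi => ?_) hμ
    exact closingReg_convex _ _ _ ht' ht (by omega) (by omega)
  · refine key b (t + 1) t' (t'.val - (t.val + 1)) (by omega) (by omega) (fun i hi => ?_) hμ.symm
    exact closingReg_convex _ _ _ ht ht' (by omega) (by omega)

end Disk

section
variable {T : Track} {ω ω' : ℤ → Bool} {g : List (Bool × Bool)} {δ : Bool}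

open Classical in
/-- If conjugates of long words cancel modulo the relators, there are long good windows. -/
theorem exists_window (hω : T.Short ω) (hω' : T.Tame ω') (hg : g ≠ []) {a : ℤ} {n' n₁ M : ℕ}
    (hM : ((1 + 11 * T.L) * (2 * g.length) + 1) * M ≤ n₁)
    (h : FreeGroup.mk (closing ω ω' δ a n' n₁ g) ∈ T.R) :
    ∃ (n : ℕ) (_ : NeZero n) (x : ZMod n → Bool × Bool) (D : Disk T n x) (Γ : Regions n x),
      (∀ b, Γ.ω b = cond b ω ω') ∧ (∀ b, Γ.δ b = cond b δ true) ∧ D.Simple Γ ∧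
      ∃ t, ∀ m < M, Γ.reg (t + (m : ℕ)) = some true ∧ D.Good Γ (t + (m : ℕ)) := by
  have hg' := List.length_pos_of_ne_nil hg
  obtain ⟨n, hn⟩ : ∃ n, (closing ω ω' δ a n' n₁ g).length = n := ⟨_, rfl⟩
  have hn' := hn
  rw [closing_length] at hn'
  have : NeZero n := ⟨by omega⟩
  obtain ⟨D⟩ := exists_disk T _ hn h
  set Γ := closingRegions ω ω' δ a n' n₁ g hg hn with hΓ
  refine ⟨n, this, _, D, Γ, fun _ => rfl, fun _ => rfl,
    D.simple_closing hω.tame hω' δ a n' n₁ hg hn, ?_⟩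
  have hval : ∀ u, u < n → ((u : ℕ) : ZMod n).val = u := fun u hu => by
    rw [ZMod.val_natCast, Nat.mod_eq_of_lt hu]
  have hnone : #{t | Γ.reg t = none} ≤ 2 * g.length := by
    have h1 : #({t | Γ.reg t = none} : Finset (ZMod n)) ≤ #((range g.length).image (n' + ·) ∪
        (range g.length).image (n' + g.length + n₁ + ·)) := by
      refine card_le_card_of_injOn ZMod.val (fun t ht => ?_) (ZMod.val_injective n).injOn
      have ht : closingReg n' n₁ g t.val = none := (mem_filter.1 ht).2
      have := ZMod.val_lt t
      unfold closingReg at ht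
      simp only [coe_union, coe_image, coe_range, Set.mem_union, Set.mem_image, Set.mem_Iio]
      split_ifs at ht with h1 h2
      rcases Nat.lt_or_ge t.val (n' + g.length) with h3 | h3
      · exact Or.inl ⟨t.val - n', by omega, by omega⟩
      · exact Or.inr ⟨t.val - (n' + g.length + n₁), by omega, by omega⟩
    refine (h1.trans (card_union_le _ _)).trans ?_
    have h2 := card_image_le (s := range g.length) (f := (n' + ·))
    have h3 := card_image_le (s := range g.length) (f := (n' + g.length + n₁ + ·))
    rw [card_range] at h2 h3
    omega
  have hspec : ∃ t, Γ.reg t = none := by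
    refine ⟨(n' : ℕ), ?_⟩
    show closingReg n' n₁ g _ = none
    rw [hval _ (by omega)]
    unfold closingReg
    rw [if_neg (by omega), if_neg (by omega)]
  have hng := D.card_not_good Γ hω' hω hspec
  set B := ({t | Γ.reg t = some true ∧ ¬ D.Good Γ t} : Finset (ZMod n)) with hB
  have hBc : #(B.image ZMod.val) ≤ (1 + 11 * T.L) * (2 * g.length) :=
    card_image_le.trans (hng.trans (Nat.mul_le_mul_left _ hnone))
  obtain ⟨u, hu1, hu2, hu3⟩ := exists_block (B.image ZMod.val) (n' + g.length) M
    ((Nat.mul_le_mul_right M (Nat.succ_le_succ hBc)).trans hM)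
  refine ⟨(u : ℕ), fun m hm => ?_⟩
  have hv : ((u : ZMod n) + m).val = u + m := by
    rw [← Nat.cast_add]; exact hval _ (by omega)
  have hr : Γ.reg (u + (m : ℕ)) = some true := by
    show closingReg n' n₁ g _ = _
    rw [hv]
    unfold closingReg
    rw [if_neg (by omega), if_pos (by omega)]
  refine ⟨hr, ?_⟩
  by_contra hng'
  refine hu3 m hm (mem_image.2 ⟨_, ?_, hv⟩)
  rw [hB]; simp only [mem_filter, mem_univ, true_and]; exact ⟨hr, hng'⟩

/-- Opposite directions: the sequences agree on arbitrarily long windows. -/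
theorem extract_parallel (hω : T.Short ω) (hω' : T.Tame ω') (hg : g ≠ [])
    (H : ∀ M, ∃ n₁ ≥ M, ∃ n' a, FreeGroup.mk (closing ω ω' false a n' n₁ g) ∈ T.R) (M : ℕ) :
    ∃ α β : ℤ, ∀ m : ℕ, m < M → ω (α + m) = ω' (β + m) := by
  obtain ⟨n₁, h1, n', a, h⟩ := H (((1 + 11 * T.L) * (2 * g.length) + 1) * M)
  obtain ⟨n, _, x, D, Γ, e1, e2, hS, t, ht⟩ := exists_window hω hω' hg h1 h
  have := D.parallel_window Γ hS (by simp [e2]) ht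
  simpa [e1] using this

/-- Equal directions: the sequences bound arbitrarily long chains. -/
theorem extract_chain (hω : T.Short ω) (hω' : T.Tame ω') (hg : g ≠ [])
    (H : ∀ M, ∃ n₁ ≥ M, ∃ n' a, FreeGroup.mk (closing ω ω' true a n' n₁ g) ∈ T.R) (k : ℕ) :
    ∃ a c : ℤ, T.Chain ω ω' k a c := by
  obtain ⟨n₁, h1, n', a, h⟩ := H (((1 + 11 * T.L) * (2 * g.length) + 1) * ((k + 1) * T.L + 1))
  obtain ⟨n, _, x, D, Γ, e1, e2, hS, t, ht⟩ := exists_window hω hω' hg h1 h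
  have := D.antiparallel_window Γ hS (by simp [e2]) k fun m hm => ht m (by omega)
  simpa [e1] using this

end
end

/-- The height `⌊(c + i q) / p⌋` of the `i`-th letter of a string of slope `q / p`. -/
def fl (q p c i : ℤ) : ℤ := (c + i * q) / p

/-- The sign of the `i`-th letter of a string of slope `q / p`. -/
def st (q p c i : ℤ) : Bool := decide (fl q p c i % 2 = 0)

lemma st_eq_iff {q p c i q' p' c' i' : ℤ} :
    st q p c i = st q' p' c' i' ↔ fl q p c i % 2 = fl q' p' c' i' % 2 := by
  unfold st
  rw [decide_eq_decide]
  omega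

section
variable {q p : ℤ}

lemma fl_lt (hp : 0 < p) (c : ℤ) (i l : ℤ) : p * (fl q p c (i + l) - fl q p c i) < l * q + p := by
  have h1 := Int.mul_ediv_self_le (x := c + (i + l) * q) hp.ne'
  have h2 := Int.lt_mul_ediv_self_add (x := c + i * q) hp
  unfold fl
  linarith

lemma lt_fl (hp : 0 < p) (c : ℤ) (i l : ℤ) : l * q - p < p * (fl q p c (i + l) - fl q p c i) := by
  have h1 := Int.mul_ediv_self_le (x := c + i * q) hp.ne'
  have h2 := Int.lt_mul_ediv_self_add (x := c + (i + l) * q) hp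
  unfold fl
  linarith

lemma fl_le_of (hp : 0 < p) (c : ℤ) {i l h : ℤ} (hl : l * q ≤ h * p) :
    fl q p c (i + l) - fl q p c i ≤ h := by
  have := fl_lt hp (q := q) c i l
  by_contra hno
  nlinarith

lemma le_fl_of (hp : 0 < p) (c : ℤ) {i l h : ℤ} (hl : h * p ≤ l * q) :
    h ≤ fl q p c (i + l) - fl q p c i := by
  have := lt_fl hp (q := q) c i l
  by_contra hno
  nlinarith

lemma fl_period (hp : 0 < p) (c : ℤ) {i l h : ℤ} (hl : l * q = h * p) :
    fl q p c (i + l) = fl q p c i + h := by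
  unfold fl
  rw [show c + (i + l) * q = c + i * q + h * p by rw [← hl]; ring,
    Int.add_mul_ediv_right _ _ hp.ne']

end

/-- The residue at `i` is extreme in the direction `ε`. -/
def Crit (q p c ε i : ℤ) : Prop := (c + i * q + ε) / p = fl q p c i + ε

section
variable {q p ε c : ℤ}

lemma crit_block (hp : 0 < p) {i l h : ℤ} (hl : l * q = h * p + ε) :
    Crit q p c ε i ↔ fl q p c (i + l) = fl q p c i + h + ε := by
  unfold Crit
  have : fl q p c (i + l) = (c + i * q + ε) / p + h := by
    unfold fl
    rw [show c + (i + l) * q = c + i * q + ε + h * p by rw [add_mul, hl]; ring,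
      Int.add_mul_ediv_right _ _ hp.ne']
  rw [this]
  omega

lemma Crit.step (hp : 0 < p) {i l h : ℤ} (hi : Crit q p c (-ε) i) (hl : l * q = h * p - ε) :
    Crit q p c ε (i + l) := by
  have h1 := (crit_block hp (h := h) (l := l) (by rw [hl]; ring)).1 hi
  unfold Crit
  rw [h1, show c + (i + l) * q + ε = c + i * q + h * p by rw [add_mul, hl]; ring,
      Int.add_mul_ediv_right _ _ hp.ne']
  unfold fl
  ring

lemma crit_add (hp : 0 < p) {i : ℤ} (k : ℤ) : Crit q p c ε (i + k * p) ↔ Crit q p c ε i := by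
  unfold Crit
  rw [fl_period hp (h := k * q) c (by ring),
    show c + (i + k * p) * q + ε = c + i * q + ε + (k * q) * p by ring,
    Int.add_mul_ediv_right _ _ hp.ne']
  omega

lemma crit_one_iff (hp : 0 < p) {i : ℤ} : Crit q p c 1 i ↔ p ∣ c + i * q + 1 := by
  unfold Crit fl
  generalize c + i * q = x
  have h1 := Int.mul_ediv_add_emod x p
  have h2 := Int.emod_nonneg x hp.ne'
  have h3 := Int.emod_lt_of_pos x hp
  constructor
  · intro h
    have h4 := Int.mul_ediv_self_le (x := x + 1) hp.ne'
    rw [h] at h4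
    exact ⟨x / p + 1, by nlinarith⟩
  · rintro ⟨k, hk⟩
    rw [hk, Int.mul_ediv_cancel_left _ hp.ne']
    have : p * (k - (x / p)) = x % p + 1 := by rw [mul_sub]; linarith
    have h5 : 0 < k - x / p := by by_contra hno; nlinarith
    have h6 : k - x / p ≤ 1 := by by_contra hno; nlinarith
    omega

lemma crit_neg_one_iff (hp : 0 < p) {i : ℤ} : Crit q p c (-1) i ↔ p ∣ c + i * q := by
  unfold Crit fl
  generalize c + i * q = x
  have h1 := Int.mul_ediv_add_emod x p
  have h2 := Int.emod_nonneg x hp.ne'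
  constructor
  · intro h
    have h4 := Int.lt_mul_ediv_self_add (x := x + -1) hp
    rw [h] at h4
    exact ⟨x / p, by nlinarith⟩
  · rintro ⟨k, rfl⟩
    rw [Int.mul_ediv_cancel_left _ hp.ne', add_comm, Int.add_mul_ediv_left _ _ hp.ne',
      Int.ediv_eq_neg_one_of_neg_of_le (by norm_num) (by omega)]
    ring

lemma Crit.dvd_sub (hp : 0 < p) (hε : ε = 1 ∨ ε = -1) {d i : ℤ} (h : Crit q p c ε i)
    (h' : Crit q p d ε i) : p ∣ c - d := by
  rcases hε with rfl | rfl
  · rw [crit_one_iff hp] at h h'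
    rw [show c - d = (c + i * q + 1) - (d + i * q + 1) by ring]; exact dvd_sub h h'
  · rw [crit_neg_one_iff hp] at h h'
    rw [show c - d = (c + i * q) - (d + i * q) by ring]; exact dvd_sub h h'

lemma exists_crit (hp : 0 < p) (hε : ε = 1 ∨ ε = -1) {y : ℤ} (hy : p ∣ y * q - 1) (c i₀ : ℤ) :
    ∃ i, i₀ ≤ i ∧ i < i₀ + p ∧ Crit q p c ε i := by
  have key : ∀ z, ∃ i, i₀ ≤ i ∧ i < i₀ + p ∧ p ∣ c + i * q + z := by
    intro z
    refine ⟨i₀ + (-(c + z) * y - i₀) % p, ?_, ?_, ?_⟩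
    · have := Int.emod_nonneg (-(c + z) * y - i₀) hp.ne'; omega
    · have := Int.emod_lt_of_pos (-(c + z) * y - i₀) hp; omega
    · have h1 := Int.mul_ediv_add_emod (-(c + z) * y - i₀) p
      obtain ⟨w, hw⟩ := hy
      refine ⟨-(c + z) * w - (-(c + z) * y - i₀) / p * q, ?_⟩
      have h2 : (-(c + z) * y - i₀) % p = -(c + z) * y - i₀ -
        p * ((-(c + z) * y - i₀) / p) := by linarith
      rw [h2]
      linear_combination -(c + z) * hw
  rcases hε with rfl | rfl
  · simpa only [crit_one_iff hp] using key 1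
  · simpa only [crit_neg_one_iff hp, add_zero] using key 0

end

lemma fl_succ {q p : ℤ} (hp : 0 < p) (h0 : 0 ≤ q) (h1 : q ≤ p) (c i : ℤ) :
    fl q p c (i + 1) = fl q p c i ∨ fl q p c (i + 1) = fl q p c i + 1 := by
  have h2 := fl_le_of hp c (i := i) (l := 1) (h := 1) (q := q) (by omega)
  have h3 := le_fl_of hp c (i := i) (l := 1) (h := 0) (q := q) (by omega)
  omega

/-- Strings with the same signs on a window have the same heights up to an even shift. -/
lemma fl_eq_of_st {q p q' p' : ℤ} (hp : 0 < p) (h0 : 0 ≤ q) (h1 : q ≤ p) (hp' : 0 < p')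
    (h0' : 0 ≤ q') (h1' : q' ≤ p') {c c' a b : ℤ} {u : ℕ}
    (h : ∀ m : ℕ, m < u → st q p c (a + m) = st q' p' c' (b + m)) :
    ∃ w, ∀ m : ℤ, 0 ≤ m → m < u → fl q p c (a + m) = fl q' p' c' (b + m) + 2 * w := by
  rcases Nat.eq_zero_or_pos u with rfl | hu
  · exact ⟨0, fun m hm hm' => by simp at hm'; omega⟩
  simp only [st_eq_iff] at h
  obtain ⟨w, hw⟩ : ∃ w, fl q p c a = fl q' p' c' b + 2 * w := by
    have := h 0 hu
    simp only [Nat.cast_zero, add_zero] at this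
    exact ⟨(fl q p c a - fl q' p' c' b) / 2, by omega⟩
  refine ⟨w, fun m hm hm' => ?_⟩
  lift m to ℕ using hm
  induction m with
  | zero => simpa using hw
  | succ m ih =>
    have e1 := ih (by push_cast at hm'; omega)
    have e2 := h (m + 1) (by omega)
    have e3 := fl_succ hp h0 h1 c (a + m)
    have e4 := fl_succ hp' h0' h1' c' (b + m)
    push_cast at e2 ⊢
    simp only [← add_assoc] at e2 ⊢
    omega

/-- A slope `q / p` which is the mediant of its Farey parents `qA / pA` and `qB / pB`. -/
structure Farey where
  pA : ℕ
  qA : ℕ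
  pB : ℕ
  qB : ℕ
  ε : ℤ
  hε : ε = 1 ∨ ε = -1
  pA_pos : 0 < pA
  pB_pos : 0 < pB
  det : (pA : ℤ) * qB - qA * pB = ε
  two_le : 2 ≤ qA + qB
  lt : qA + qB + 2 ≤ pA + pB

namespace Farey
variable (f : Farey)

/-- The denominator of the slope. -/
def p : ℤ := f.pA + f.pB

/-- The numerator of the slope. -/
def q : ℤ := f.qA + f.qB

lemma p_pos : 0 < f.p := by
  have := f.pA_pos
  unfold p; omega

lemma q_nonneg : 0 ≤ f.q := by unfold q; omega

lemma q_le : f.q ≤ f.p := by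
  have := f.lt
  unfold p q; omega

lemma hA : (f.pA : ℤ) * f.q = f.qA * f.p + f.ε := by
  rw [← f.det]; unfold p q; ring

lemma hB : (f.pB : ℤ) * f.q = f.qB * f.p - f.ε := by
  rw [← f.det]; unfold p q; ring

lemma neg_ε : -f.ε = 1 ∨ -f.ε = -1 := by
  rcases f.hε with h | h <;> rw [h] <;> simp

lemma exists_inv : ∃ y : ℤ, f.p ∣ y * f.q - 1 := by
  refine ⟨f.ε * f.pA, f.ε * f.qA, ?_⟩
  have : f.ε * f.ε = 1 := by rcases f.hε with h | h <;> rw [h] <;> norm_num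
  linear_combination f.ε * f.hA + this

lemma exists_crit (c i₀ : ℤ) : ∃ i, i₀ ≤ i ∧ i < i₀ + f.p ∧ Crit f.q f.p c f.ε i := by
  obtain ⟨y, hy⟩ := f.exists_inv
  exact Heckoid.exists_crit f.p_pos f.hε hy c i₀

lemma exists_crit' (c i₀ : ℤ) : ∃ i, i₀ ≤ i ∧ i < i₀ + f.p ∧ Crit f.q f.p c (-f.ε) i := by
  obtain ⟨y, hy⟩ := f.exists_inv
  exact Heckoid.exists_crit f.p_pos f.neg_ε hy c i₀

variable {f}

lemma critA {c i : ℤ} (h : Crit f.q f.p c f.ε i) : Crit f.q f.p c (-f.ε) (i + f.pA) :=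
  Crit.step f.p_pos (by simpa using h) (by rw [f.hA]; ring)

lemma critB {c i : ℤ} (h : Crit f.q f.p c (-f.ε) i) : Crit f.q f.p c f.ε (i + f.pB) :=
  Crit.step f.p_pos h f.hB

lemma crit_per {c i ε : ℤ} (k : ℤ) (h : Crit f.q f.p c ε i) : Crit f.q f.p c ε (i + k * f.p) :=
  (crit_add f.p_pos k).2 h

/-- A window of `p` letters determines the residue. -/
lemma dvd_of_fl_eq {c d a w : ℤ}
    (h : ∀ m, a ≤ m → m < a + f.p → fl f.q f.p c m = fl f.q f.p d m + w) : f.p ∣ c - d := by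
  obtain ⟨i, h1, h2, h3⟩ := f.exists_crit c a
  have hA := f.pA_pos
  have hB := f.pB_pos
  have hp : f.p = f.pA + f.pB := rfl
  rcases lt_or_ge (i + f.pA) (a + f.p) with h4 | h4
  · refine Crit.dvd_sub f.p_pos f.hε h3 ?_
    rw [crit_block f.p_pos f.hA] at h3 ⊢
    have := h i h1 h2
    have := h (i + f.pA) (by omega) h4
    omega
  · have h5 : Crit f.q f.p c (-f.ε) (i - f.pB) := by
      have := crit_per (-1) (critA h3)
      rwa [show i + f.pA + -1 * f.p = i - f.pB by rw [hp]; ring] at this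
    refine Crit.dvd_sub f.p_pos f.neg_ε h5 ?_
    rw [crit_block f.p_pos (f.hB.trans (sub_eq_add_neg _ _))] at h5 ⊢
    have := h (i - f.pB) (by omega) (by omega)
    have := h (i - f.pB + f.pB) (by omega) (by omega)
    omega

/-- A short extremal window determines the residue. -/
lemma dvd_of_fl_eq' {c d a w : ℤ} (ha : Crit f.q f.p c (-f.ε) a)
    (h : ∀ m, a ≤ m → m ≤ a + f.pB → fl f.q f.p c m = fl f.q f.p d m + w) : f.p ∣ c - d := by
  refine Crit.dvd_sub f.p_pos f.neg_ε ha ?_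
  rw [crit_block f.p_pos (f.hB.trans (sub_eq_add_neg _ _))] at ha ⊢
  have := h a le_rfl (by omega)
  have := h (a + f.pB) (by omega) (by omega)
  omega

lemma two_dvd_of_fl_eq {c d i w : ℤ} (hd : f.p ∣ c - d)
    (h : fl f.q f.p c i = fl f.q f.p d i + 2 * w) : 2 * f.p ∣ c - d := by
  obtain ⟨k, hk⟩ := hd
  have : fl f.q f.p c i = fl f.q f.p d i + k := by
    unfold fl
    rw [show c + i * f.q = d + i * f.q + k * f.p by linarith,
      Int.add_mul_ediv_right _ _ f.p_pos.ne']
  exact ⟨w, by rw [hk, show k = 2 * w by omega]; ring⟩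

variable (f)

/-- The number of residues modulo `2 p`. -/
def twoP : ℕ := 2 * (f.pA + f.pB)

lemma twoP_cast : (f.twoP : ℤ) = 2 * f.p := by unfold twoP p; push_cast; ring

instance : NeZero f.twoP := ⟨by have := f.pA_pos; unfold twoP; omega⟩

/-- The sign of a residue modulo `2 p`. -/
def colour (j : ZMod f.twoP) : Bool := decide (j.val < f.pA + f.pB)

lemma colour_cast (c i : ℤ) : f.colour ((c + i * f.q : ℤ) : ZMod f.twoP) = st f.q f.p c i := by
  unfold colour st fl
  rw [decide_eq_decide]
  have h : ((((c + i * f.q : ℤ) : ZMod f.twoP).val : ℕ) : ℤ) = (c + i * f.q) % (2 * f.p) := by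
    rw [ZMod.val_intCast, f.twoP_cast]
  generalize c + i * f.q = x at h ⊢
  have hp := f.p_pos
  have hpp : f.p = f.pA + f.pB := rfl
  have h1 := Int.mul_ediv_add_emod x (2 * f.p)
  have h2 := Int.emod_nonneg x (b := 2 * f.p) (by omega)
  have h3 := Int.emod_lt_of_pos x (b := 2 * f.p) (by omega)
  have h4 : x / f.p = x % (2 * f.p) / f.p + 2 * (x / (2 * f.p)) := by
    have : x = x % (2 * f.p) + (2 * (x / (2 * f.p))) * f.p := by linarith
    conv_lhs => rw [this]
    exact Int.add_mul_ediv_right _ _ hp.ne'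
  rcases lt_or_ge (x % (2 * f.p)) f.p with h5 | h5
  · rw [Int.ediv_eq_zero_of_lt h2 h5] at h4
    constructor
    · intro _; omega
    · intro _; omega
  · have : x % (2 * f.p) / f.p = 1 := by
      rw [Int.ediv_eq_iff_of_pos hp]; omega
    rw [this] at h4
    constructor
    · intro _; omega
    · intro _; omega

lemma addRight_zpow {G : Type*} [AddCommGroup G] (g x : G) (i : ℤ) :
    ((Equiv.addRight g) ^ i) x = x + i • g := by
  induction i using Int.induction_on generalizing x with
  | zero => simp
  | succ i ih => rw [zpow_add_one, Equiv.Perm.mul_apply, ih, add_smul, one_smul]; simp; abel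
  | pred i ih =>
    rw [zpow_sub_one, Equiv.Perm.mul_apply, ih, sub_smul, one_smul, Equiv.Perm.inv_def]; simp; abel

lemma step_cast (c i : ℤ) : ((Equiv.addRight ((f.q : ℤ) : ZMod f.twoP)) ^ i) (c : ZMod f.twoP) =
    ((c + i * f.q : ℤ) : ZMod f.twoP) := by
  rw [addRight_zpow]; push_cast; simp

/-- The cyclic track of the relator `u_r ^ n`. -/
def track (n : ℕ) (hn : 2 ≤ n) : Track where
  Ph := ZMod f.twoP
  N := Equiv.addRight ((f.q : ℤ) : ZMod f.twoP)
  col := f.colour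
  L := 2 * n * (f.pA + f.pB)
  K := f.pA + f.pB - 1
  K_pos := by have := f.lt; have := f.two_le; omega
  L_large := by
    have := Nat.mul_le_mul_right (f.pA + f.pB) hn
    have := f.pA_pos
    rw [mul_assoc]
    omega
  period := by
    ext x
    obtain ⟨c, rfl⟩ := ZMod.intCast_surjective x
    rw [← zpow_natCast, f.step_cast, Equiv.Perm.one_apply, ZMod.intCast_eq_intCast_iff_dvd_sub,
      f.twoP_cast]
    exact ⟨-(n * f.q), by unfold p; push_cast; ring⟩
  sep := by
    intro φ ψ h
    obtain ⟨c, rfl⟩ := ZMod.intCast_surjective φ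
    obtain ⟨d, rfl⟩ := ZMod.intCast_surjective ψ
    simp only [f.step_cast, f.colour_cast] at h
    have hA := f.pA_pos
    obtain ⟨w, hw⟩ := fl_eq_of_st (u := f.pA + f.pB) (a := 0) (b := 0) f.p_pos f.q_nonneg f.q_le
      f.p_pos f.q_nonneg f.q_le (fun m hm => by simpa using h m (by omega))
    simp only [zero_add] at hw
    have h1 := dvd_of_fl_eq (a := 0) (fun m h1 h2 => hw m h1 (by simpa [p] using h2))
    have h2 := two_dvd_of_fl_eq h1 (hw 0 le_rfl (by omega))
    rw [eq_comm, ZMod.intCast_eq_intCast_iff_dvd_sub, f.twoP_cast]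
    exact h2

end Farey
/-- The pair represents a fraction between `0` and `1`. -/
structure IsSlope (q p : ℤ) : Prop where
  pos : 0 < p
  nonneg : 0 ≤ q
  le : q ≤ p

namespace Farey
variable (f : Farey)

/-- The slope lies outside the gap around `f` bounded by the two extremal blocks of index `n`. -/
def Dom (n : ℕ) (q' p' : ℤ) : Prop :=
  f.ε * ((f.pA + (2 * n - 2) * f.p) * q' - (f.qA + (2 * n - 2) * f.q) * p') < 0 ∨
    0 ≤ f.ε * ((f.pB + f.p) * q' - (f.qB + f.q) * p')

/-- The slope lies strictly between the Farey parents. -/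
def Inside (q' p' : ℤ) : Prop :=
  0 < f.ε * (f.pA * q' - f.qA * p') ∧ f.ε * (f.pB * q' - f.qB * p') < 0

/-- On the window `[u, v)` the heights of two strings agree up to a shift. -/
def Agree (q' p' c' a c w u v : ℤ) : Prop :=
  ∀ m, u ≤ m → m < v → fl q' p' c' (a + m) = fl f.q f.p c m + w

variable {f} {q' p' c' a c w u v : ℤ}

lemma Agree.block (hW : f.Agree q' p' c' a c w u v) (hp' : 0 < p') {ε i l h : ℤ}
    (hε : ε = 1 ∨ ε = -1) (hi : Crit f.q f.p c ε i) (hl : l * f.q = h * f.p + ε) (h0 : 0 ≤ l)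
    (h1 : u ≤ i) (h2 : i + l < v) : 0 < ε * (l * q' - h * p') := by
  rw [crit_block f.p_pos hl] at hi
  have e1 := hW i h1 (by omega)
  have e2 := hW (i + l) (by omega) h2
  rw [← add_assoc] at e2
  have e3 := fl_lt hp' (q := q') c' (a + i) l
  have e4 := lt_fl hp' (q := q') c' (a + i) l
  rw [show fl q' p' c' (a + i + l) - fl q' p' c' (a + i) = h + ε by omega] at e3 e4
  rcases hε with rfl | rfl <;> linarith

lemma Agree.blockA (hW : f.Agree q' p' c' a c w u v) (hp' : 0 < p') {i : ℤ}
    (hi : Crit f.q f.p c f.ε i) (k : ℤ) (hk : 0 ≤ k) (h1 : u ≤ i)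
    (h2 : i + (f.pA + k * f.p) < v) :
    0 < f.ε * ((f.pA + k * f.p) * q' - (f.qA + k * f.q) * p') := by
  have := mul_nonneg hk f.p_pos.le
  exact hW.block hp' f.hε hi (by rw [add_mul, f.hA]; ring) (by omega) h1 h2

lemma Agree.blockB (hW : f.Agree q' p' c' a c w u v) (hp' : 0 < p') {i : ℤ}
    (hi : Crit f.q f.p c (-f.ε) i) (k : ℤ) (hk : 0 ≤ k) (h1 : u ≤ i)
    (h2 : i + (f.pB + k * f.p) < v) :
    f.ε * ((f.pB + k * f.p) * q' - (f.qB + k * f.q) * p') < 0 := by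
  have := mul_nonneg hk f.p_pos.le
  have := hW.block hp' f.neg_ε hi (h := f.qB + k * f.q) (by rw [add_mul, f.hB]; ring) (by omega)
    h1 h2
  linarith

lemma Agree.not_dom (hW : f.Agree q' p' c' a c w u v) (hp' : 0 < p') {n : ℕ} (hn : 2 ≤ n) {i : ℤ}
    (hi : Crit f.q f.p c (-f.ε) i) (h1 : u ≤ i - f.pA - (2 * n - 1) * f.p) (h2 : i - f.p < v) :
    ¬ f.Dom n q' p' := by
  have hp := f.p_pos
  have hpp : f.p = f.pA + f.pB := rfl
  have hA := f.pA_pos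
  have h3 : 3 * f.p ≤ (2 * n - 1) * f.p := by
    apply mul_le_mul_of_nonneg_right _ hp.le; omega
  have hi' : Crit f.q f.p c f.ε (i - f.pA - (2 * n - 1) * f.p) := by
    have := crit_per (-(2 * n)) (critB hi)
    rwa [show i + f.pB + -(2 * n) * f.p = i - f.pA - (2 * n - 1) * f.p by rw [hpp]; ring] at this
  have e1 := hW.blockA hp' hi' (2 * n - 2) (by omega) h1 (by
    rw [show i - f.pA - (2 * n - 1) * f.p + (f.pA + (2 * n - 2) * f.p) = i - f.p by ring]
    exact h2)
  have e2 := hW.blockB hp' (crit_per (-3) hi) 1 zero_le_one (by omega) (by omega)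
  rw [one_mul, one_mul] at e2
  rintro (h | h) <;> omega

variable {n : ℕ} {hn : 2 ≤ n}

lemma agree_of_carry (hs : IsSlope q' p') {u : ℕ} {s : ℤ}
    (h : (f.track n hn).Carry (st q' p' c') u s (c : ZMod f.twoP)) :
    ∃ w, f.Agree q' p' c' s c (2 * w) 0 u := by
  have h' : ∀ m : ℕ, m < u → st q' p' c' (s + m) = st f.q f.p c (0 + m) := fun m hm => by
    rw [zero_add, ← f.colour_cast, ← f.step_cast]
    exact h m hm
  obtain ⟨w, hw⟩ := fl_eq_of_st hs.pos hs.nonneg hs.le f.p_pos f.q_nonneg f.q_le h'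
  exact ⟨w, fun m h1 h2 => by simpa using hw m h1 h2⟩

lemma track_L_cast : (((f.track n hn).L : ℕ) : ℤ) = 2 * n * f.p := by
  show ((2 * n * (f.pA + f.pB) : ℕ) : ℤ) = _
  unfold p; push_cast; ring

lemma four_mul_le : 4 * f.p ≤ (f.track n hn).L := by
  rw [track_L_cast]
  apply mul_le_mul_of_nonneg_right _ f.p_pos.le; omega

/-- Slopes in the domain give tame sequences. -/
theorem tame (hs : IsSlope q' p') (hd : f.Dom n q' p') : (f.track n hn).Tame (st q' p' c') := by
  intro s ψ u hu huL hc
  obtain ⟨c, rfl⟩ : ∃ c : ℤ, (c : ZMod f.twoP) = ψ := ZMod.intCast_surjective (n := f.twoP) ψ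
  obtain ⟨w, hw⟩ := agree_of_carry hs hc
  have hL := track_L_cast (f := f) (hn := hn)
  have hpp : f.p = f.pA + f.pB := rfl
  have key : ∀ i, Crit f.q f.p c (-f.ε) i → (f.track n hn).L - (f.pB : ℤ) ≤ i → ¬ i - f.p < u :=
    fun i h1 h2 h3 => hw.not_dom hs.pos hn h1 (by
      have : (2 * (n : ℤ) - 1) * f.p = 2 * n * f.p - f.p := by ring
      rw [this]; omega) h3 hd
  constructor
  · by_contra hno
    obtain ⟨i, h1, h2, h3⟩ := f.exists_crit' c u
    exact key i h3 (by omega) (by omega)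
  · intro ψ' h'
    obtain ⟨d, rfl⟩ : ∃ d : ℤ, ((d + u * f.q : ℤ) : ZMod f.twoP) = ψ' := by
      obtain ⟨d, rfl⟩ := ZMod.intCast_surjective (n := f.twoP) ψ'
      exact ⟨d - u * f.q, by rw [sub_add_cancel]⟩
    obtain ⟨i, h1, h2, h3⟩ := f.exists_crit' c u
    rcases lt_or_ge i ((f.track n hn).L - (f.pB : ℤ)) with h4 | h4
    · have h5 : ∀ m : ℕ, m < (f.track n hn).L - u →
          st f.q f.p c (u + m) = st f.q f.p d (u + m) := by
        intro m hm
        have h6 : f.colour (((f.track n hn).N ^ (m : ℤ)) ((d + u * f.q : ℤ) : ZMod f.twoP)) =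
          f.colour (((f.track n hn).N ^ (u + m : ℤ)) (c : ZMod f.twoP)) := h' m hm
        rw [show ((f.track n hn).N ^ (m : ℤ)) ((d + u * f.q : ℤ) : ZMod f.twoP) = _
            from f.step_cast _ _, show ((f.track n hn).N ^ (u + m : ℤ)) (c : ZMod f.twoP) = _
            from f.step_cast _ _, f.colour_cast, f.colour_cast] at h6
        rw [← h6]
        unfold st fl
        rw [show d + u * f.q + m * f.q = d + (u + m) * f.q by ring]
      obtain ⟨w', hw'⟩ := fl_eq_of_st f.p_pos f.q_nonneg f.q_le f.p_pos f.q_nonneg f.q_le h5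
      have h6 : ∀ m, (u : ℤ) ≤ m → m < (f.track n hn).L →
          fl f.q f.p c m = fl f.q f.p d m + 2 * w' := fun m a b => by
        have := hw' (m - u) (by omega) (by omega)
        rwa [add_sub_cancel] at this
      have h7 := dvd_of_fl_eq' h3 (fun m a b => h6 m (by omega) (by omega))
      have h8 := two_dvd_of_fl_eq h7 (h6 i h1 (by omega))
      rw [show ((f.track n hn).N ^ (u : ℤ)) (c : ZMod f.twoP) = _ from f.step_cast _ _]
      refine (ZMod.intCast_eq_intCast_iff_dvd_sub _ _ _).2 ?_
      rw [f.twoP_cast]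
      rwa [add_sub_add_right_eq_sub]
    · exact (key i h3 h4 (by omega)).elim

lemma Agree.length_le (hW : f.Agree q' p' c' a c w 0 v) (hp' : 0 < p') {i : ℤ} (hi0 : 0 ≤ i)
    (hi : Crit f.q f.p c f.ε i) (hA : f.ε * (f.pA * q' - f.qA * p') ≤ 0) : v ≤ i + f.pA := by
  by_contra hno
  have := hW.blockA hp' hi 0 le_rfl hi0 (by omega)
  simp only [zero_mul, add_zero] at this
  omega

lemma Agree.length_le' (hW : f.Agree q' p' c' a c w 0 v) (hp' : 0 < p') {i : ℤ} (hi0 : 0 ≤ i)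
    (hi : Crit f.q f.p c (-f.ε) i) (hB : 0 ≤ f.ε * (f.pB * q' - f.qB * p')) : v ≤ i + f.pB := by
  by_contra hno
  have := hW.blockB hp' hi 0 le_rfl hi0 (by omega)
  simp only [zero_mul, add_zero] at this
  omega

/-- Slopes not between the Farey parents give short sequences. -/
theorem short (hs : IsSlope q' p') (hi : ¬ f.Inside q' p') :
    (f.track n hn).Short (st q' p' c') := by
  intro s ψ u hc
  obtain ⟨c, rfl⟩ : ∃ c : ℤ, (c : ZMod f.twoP) = ψ := ZMod.intCast_surjective (n := f.twoP) ψ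
  obtain ⟨w, hw⟩ := agree_of_carry hs hc
  have h4 := four_mul_le (f := f) (hn := hn)
  have hpp : f.p = f.pA + f.pB := rfl
  have hA := f.pA_pos
  have hB := f.pB_pos
  have hK : (f.track n hn).K = f.pA + f.pB - 1 := rfl
  have : (u : ℤ) ≤ 2 * f.p - 2 := by
    by_cases h : f.ε * (f.pA * q' - f.qA * p') ≤ 0
    · obtain ⟨i, h1, h2, h3⟩ := f.exists_crit c 0
      have := hw.length_le hs.pos h1 h3 h
      omega
    · obtain ⟨i, h1, h2, h3⟩ := f.exists_crit' c 0
      have := hw.length_le' hs.pos h1 h3 (by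
        by_contra hno
        exact hi ⟨by omega, by omega⟩)
      omega
  omega

/-- Strings agreeing on arbitrarily long windows have the same slope. -/
theorem slope_eq {q₁ p₁ c₁ q₂ p₂ c₂ : ℤ} (h₁ : IsSlope q₁ p₁) (h₂ : IsSlope q₂ p₂)
    (h : ∀ M : ℕ, ∃ a b : ℤ, ∀ m : ℕ, m < M → st q₁ p₁ c₁ (a + m) = st q₂ p₂ c₂ (b + m)) :
    q₁ * p₂ = q₂ * p₁ := by
  obtain ⟨a, b, hab⟩ := h ((2 * p₁ * p₂).toNat + 1)
  have hp := mul_pos h₁.pos h₂.pos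
  obtain ⟨w, hw⟩ := fl_eq_of_st h₁.pos h₁.nonneg h₁.le h₂.pos h₂.nonneg h₂.le hab
  have e1 := hw 0 le_rfl (by omega)
  have e2 := hw (2 * p₁ * p₂) (by linarith) (by push_cast; rw [Int.toNat_of_nonneg] <;> linarith)
  rw [add_zero, add_zero] at e1
  have a1 := fl_lt h₁.pos (q := q₁) c₁ a (2 * p₁ * p₂)
  have a2 := lt_fl h₁.pos (q := q₁) c₁ a (2 * p₁ * p₂)
  have a3 := fl_lt h₂.pos (q := q₂) c₂ b (2 * p₁ * p₂)
  have a4 := lt_fl h₂.pos (q := q₂) c₂ b (2 * p₁ * p₂)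
  have hX : fl q₁ p₁ c₁ (a + 2 * p₁ * p₂) - fl q₁ p₁ c₁ a =
    fl q₂ p₂ c₂ (b + 2 * p₁ * p₂) - fl q₂ p₂ c₂ b := by omega
  rw [hX] at a1 a2
  generalize fl q₂ p₂ c₂ (b + 2 * p₁ * p₂) - fl q₂ p₂ c₂ b = X at a1 a2 a3 a4
  have b1 : X < 2 * (p₂ * q₁) + 1 := by
    have := h₁.pos; nlinarith
  have b2 : 2 * (p₂ * q₁) - 1 < X := by
    have := h₁.pos; nlinarith
  have b3 : X < 2 * (p₁ * q₂) + 1 := by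
    have := h₂.pos; nlinarith
  have b4 : 2 * (p₁ * q₂) - 1 < X := by
    have := h₂.pos; nlinarith
  have : p₂ * q₁ = p₁ * q₂ := by omega
  linarith

end Farey
namespace Farey
variable {f : Farey} {q₁ p₁ c₁ q₂ p₂ c₂ : ℤ} {L : ℤ}

lemma Agree.shift {q' p' c' a c w u v : ℤ} (d : ℤ) (h : f.Agree q' p' c' (a + d) (c + d * f.q) w u v) :
    f.Agree q' p' c' a c w (d + u) (d + v) := by
  intro m h1 h2
  have := h (m - d) (by omega) (by omega)
  rw [add_add_sub_cancel] at this
  rw [this]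
  unfold fl
  rw [show c + d * f.q + (m - d) * f.q = c + m * f.q by ring]

variable (f q₁ p₁ c₁ q₂ p₂ c₂ L) in
/-- A relator turn split into an arc along the first string and an arc along the second one. -/
structure Bead (a c l d w w' : ℤ) : Prop where
  pos : 0 < l
  lt : l < L
  left : f.Agree q₁ p₁ c₁ a d (2 * w) 0 l
  right : f.Agree q₂ p₂ c₂ (c - L) d (2 * w') l L

variable {n : ℕ} {hn : 2 ≤ n}

lemma exists_bead (h₁ : IsSlope q₁ p₁) (h₂ : IsSlope q₂ p₂) {k : ℕ} {a c : ℤ}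
    (h : (f.track n hn).Chain (st q₁ p₁ c₁) (st q₂ p₂ c₂) (k + 1) a c) :
    ∃ l d w w' : ℤ, f.Bead q₁ p₁ c₁ q₂ p₂ c₂ (2 * n * f.p) a c l d w w' ∧
      (f.track n hn).Chain (st q₁ p₁ c₁) (st q₂ p₂ c₂) k (a + l) (c - 2 * n * f.p + l) := by
  obtain ⟨l, φ, hl, hl', hc, hc', hk⟩ := h
  obtain ⟨d, rfl⟩ : ∃ d : ℤ, (d : ZMod f.twoP) = φ := ZMod.intCast_surjective (n := f.twoP) φ
  have hL := track_L_cast (f := f) (hn := hn)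
  obtain ⟨w, hw⟩ := agree_of_carry h₁ hc
  rw [show ((f.track n hn).N ^ (l : ℤ)) (d : ZMod f.twoP) = _ from f.step_cast _ _] at hc'
  obtain ⟨w', hw'⟩ := agree_of_carry h₂ hc'
  refine ⟨l, d, w, w', ⟨by omega, by omega, hw, ?_⟩, ?_⟩
  · rw [← sub_add, hL] at hw'
    have := hw'.shift
    rwa [add_zero, Nat.cast_sub hl'.le, hL, add_sub_cancel] at this
  · rwa [← sub_add, hL] at hk

namespace Bead
variable {a c l d w w' : ℤ}

lemma right_side (hb : f.Bead q₁ p₁ c₁ q₂ p₂ c₂ (2 * n * f.p) a c l d w w') (hn : 2 ≤ n)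
    (hp₁ : 0 < p₁) (hp₂ : 0 < p₂) (hB : 0 ≤ f.ε * (f.pB * q₁ - f.qB * p₁)) :
    ¬ f.Dom n q₂ p₂ := by
  obtain ⟨i, h1, h2, h3⟩ := f.exists_crit' d 0
  have h4 := hb.left.length_le' hp₁ h1 h3 hB
  have hpp : f.p = f.pA + f.pB := rfl
  have h5 : (2 * (n : ℤ) - 1) * f.p = 2 * n * f.p - f.p := by ring
  refine hb.right.not_dom hp₂ hn (i := i + 2 * n * f.p) (crit_per (2 * n) h3) ?_ ?_
  · rw [h5]; omega
  · omega

lemma left_side (hb : f.Bead q₁ p₁ c₁ q₂ p₂ c₂ (2 * n * f.p) a c l d w w') (hn : 2 ≤ n)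
    (hp₁ : 0 < p₁) (hp₂ : 0 < p₂) (hA : f.ε * (f.pA * q₁ - f.qA * p₁) ≤ 0)
    (hd : f.Dom n q₂ p₂) : l ≤ f.p + f.pA - 1 ∧
      f.ε * ((f.pA + (2 * n - 2) * f.p) * q₂ - (f.qA + (2 * n - 2) * f.q) * p₂) < 0 ∧
      0 < f.ε * ((f.pA + f.p) * q₂ - (f.qA + f.q) * p₂) := by
  obtain ⟨i, h1, h2, h3⟩ := f.exists_crit d 0
  have h4 := hb.left.length_le hp₁ h1 h3 hA
  have hpp : f.p = f.pA + f.pB := rfl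
  have hp := f.p_pos
  have hA' := f.pA_pos
  have hB' := f.pB_pos
  have h5 : 4 * f.p ≤ 2 * n * f.p := by
    apply mul_le_mul_of_nonneg_right _ hp.le; omega
  have e1 := hb.right.blockB hp₂ (critA h3) 1 zero_le_one (by omega) (by omega)
  have e2 := hb.right.blockA hp₂ (crit_per 1 h3) 1 zero_le_one (by omega) (by omega)
  simp only [one_mul] at e1 e2
  refine ⟨by omega, ?_, e2⟩
  rcases hd with h | h
  · exact h
  · omega

lemma vertex {a' c' l₂ d₂ w₂ w₂' : ℤ} (hn : 2 ≤ n) (h₁ : IsSlope q₁ p₁) (h₂ : IsSlope q₂ p₂)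
    (hb : f.Bead q₁ p₁ c₁ q₂ p₂ c₂ (2 * n * f.p) a c l d w w')
    (hb' : f.Bead q₁ p₁ c₁ q₂ p₂ c₂ (2 * n * f.p) a' c' l₂ d₂ w₂ w₂')
    (ha' : a' = a + l) (hc' : c' = c - 2 * n * f.p + l)
    (hl : l ≤ f.p + f.pA - 1) (hl₂ : l₂ ≤ f.p + f.pA - 1)
    (hs : 0 < f.ε * ((f.pA + f.p) * q₂ - (f.qA + f.q) * p₂)) :
    0 ≤ f.ε * ((fl q₁ p₁ c₁ a' - fl q₁ p₁ c₁ (a' - 1)) + (fl q₂ p₂ c₂ c' - fl q₂ p₂ c₂ (c' - 1))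
      - (fl f.q f.p d l - fl f.q f.p d (l - 1))
      - (fl f.q f.p d₂ (2 * n * f.p) - fl f.q f.p d₂ (2 * n * f.p - 1))) := by
  have hpp : f.p = f.pA + f.pB := rfl
  have hqq : f.q = f.qA + f.qB := rfl
  have hp := f.p_pos
  have hA' := f.pA_pos
  have hB' := f.pB_pos
  have hq2 : 2 ≤ f.q := by have := f.two_le; omega
  have hqp : f.q + 2 ≤ f.p := by have := f.lt; omega
  have h5 : 4 * f.p ≤ 2 * n * f.p := by
    apply mul_le_mul_of_nonneg_right _ hp.le; omega
  have hl0 := hb.pos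
  have hl0' := hb'.pos
  have hper := fl_period (q := f.q) (l := 2 * n * f.p) (h := 2 * (n * f.q)) hp d₂ (i := 0) (by ring)
  rw [zero_add] at hper
  have s1 := fl_succ h₁.pos h₁.nonneg h₁.le c₁ (a' - 1)
  have s2 := fl_succ h₂.pos h₂.nonneg h₂.le c₂ (c' - 1)
  have s3 := fl_succ hp f.q_nonneg f.q_le d (l - 1)
  have s4 := fl_succ hp f.q_nonneg f.q_le d₂ (2 * n * f.p - 1)
  rw [sub_add_cancel] at s1 s2 s3 s4
  have t1 := hb.left (l - 1) (by omega) (by omega)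
  have t2 := hb'.left 0 le_rfl hl0'
  have t3 := hb.right l le_rfl (by omega)
  have t4 := hb'.right (2 * n * f.p - 1) (by omega) (by omega)
  have t5 := hb.right (l + 2 * f.pA) (by omega) (by omega)
  have t6 := hb'.right (2 * n * f.p - f.pB) (by omega) (by omega)
  rw [show a + (l - 1) = a' - 1 by omega] at t1
  rw [add_zero] at t2
  rw [show c - 2 * n * f.p + l = c' by omega] at t3
  rw [show c' - 2 * n * f.p + (2 * n * f.p - 1) = c' - 1 by omega] at t4
  rw [show c - 2 * n * f.p + (l + 2 * f.pA) = c' + 2 * f.pA by omega] at t5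
  rw [show c' - 2 * n * f.p + (2 * n * f.p - f.pB) = c' - f.pB by omega] at t6
  have hlen1 : l - 1 + (2 * f.pA + 1) = l + 2 * f.pA := by ring
  have hlen2 : 2 * n * f.p - f.pB + f.pB = 2 * n * f.p := by ring
  have hlen3 : c' - f.pB + (f.pA + f.p) = c' + 2 * f.pA := by rw [hpp]; ring
  have eA := f.hA
  have eB := f.hB
  have hp₂ := h₂.pos
  rcases f.hε with hε | hε
  · rw [hε] at eA eB hs ⊢
    by_contra hno
    have g1 := fl_le_of hp d₂ (i := 2 * n * f.p - f.pB) (l := f.pB) (h := f.qB) (q := f.q) (by omega)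
    have g2 := fl_le_of hp d (i := l - 1) (l := 2 * f.pA + 1) (h := 2 * f.qA + 1) (q := f.q)
      (by linarith)
    have g3 := lt_fl hp₂ (q := q₂) c₂ (c' - f.pB) (f.pA + f.p)
    rw [hlen1] at g2
    rw [hlen2] at g1
    rw [hlen3] at g3
    have g4 : fl q₂ p₂ c₂ (c' + 2 * f.pA) - fl q₂ p₂ c₂ (c' - f.pB) ≤ f.qA + f.q - 1 := by omega
    have g5 := mul_le_mul_of_nonneg_left g4 hp₂.le
    clear g4 hno g1 g2 eA eB
    linarith
  · rw [hε] at eA eB hs ⊢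
    by_contra hno
    have g1 := le_fl_of hp d₂ (i := 2 * n * f.p - f.pB) (l := f.pB) (h := f.qB) (q := f.q) (by omega)
    have g2 := le_fl_of hp d (i := l - 1) (l := 2 * f.pA + 1) (h := 2 * f.qA) (q := f.q)
      (by linarith)
    have g3 := fl_lt hp₂ (q := q₂) c₂ (c' - f.pB) (f.pA + f.p)
    rw [hlen1] at g2
    rw [hlen2] at g1
    rw [hlen3] at g3
    have g4 : f.qA + f.q + 1 ≤ fl q₂ p₂ c₂ (c' + 2 * f.pA) - fl q₂ p₂ c₂ (c' - f.pB) := by omega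
    have g5 := mul_le_mul_of_nonneg_left g4 hp₂.le
    clear g4 hno g1 g2 eA eB
    linarith

end Bead

lemma chain_sum (h₁ : IsSlope q₁ p₁) (h₂ : IsSlope q₂ p₂)
    (hA : f.ε * (f.pA * q₁ - f.qA * p₁) ≤ 0) (hd : f.Dom n q₂ p₂) (k : ℕ) :
    ∀ {a c l d w w' : ℤ}, f.Bead q₁ p₁ c₁ q₂ p₂ c₂ (2 * n * f.p) a c l d w w' →
    (f.track n hn).Chain (st q₁ p₁ c₁) (st q₂ p₂ c₂) k (a + l) (c - 2 * n * f.p + l) →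
    ∃ Λ Λ' : ℤ, 1 ≤ Λ ∧ 1 ≤ Λ' ∧ Λ + Λ' = (k + 1) * (2 * n * f.p) ∧
      f.ε * ((k + 1) * (2 * (n * f.q))) - 1 ≤ f.ε * (fl q₁ p₁ c₁ (a + Λ - 1) - fl q₁ p₁ c₁ a +
        (fl q₂ p₂ c₂ (c - 1) - fl q₂ p₂ c₂ (c - Λ')) +
        (fl f.q f.p d (2 * n * f.p) - fl f.q f.p d (2 * n * f.p - 1))) := by
  have hp := f.p_pos
  have key : ∀ {a c l d w w' : ℤ}, f.Bead q₁ p₁ c₁ q₂ p₂ c₂ (2 * n * f.p) a c l d w w' →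
      fl q₁ p₁ c₁ (a + l - 1) - fl q₁ p₁ c₁ a +
        (fl q₂ p₂ c₂ (c - 1) - fl q₂ p₂ c₂ (c - 2 * n * f.p + l)) = 2 * (n * f.q) -
        (fl f.q f.p d (2 * n * f.p) - fl f.q f.p d (2 * n * f.p - 1)) -
        (fl f.q f.p d l - fl f.q f.p d (l - 1)) := by
    intro a c l d w w' hb
    have hl := hb.pos
    have hl' := hb.lt
    have hper := fl_period (q := f.q) (l := 2 * n * f.p) (h := 2 * (n * f.q)) hp d (i := 0) (by ring)
    rw [zero_add] at hper
    have t1 := hb.left (l - 1) (by omega) (by omega)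
    have t2 := hb.left 0 le_rfl hl
    have t3 := hb.right l le_rfl (by omega)
    have t4 := hb.right (2 * n * f.p - 1) (by omega) (by omega)
    rw [← add_sub_assoc] at t1
    rw [add_zero] at t2
    rw [show c - 2 * n * f.p + (2 * n * f.p - 1) = c - 1 by ring] at t4
    omega
  induction k with
  | zero =>
    intro a c l d w w' hb _
    refine ⟨l, 2 * n * f.p - l, hb.pos, by have := hb.lt; omega, by push_cast; ring, ?_⟩
    have h := key hb
    have s3 := fl_succ hp f.q_nonneg f.q_le d (l - 1)
    rw [sub_add_cancel] at s3
    rw [show c - (2 * n * f.p - l) = c - 2 * n * f.p + l by ring, h]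
    push_cast
    rcases f.hε with hε | hε <;> rw [hε] <;> omega
  | succ k ih =>
    intro a c l d w w' hb hch
    obtain ⟨l₂, d₂, w₂, w₂', hb', hch'⟩ := exists_bead h₁ h₂ hch
    obtain ⟨Λ, Λ', h1, h1', h2, h3⟩ := ih hb' hch'
    have hl := hb.pos
    have hl' := hb.lt
    refine ⟨l + Λ, (2 * n * f.p - l) + Λ', by omega, by omega, ?_, ?_⟩
    · rw [show l + Λ + (2 * n * f.p - l + Λ') = (Λ + Λ') + 2 * n * f.p by ring, h2]
      push_cast; ring
    · have h := key hb
      obtain ⟨g1, _, g2⟩ := hb.left_side hn h₁.pos h₂.pos hA hd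
      obtain ⟨g1', _, _⟩ := hb'.left_side hn h₁.pos h₂.pos hA hd
      have hv := hb.vertex hn h₁ h₂ hb' rfl rfl g1 g1' g2
      rw [show a + (l + Λ) - 1 = a + l + Λ - 1 by ring,
        show c - (2 * n * f.p - l + Λ') = c - 2 * n * f.p + l - Λ' by ring]
      push_cast
      rcases f.hε with hε | hε <;> rw [hε] at hv h3 ⊢ <;> linarith

set_option maxHeartbeats 1000000 in
/-- There are no arbitrarily long chains with the second slope in the domain
and the first slope not between the Farey parents. -/
theorem not_chain (h₁ : IsSlope q₁ p₁) (h₂ : IsSlope q₂ p₂) (hi : ¬ f.Inside q₁ p₁)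
    (hd : f.Dom n q₂ p₂) (h : ∀ k, ∃ a c : ℤ,
      (f.track n hn).Chain (st q₁ p₁ c₁) (st q₂ p₂ c₂) k a c) : False := by
  by_cases hA : f.ε * (f.pA * q₁ - f.qA * p₁) ≤ 0
  swap
  · obtain ⟨a, c, hch⟩ := h 1
    obtain ⟨l, d, w, w', hb, _⟩ := exists_bead h₁ h₂ hch
    refine hb.right_side hn h₁.pos h₂.pos ?_ hd
    by_contra hno
    exact hi ⟨by omega, by omega⟩
  have hp := f.p_pos
  have hp₁ := h₁.pos
  have hp₂ := h₂.pos
  have hεε : f.ε * f.ε = 1 := by rcases f.hε with h | h <;> rw [h] <;> norm_num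
  obtain ⟨a, c, hch⟩ := h ((6 * f.p * (p₁ + p₂) + 1).toNat + 1)
  obtain ⟨l, d, w, w', hb, hch'⟩ := exists_bead h₁ h₂ hch
  obtain ⟨_, g1, _⟩ := hb.left_side hn hp₁ hp₂ hA hd
  have hmul := mul_pos hp (add_pos hp₁ hp₂)
  obtain ⟨Λ, Λ', e1, e1', e2, e3⟩ := chain_sum h₁ h₂ hA hd _ hb hch'
  set k : ℤ := (((6 * f.p * (p₁ + p₂) + 1).toNat : ℕ) : ℤ) + 1 with hk
  have hk' : k = 6 * f.p * (p₁ + p₂) + 2 := by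
    rw [hk, Int.toNat_of_nonneg (by linarith)]; ring
  have f1 : f.ε * (f.p * q₁ - f.q * p₁) ≤ -1 := by
    have e : f.p * (f.ε * (f.pA * q₁ - f.qA * p₁)) = f.pA * (f.ε * (f.p * q₁ - f.q * p₁)) + p₁ := by
      linear_combination f.ε * p₁ * f.hA + p₁ * hεε
    have := f.pA_pos
    by_contra hno
    have : 0 ≤ (f.pA : ℤ) * (f.ε * (f.p * q₁ - f.q * p₁)) := mul_nonneg (by omega) (by omega)
    have : f.p * (f.ε * (f.pA * q₁ - f.qA * p₁)) ≤ 0 := mul_nonpos_of_nonneg_of_nonpos hp.le hA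
    omega
  have f2 : f.ε * (f.p * q₂ - f.q * p₂) ≤ -1 := by
    have e : f.p * (f.ε * (f.pA * q₂ - f.qA * p₂)) = f.pA * (f.ε * (f.p * q₂ - f.q * p₂)) + p₂ := by
      linear_combination f.ε * p₂ * f.hA + p₂ * hεε
    have := f.pA_pos
    by_contra hno
    have h0 : 0 ≤ f.ε * (f.p * q₂ - f.q * p₂) := by omega
    have h1 : 0 ≤ (f.pA : ℤ) * (f.ε * (f.p * q₂ - f.q * p₂)) := mul_nonneg (by omega) h0
    have h2 : 0 < f.ε * (f.pA * q₂ - f.qA * p₂) := by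
      by_contra h3
      have := mul_nonpos_of_nonneg_of_nonpos hp.le (not_lt.1 h3)
      omega
    have h3 : 0 ≤ (2 * n - 2) * (f.ε * (f.p * q₂ - f.q * p₂)) := mul_nonneg (by omega) h0
    linarith
  have d1 : f.ε * (p₁ * (fl q₁ p₁ c₁ (a + Λ - 1) - fl q₁ p₁ c₁ a)) <
      f.ε * ((Λ - 1) * q₁) + p₁ := by
    have := fl_lt hp₁ (q := q₁) c₁ a (Λ - 1)
    have := lt_fl hp₁ (q := q₁) c₁ a (Λ - 1)
    rw [← add_sub_assoc] at *
    rcases f.hε with h | h <;> rw [h] <;> linarith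
  have d2 : f.ε * (p₂ * (fl q₂ p₂ c₂ (c - 1) - fl q₂ p₂ c₂ (c - Λ'))) <
      f.ε * ((Λ' - 1) * q₂) + p₂ := by
    have h1 := fl_lt hp₂ (q := q₂) c₂ (c - Λ') (Λ' - 1)
    have h2 := lt_fl hp₂ (q := q₂) c₂ (c - Λ') (Λ' - 1)
    rw [show c - Λ' + (Λ' - 1) = c - 1 by ring] at h1 h2
    rcases f.hε with h | h <;> rw [h] <;> linarith
  generalize fl q₁ p₁ c₁ (a + Λ - 1) - fl q₁ p₁ c₁ a = D at d1 e3
  generalize fl q₂ p₂ c₂ (c - 1) - fl q₂ p₂ c₂ (c - Λ') = D' at d2 e3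
  have v1 : p₁ * (f.p * (f.ε * D) - (Λ - 1) * (f.ε * f.q) - f.p) < -(Λ - 1) := by
    have a1 := mul_lt_mul_of_pos_left d1 hp
    have a2 := mul_le_mul_of_nonneg_left f1 (show 0 ≤ Λ - 1 by omega)
    linarith
  have v2 : p₂ * (f.p * (f.ε * D') - (Λ' - 1) * (f.ε * f.q) - f.p) < -(Λ' - 1) := by
    have a1 := mul_lt_mul_of_pos_left d2 hp
    have a2 := mul_le_mul_of_nonneg_left f2 (show 0 ≤ Λ' - 1 by omega)
    linarith
  have s4 := fl_succ hp f.q_nonneg f.q_le d (2 * n * f.p - 1)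
  rw [sub_add_cancel] at s4
  have e4 : f.ε * (k * (2 * (n * f.q))) - 2 ≤ f.ε * D + f.ε * D' := by
    rcases f.hε with h | h <;> rw [h] at e3 ⊢ <;> omega
  have e5 := mul_le_mul_of_nonneg_left e4 hp.le
  have e6 : (Λ + Λ') * (f.ε * f.q) = f.p * (f.ε * (k * (2 * (n * f.q)))) := by rw [e2]; ring
  have e7 : f.ε * f.q ≤ f.p ∧ -f.p ≤ f.ε * f.q := by
    have := f.q_nonneg
    have := f.q_le
    rcases f.hε with h | h <;> rw [h] <;> constructor <;> linarith
  have e8 : -6 * f.p ≤ (f.p * (f.ε * D) - (Λ - 1) * (f.ε * f.q) - f.p) +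
      (f.p * (f.ε * D') - (Λ' - 1) * (f.ε * f.q) - f.p) := by linarith
  generalize f.p * (f.ε * D) - (Λ - 1) * (f.ε * f.q) - f.p = V at v1 e8
  generalize f.p * (f.ε * D') - (Λ' - 1) * (f.ε * f.q) - f.p = V' at v2 e8
  have i1 : V < 0 := by
    by_contra hno
    have := mul_nonneg hp₁.le (not_lt.1 hno)
    omega
  have i2 : V' < 0 := by
    by_contra hno
    have := mul_nonneg hp₂.le (not_lt.1 hno)
    omega
  have i3 : Λ - 1 < 6 * f.p * p₁ := by
    have := mul_le_mul_of_nonneg_left (show -6 * f.p ≤ V by linarith only [e8, i2]) hp₁.le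
    linarith only [this, v1]
  have i4 : Λ' - 1 < 6 * f.p * p₂ := by
    have := mul_le_mul_of_nonneg_left (show -6 * f.p ≤ V' by linarith only [e8, i1]) hp₂.le
    linarith only [this, v2]
  have i5 : 1 * k ≤ 2 * n * f.p * k := by
    apply mul_le_mul_of_nonneg_right _ (by linarith)
    have : 1 * 1 ≤ 2 * (n : ℤ) * f.p := mul_le_mul (by omega) (by omega) (by norm_num) (by omega)
    omega
  rw [mul_comm k] at e2
  linarith only [e2, i3, i4, i5, hk']

end Farey
/-- The involution of the free group flipping the sign of each letter together with its direction. -/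
def flipHom : FreeGroup Bool →* FreeGroup Bool := FreeGroup.lift fun x => (FreeGroup.of !x)⁻¹

lemma flipHom_mk (l : List (Bool × Bool)) :
    flipHom (FreeGroup.mk l) = FreeGroup.mk (l.map fun y => (!y.1, !y.2)) := by
  induction l with
  | nil => simp [← FreeGroup.one_eq_mk]
  | cons y l ih =>
    rw [← List.singleton_append, ← FreeGroup.mul_mk, map_mul, ih, List.singleton_append,
      List.map_cons, ← List.singleton_append (l := l.map _), ← FreeGroup.mul_mk]
    congr 1
    obtain ⟨x, _ | _⟩ := y <;>
      simp [flipHom, FreeGroup.lift_mk, FreeGroup.of, FreeGroup.inv_mk, FreeGroup.invRev]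

lemma flipHom_flipHom (x : FreeGroup Bool) : flipHom (flipHom x) = x := by
  induction x using Quot.inductionOn with
  | _ l =>
    change flipHom (flipHom (FreeGroup.mk l)) = FreeGroup.mk l
    rw [flipHom_mk, flipHom_mk, List.map_map]
    congr 1
    exact List.map_id'' (by simp) l

/-- The flip as an automorphism. -/
def flip : MulAut (FreeGroup Bool) :=
  MonoidHom.toMulEquiv flipHom flipHom (MonoidHom.ext flipHom_flipHom)
    (MonoidHom.ext flipHom_flipHom)

lemma flip_apply (x : FreeGroup Bool) : flip x = flipHom x := rfl

lemma flipHom_of (b : Bool) : flipHom (FreeGroup.of b) = (FreeGroup.of !b)⁻¹ :=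
  FreeGroup.lift_apply_of

lemma flip_mul_flip : flip * flip = 1 := MulEquiv.ext flipHom_flipHom

lemma flip_inv : flip⁻¹ = flip := inv_eq_of_mul_eq_one_left flip_mul_flip

/-- The free group on letters `f₊`, `f₋` extended by its automorphisms. -/
abbrev Hol : Type := FreeGroup Bool ⋊[MonoidHom.id _] MulAut (FreeGroup Bool)

/-- The homomorphism turning alternating words into positive words in the signs. -/
def toHol : F →* Hol := FreeGroup.lift fun i =>
  ⟨if i = 0 then FreeGroup.of true else (FreeGroup.of false)⁻¹, flip⟩

lemma toHol_right (x : F) : (toHol x).right = 1 ∨ (toHol x).right = flip := by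
  induction x using FreeGroup.induction_on with
  | C1 => simp
  | of i => right; simp [toHol]
  | inv_of i _ => right; simp [toHol, flip_inv]
  | mul x y hx hy =>
    rw [map_mul, SemidirectProduct.mul_right]
    rcases hx with hx | hx <;> rcases hy with hy | hy <;> simp [hx, hy, flip_mul_flip]

lemma toHol_gen_zpow (i : ℕ) (b : Bool) : toHol (gen i ^ (if b then (1 : ℤ) else -1)) =
    ⟨if i % 2 = 0 then FreeGroup.of b else flipHom (FreeGroup.of b), flip⟩ := by
  have h : toHol (gen i) =
      ⟨if i % 2 = 0 then FreeGroup.of true else (FreeGroup.of false)⁻¹, flip⟩ := by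
    rw [toHol, gen, FreeGroup.lift_apply_of]
    congr 2
    exact propext Fin.ext_iff
  have hn : toHol (gen i)⁻¹ =
      ⟨if i % 2 = 0 then FreeGroup.of false else (FreeGroup.of true)⁻¹, flip⟩ := by
    rw [map_inv, h]
    refine inv_eq_of_mul_eq_one_left ?_
    rw [SemidirectProduct.ext_iff]
    rcases Nat.mod_two_eq_zero_or_one i with hi | hi <;>
      simp [hi, flip_mul_flip, flip_apply, flipHom_of]
  cases b
  · simpa [flipHom_of, zpow_neg_one] using hn
  · simpa [flipHom_of] using h

lemma word_succ (ω : ℤ → Bool) (a : ℤ) (k : ℕ) :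
    word ω true a (k + 1) = word ω true a k ++ [(ω (a + k), true)] := by
  simp [word, List.range_succ]

lemma toHol_prod (ω : ℤ → Bool) (k : ℕ) : toHol (((List.range (2 * k)).map fun i : ℕ =>
    gen i ^ (if ω i then (1 : ℤ) else -1)).prod) =
    SemidirectProduct.inl (FreeGroup.mk (word ω true 0 (2 * k))) := by
  induction k with
  | zero => simp [word, ← FreeGroup.one_eq_mk]
  | succ k ih =>
    rw [Nat.mul_succ, List.range_succ, List.range_succ, word_succ ω 0 (2 * k + 1),
      word_succ ω 0 (2 * k)]
    simp only [List.map_append, List.prod_append, List.map_singleton, List.prod_singleton, map_mul,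
      ih, toHol_gen_zpow, ← FreeGroup.mul_mk]
    rw [SemidirectProduct.ext_iff]
    simp [flip_mul_flip, flip_apply, flipHom_flipHom, mul_assoc, FreeGroup.of,
      Nat.add_mod]

lemma sign_eq (s : ℚ) (i : ℕ) (hs : 0 ≤ s) : ((-1 : ℤ) ^ (⌊(i : ℚ) * s⌋.toNat)) =
    if st s.num s.den 0 i then 1 else -1 := by
  have h : ⌊(i : ℚ) * s⌋ = fl s.num s.den 0 i := by
    unfold fl
    rw [zero_add]
    conv_lhs => rw [← Rat.num_div_den s]
    rw [← mul_div_assoc]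
    exact_mod_cast Rat.floor_intCast_div_natCast (i * s.num) s.den
  have h0 : 0 ≤ ⌊(i : ℚ) * s⌋ := Int.floor_nonneg.2 (by positivity)
  rw [h] at h0 ⊢
  unfold st
  obtain ⟨j, hj⟩ := Int.eq_ofNat_of_zero_le h0
  rw [hj, Int.toNat_natCast, neg_one_pow_eq_ite]
  simp only [decide_eq_true_eq, Nat.even_iff]
  congr 1
  simp only [eq_iff_iff]
  omega

lemma toHol_uWord (s : ℚ) (hs : 0 ≤ s) : toHol (uWord s) = SemidirectProduct.inl
    (FreeGroup.mk (word (st s.num s.den 0) true 0 (2 * s.den))) := by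
  rw [← toHol_prod, uWord]
  congr 3
  funext i
  rw [sign_eq s i hs]

lemma st_neg {q p : ℤ} (hp : 0 < p) (c i : ℤ) : (!st q p c i) = st q p (-1 - c) (-i) := by
  have h : fl q p (-1 - c) (-i) = -1 - fl q p c i := by
    unfold fl
    generalize hx : c + i * q = x
    rw [show -1 - c + -i * q = -1 - x by rw [← hx]; ring]
    have h1 := Int.mul_ediv_self_le (x := x) hp.ne'
    have h2 := Int.lt_mul_ediv_self_add (x := x) hp
    rw [Int.ediv_eq_iff_of_pos hp]
    constructor <;> linarith
  unfold st
  rw [h, ← decide_not, decide_eq_decide]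
  omega

lemma word_append {ω : ℤ → Bool} {a P : ℤ} {u v : ℕ} (hω : ∀ i, ω (i + P) = ω i) (hu : (u : ℤ) = P) :
    word ω true a (u + v) = word ω true a u ++ word ω true a v := by
  simp only [word, List.range_add, List.map_append, List.map_map]
  congr 2
  funext i
  simp only [Function.comp, sg_true, one_mul, Prod.mk.injEq, and_true]
  rw [← hω (a + i), ← hu]
  push_cast
  congr 1
  ring

lemma mk_word_pow {ω : ℤ → Bool} {a : ℤ} {u : ℕ} (hω : ∀ i, ω (i + u) = ω i) (N : ℕ) :
    FreeGroup.mk (word ω true a u) ^ N = FreeGroup.mk (word ω true a (N * u)) := by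
  induction N with
  | zero => simp [word, ← FreeGroup.one_eq_mk]
  | succ N ih => rw [pow_succ', ih, add_one_mul, add_comm, word_append hω rfl, FreeGroup.mul_mk]

lemma st_period {q p : ℤ} (hp : 0 < p) (c i : ℤ) : st q p c (i + 2 * p) = st q p c i := by
  rw [st_eq_iff, fl_period (q := q) hp c (l := 2 * p) (h := 2 * q) (by ring)]
  omega

lemma flipHom_word {q p : ℤ} (hp : 0 < p) (c a : ℤ) (δ : Bool) (n : ℕ) :
    flipHom (FreeGroup.mk (word (st q p c) δ a n)) =
      FreeGroup.mk (word (st q p (-1 - c)) (!δ) (-a) n) := by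
  rw [flipHom_mk]
  congr 1
  simp only [word, List.map_map]
  congr 1
  funext i
  simp only [Function.comp, st_neg hp, sg_not]
  congr 2
  ring

namespace Farey
variable {f : Farey} {n : ℕ} {hn : 2 ≤ n}

lemma rel_eq_word (c : ℤ) (δ : Bool) :
    (f.track n hn).rel (c : ZMod f.twoP) δ = word (st f.q f.p c) δ 0 (f.track n hn).L := by
  simp only [Track.rel, word, zero_add]
  congr 1
  funext i
  rw [← f.colour_cast, ← f.step_cast]
  rfl

lemma flipHom_mem {x : FreeGroup Bool} (hx : x ∈ (f.track n hn).R) :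
    flipHom x ∈ (f.track n hn).R := by
  have h : (f.track n hn).R ≤ (f.track n hn).R.comap flipHom := by
    refine Subgroup.normalClosure_le_normal ?_
    rintro _ ⟨_, ⟨φ, δ, rfl⟩, rfl⟩
    obtain ⟨c, rfl⟩ : ∃ c : ℤ, (c : ZMod f.twoP) = φ := ZMod.intCast_surjective (n := f.twoP) φ
    rw [SetLike.mem_coe, Subgroup.mem_comap, rel_eq_word, flipHom_word f.p_pos, neg_zero,
      ← rel_eq_word]
    exact Subgroup.subset_normalClosure ⟨_, ⟨_, _, rfl⟩, rfl⟩
  exact h hx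

lemma flip_mem_iff {x : FreeGroup Bool} : flip x ∈ (f.track n hn).R ↔ x ∈ (f.track n hn).R :=
  ⟨fun h => by simpa [flip_apply, flipHom_flipHom] using flipHom_mem h, flipHom_mem⟩

variable (f n hn) in
/-- The elements of the free group that become trivial after imposing all relators. -/
def kernel : Subgroup F := ((f.track n hn).R.map SemidirectProduct.inl).comap toHol

lemma mem_kernel {x : F} : x ∈ f.kernel n hn ↔ ∃ g ∈ (f.track n hn).R, SemidirectProduct.inl g = toHol x :=
  Iff.rfl

instance : (f.kernel n hn).Normal where
  conj_mem x hx y := by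
    obtain ⟨g, hg, h⟩ := mem_kernel.1 hx
    refine mem_kernel.2 ⟨(toHol y).left * (toHol y).right g * (toHol y).left⁻¹, ?_, ?_⟩
    · refine Subgroup.normalClosure_normal.conj_mem _ ?_ _
      rcases toHol_right y with h | h <;> rw [h]
      · exact hg
      · exact flip_mem_iff.2 hg
    · rw [map_mul toHol, map_mul toHol, map_inv toHol, ← h, SemidirectProduct.ext_iff]
      simp

lemma heckN_le {r : ℚ} (h1 : r.num = f.q) (h2 : (r.den : ℤ) = f.p) : heckN r n ≤ f.kernel n hn := by
  refine Subgroup.normalClosure_le_normal ?_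
  rw [Set.singleton_subset_iff, SetLike.mem_coe, mem_kernel]
  refine ⟨_, Subgroup.subset_normalClosure ⟨_, ⟨((0 : ℤ) : ZMod f.twoP), true, rfl⟩, rfl⟩, ?_⟩
  have hr : 0 ≤ r := by rw [← Rat.num_nonneg, h1]; exact f.q_nonneg
  rw [map_pow, toHol_uWord r hr, ← map_pow, mk_word_pow, rel_eq_word, h1, h2]
  · congr 3
    have := track_L_cast (f := f) (hn := hn)
    zify
    rw [this, h2]; ring
  · intro i
    rw [h1, h2]
    push_cast
    rw [h2]
    exact st_period f.p_pos _ _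

/-- A conjugacy produces closing words of arbitrary length. -/
lemma exists_closing {s s' : ℚ} (hs : 0 ≤ s) (hs' : 0 ≤ s') {x : F} {δ : Bool}
    (h : ∀ N : ℕ, uWord s' ^ N * (x * (if δ then uWord s ^ N else (uWord s ^ N)⁻¹) * x⁻¹) ∈
      f.kernel n hn) :
    ∃ g ≠ [], ∃ δ c, ∀ M, ∃ n₁ ≥ M, ∃ n' a, FreeGroup.mk (closing (st s.num s.den c)
      (st s'.num s'.den 0) δ a n' n₁ g) ∈ (f.track n hn).R := by
  have hp : 0 < (s.den : ℤ) := by exact_mod_cast s.den_pos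
  have hp' : 0 < (s'.den : ℤ) := by exact_mod_cast s'.den_pos
  obtain ⟨g, hg0, hg⟩ : ∃ g ≠ [], FreeGroup.mk g = (toHol x).left := by
    refine ⟨(toHol x).left.toWord ++ [(true, true), (true, false)], by simp, ?_⟩
    rw [← FreeGroup.mul_mk, FreeGroup.mk_toWord, mul_eq_left, FreeGroup.one_eq_mk]
    exact Quot.sound (FreeGroup.Red.Step.not (L₁ := []) (L₂ := []))
  obtain ⟨ε, c, hc⟩ : ∃ ε c, ∀ N : ℕ, ∃ a, (toHol x).right
      (if δ then FreeGroup.mk (word (st s.num s.den 0) true 0 (N * (2 * s.den)))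
      else (FreeGroup.mk (word (st s.num s.den 0) true 0 (N * (2 * s.den))))⁻¹) =
      FreeGroup.mk (word (st s.num s.den c) ε a (N * (2 * s.den))) := by
    rcases toHol_right x with h | h <;> rw [h] <;> cases δ
    · exact ⟨false, 0, fun N => ⟨_, by
        rw [if_neg (by simp), FreeGroup.inv_mk, invRev_word]; rfl⟩⟩
    · exact ⟨true, 0, fun N => ⟨_, rfl⟩⟩
    · exact ⟨true, -1 - 0, fun N => ⟨_, by
        simp only [Bool.false_eq_true, if_false, FreeGroup.inv_mk, invRev_word, flip_apply]
        exact flipHom_word hp ..⟩⟩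
    · exact ⟨false, -1 - 0, fun N => ⟨_, flipHom_word hp ..⟩⟩
  refine ⟨g, hg0, ε, c, fun M => ?_⟩
  obtain ⟨a, ha⟩ := hc M
  refine ⟨M * (2 * s.den), Nat.le_mul_of_pos_right _ (by have := s.den_pos; omega),
    M * (2 * s'.den), a, ?_⟩
  obtain ⟨y, hy, hy'⟩ := mem_kernel.1 (h M)
  have e := congrArg SemidirectProduct.left hy'
  have e1 : toHol (uWord s ^ M) = SemidirectProduct.inl (FreeGroup.mk
      (word (st s.num s.den 0) true 0 (M * (2 * s.den)))) := by
    rw [map_pow, toHol_uWord s hs, ← map_pow, mk_word_pow]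
    exact fun i => by push_cast; exact st_period hp _ _
  have e2 : toHol (uWord s' ^ M) = SemidirectProduct.inl (FreeGroup.mk
      (word (st s'.num s'.den 0) true 0 (M * (2 * s'.den)))) := by
    rw [map_pow, toHol_uWord s' hs', ← map_pow, mk_word_pow]
    exact fun i => by push_cast; exact st_period hp' _ _
  have e3 : toHol (if δ then uWord s ^ M else (uWord s ^ M)⁻¹) = SemidirectProduct.inl
      (if δ then FreeGroup.mk (word (st s.num s.den 0) true 0 (M * (2 * s.den)))
      else (FreeGroup.mk (word (st s.num s.den 0) true 0 (M * (2 * s.den))))⁻¹) := by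
    cases δ
    · rw [if_neg (by simp), if_neg (by simp), map_inv, map_inv, e1]
    · exact e1
  rw [map_mul, map_mul, map_mul, map_inv, e2, e3] at e
  simp only [SemidirectProduct.left_inl, SemidirectProduct.mul_left, SemidirectProduct.right_inl,
    map_one, MulAut.one_apply, MonoidHom.id_apply, SemidirectProduct.mul_right, mul_one,
    SemidirectProduct.inv_left, ha, ← hg, map_inv] at e
  rw [closing, ← FreeGroup.mul_mk, ← FreeGroup.mul_mk, ← FreeGroup.mul_mk, ← FreeGroup.inv_mk,
    ← mul_assoc (FreeGroup.mk g)]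
  convert hy
  rw [e]
  simp

/-- If `u_s` and `u_{s'}^{±1}` become conjugate and `s'` is in the domain, then `s` is
between the Farey parents. -/
theorem inside_of_conj {r s s' : ℚ} (h1 : r.num = f.q) (h2 : (r.den : ℤ) = f.p) (hne : s ≠ s')
    (hs : 0 ≤ s) (hs1 : s ≤ 1) (hs' : 0 ≤ s') (hs1' : s' ≤ 1) (hn : 2 ≤ n)
    (hd : f.Dom n s'.num s'.den)
    (hconj : IsConj (heckQ r n (uWord s)) (heckQ r n (uWord s')) ∨
      IsConj (heckQ r n (uWord s)) ((heckQ r n (uWord s'))⁻¹)) :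
    f.Inside s.num s.den := by
  by_contra hi
  have slope : ∀ {t : ℚ}, 0 ≤ t → t ≤ 1 → IsSlope t.num t.den := fun {t} h0 h1 =>
    ⟨by exact_mod_cast t.den_pos, Rat.num_nonneg.2 h0, by
      have := Rat.num_le_denom_iff.2 h1
      exact this⟩
  have hS := slope hs hs1
  have hS' := slope hs' hs1'
  obtain ⟨x, δ, hx⟩ : ∃ (x : F) (δ : Bool), ∀ N : ℕ, uWord s' ^ N *
      (x * (if δ then uWord s ^ N else (uWord s ^ N)⁻¹) * x⁻¹) ∈ f.kernel n hn := by
    rcases hconj with h | h <;> obtain ⟨x, hx⟩ := isConj_iff.1 h <;>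
      obtain ⟨x, rfl⟩ := QuotientGroup.mk'_surjective _ x
    · refine ⟨x, false, fun N => heckN_le h1 h2 ((QuotientGroup.eq_one_iff _).1 ?_)⟩
      change heckQ r n _ = 1
      change heckQ r n x * _ * (heckQ r n x)⁻¹ = _ at hx
      simp only [map_mul, map_inv, map_pow, Bool.false_eq_true, if_false, ← hx, conj_pow]
      group
    · refine ⟨x, true, fun N => heckN_le h1 h2 ((QuotientGroup.eq_one_iff _).1 ?_)⟩
      change heckQ r n _ = 1
      change heckQ r n x * _ * (heckQ r n x)⁻¹ = _ at hx
      rw [eq_inv_iff_mul_eq_one, ← eq_inv_iff_mul_eq_one, eq_comm, inv_eq_iff_eq_inv] at hx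
      simp only [map_mul, map_inv, map_pow, if_true, hx, inv_pow, conj_pow]
      group
  obtain ⟨g, hg, δ, c, H⟩ := exists_closing hs hs' hx
  have hT := tame (hn := hn) (c' := 0) hS' hd
  have hSh := short (n := n) (hn := hn) (c' := c) hS hi
  cases δ
  · have := slope_eq hS hS' (extract_parallel hSh hT hg H)
    exact hne (Rat.eq_iff_mul_eq_mul.2 this)
  · exact not_chain hS hS' hi hd (extract_chain hSh hT hg H)

end Farey
lemma cfQ_nonneg (L : List ℕ) : 0 ≤ cfQ L := by
  induction L with
  | nil => simp [cfQ]
  | cons a L ih => rw [cfQ]; positivity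

lemma cfQ_le_one {L : List ℕ} (h : ∀ x ∈ L, 0 < x) : cfQ L ≤ 1 := by
  cases L with
  | nil => simp [cfQ]
  | cons a L =>
    rw [cfQ]
    have h1 : (1 : ℚ) ≤ a := by exact_mod_cast h a (by simp)
    have := cfQ_nonneg L
    rw [div_le_one (by linarith)]
    linarith

/-- A continued fraction is a fractional linear function of the value of its tail. -/
lemma exists_convergent {K : List ℕ} (hK : ∀ x ∈ K, 0 < x) : ∃ a b c d : ℕ, 0 < c ∧
    (b : ℤ) * c - a * d = (-1) ^ K.length ∧
    ∀ T, cfQ (K ++ T) = (a + b * cfQ T) / (c + d * cfQ T) := by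
  induction K with
  | nil => exact ⟨0, 1, 1, 0, one_pos, by simp, fun T => by simp⟩
  | cons k K ih =>
    obtain ⟨a, b, c, d, hc, h1, h2⟩ := ih fun x hx => hK x (by simp [hx])
    have hk : 0 < k := hK k (by simp)
    refine ⟨c, d, k * c + a, k * d + b, by positivity, ?_, fun T => ?_⟩
    · rw [List.length_cons, pow_succ, ← h1]; push_cast; ring
    · have := cfQ_nonneg T
      have hc' : (0 : ℚ) < c := by exact_mod_cast hc
      have h3 : 0 < c + d * cfQ T := by positivity
      rw [List.cons_append, cfQ, h2]
      push_cast
      have : 0 < k * c + a + (k * d + b) * cfQ T := by positivity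
      field_simp
      ring

lemma exists_isCFExp {x : ℚ} (h0 : 0 < x) (h1 : x < 1) : ∃ L, IsCFExp x L := by
  induction hN : x.num.toNat using Nat.strong_induction_on generalizing x with
  | _ N ih =>
    subst hN
    have h2 : 1 < x⁻¹ := (one_lt_inv₀ h0).2 h1
    have h3 : 1 ≤ ⌊x⁻¹⌋ := Int.le_floor.2 (by exact_mod_cast h2.le)
    obtain ⟨a, ha⟩ := Int.eq_ofNat_of_zero_le (zero_le_one.trans h3)
    rw [ha] at h3
    have hx : x = 1 / ((a : ℚ) + Int.fract x⁻¹) := by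
      have := Int.floor_add_fract x⁻¹
      rw [ha] at this
      push_cast at this
      rw [this]; simp
    rcases (Int.fract_nonneg x⁻¹).eq_or_lt with hf | hf
    · rw [← hf, add_zero] at hx
      refine ⟨[a], by simp, by simp; omega, ?_, by rw [cfQ, cfQ, add_zero]; exact hx⟩
      by_contra hno
      have : a = 1 := by simp at hno; omega
      rw [this] at hx
      simp at hx
      linarith
    · have hlt := Rat.fract_inv_num_lt_num_of_pos h0
      obtain ⟨L, hne, hpos, hlast, hL⟩ := ih _ (by
        have := Rat.num_pos.2 h0; omega) hf (Int.fract_lt_one _) rfl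
      refine ⟨a :: L, by simp, ?_, ?_, by rw [cfQ, ← hL]; exact hx⟩
      · simp only [List.mem_cons, forall_eq_or_imp]
        exact ⟨by omega, hpos⟩
      · obtain ⟨b, L, rfl⟩ := List.exists_cons_of_ne_nil hne
        simpa [List.getLast!] using hlast

lemma getLast!_concat (K : List ℕ) (z : ℕ) : (K ++ [z]).getLast! = z := by
  rw [List.getLast!_eq_getLast?_getD]; simp

/-- The Farey parents of a continued fraction. -/
lemma exists_farey {m : ℕ} {K : List ℕ} {z : ℕ} (hm : 2 ≤ m) (hK : ∀ x ∈ K, 0 < x) (hz : 2 ≤ z) :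
    ∃ f : Farey, (cfQ (m :: K ++ [z])).num = f.q ∧ ((cfQ (m :: K ++ [z])).den : ℤ) = f.p ∧
      f.ε = (-1) ^ (K.length + 1) ∧
      cfQ (m :: K) = (f.qA : ℤ) / (f.pA : ℤ) ∧
      cfQ (m :: K ++ [z - 1]) = (f.qB : ℤ) / (f.pB : ℤ) ∧
      (∀ w : ℕ, 0 < w → cfQ (m :: K ++ [z, w]) =
        (f.qA + w * f.q : ℤ) / (f.pA + w * f.p : ℤ)) ∧
      cfQ (m :: K ++ [z - 1, 2]) = (f.qB + f.q : ℤ) / (f.pB + f.p : ℤ) := by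
  obtain ⟨a, b, c, d, hc, h1, h2⟩ := exists_convergent hK
  obtain ⟨y, rfl⟩ : ∃ y, z = y + 1 := ⟨z - 1, by omega⟩
  have hy : 1 ≤ y := by omega
  have hcf : ∀ T, cfQ (m :: K ++ T) = (c + d * cfQ T) / (m * c + a + (m * d + b) * cfQ T) :=
    fun T => by
      have := cfQ_nonneg T
      have hc' : (0 : ℚ) < c := by exact_mod_cast hc
      have hm' : (0 : ℚ) < m := by exact_mod_cast (by omega : 0 < m)
      have h3 : 0 < c + d * cfQ T := by positivity
      rw [List.cons_append, cfQ, h2]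
      have : 0 < m * c + a + (m * d + b) * cfQ T := by positivity
      field_simp
      ring
  have hcy : 1 ≤ c * y := Nat.mul_pos hc hy
  have hmc : 0 < m * c := by positivity
  have hB : 2 * (c * y + d) ≤ m * (c * y + d) := Nat.mul_le_mul_right _ hm
  have hA : 2 * c ≤ m * c := Nat.mul_le_mul_right _ hm
  let f : Farey :=
    { pA := m * c + a
      qA := c
      pB := m * (c * y + d) + (a * y + b)
      qB := c * y + d
      ε := (-1) ^ (K.length + 1)
      hε := neg_one_pow_eq_or ℤ _
      pA_pos := by omega
      pB_pos := by omega
      det := by rw [pow_succ, ← h1]; push_cast; ring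
      two_le := by omega
      lt := by omega }
  have hc' : (0 : ℚ) < c := by exact_mod_cast hc
  have hm' : (0 : ℚ) < m := by exact_mod_cast (by omega : 0 < m)
  have hy' : (0 : ℚ) < y := by exact_mod_cast hy
  have hr : cfQ (m :: K ++ [y + 1]) = (f.q : ℤ) / (f.p : ℤ) := by
    rw [hcf, cfQ, cfQ]
    simp only [Farey.q, Farey.p, f]
    push_cast
    have h3 : 0 < m * c + a + (m * (c * y + d) + (a * y + b) : ℚ) := by positivity
    have h4 : 0 < m * c + a + (m * d + b) * (1 / (y + 1 + 0) : ℚ) := by positivity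
    rw [div_eq_div_iff h4.ne' h3.ne']
    field_simp
    ring
  have hcop : Nat.Coprime f.q.natAbs f.p.natAbs := by
    rw [← Int.isCoprime_iff_nat_coprime]
    have hεε : f.ε * f.ε = 1 := by rcases f.hε with h | h <;> rw [h] <;> norm_num
    exact ⟨f.ε * f.pA, -(f.ε * f.qA), by linear_combination f.ε * f.hA + hεε⟩
  refine ⟨f, ?_, ?_, rfl, ?_, ?_, fun w hw => ?_, ?_⟩
  · rw [hr]; exact Rat.num_div_eq_of_coprime f.p_pos hcop
  · rw [hr]; exact Rat.den_div_eq_of_coprime f.p_pos hcop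
  · have := hcf []
    rw [List.append_nil] at this
    rw [this, cfQ]
    simp [f]
  · rw [hcf, cfQ, cfQ, Nat.add_sub_cancel]
    simp only [f]
    push_cast
    have h3 : 0 < (m * (c * y + d) + (a * y + b) : ℚ) := by positivity
    have h4 : 0 < m * c + a + (m * d + b) * (1 / (y + 0) : ℚ) := by positivity
    rw [div_eq_div_iff h4.ne' h3.ne']
    field_simp
    ring
  · have hw' : (0 : ℚ) < w := by exact_mod_cast hw
    rw [hcf, cfQ, cfQ, cfQ]
    simp only [Farey.q, Farey.p, f]
    push_cast
    have h3 : 0 < m * c + a + w * (m * c + a + (m * (c * y + d) + (a * y + b)) : ℚ) := by positivity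
    have h4 : 0 < m * c + a + (m * d + b) * (1 / (y + 1 + 1 / (w + 0)) : ℚ) := by positivity
    rw [div_eq_div_iff h4.ne' h3.ne']
    field_simp
    ring
  · rw [hcf, cfQ, cfQ, cfQ, Nat.add_sub_cancel]
    simp only [Farey.q, Farey.p, f]
    push_cast
    have h3 : 0 < (m * (c * y + d) + (a * y + b)) +
      (m * c + a + (m * (c * y + d) + (a * y + b)) : ℚ) := by positivity
    have h4 : 0 < m * c + a + (m * d + b) * (1 / (y + 1 / (2 + 0)) : ℚ) := by positivity
    rw [div_eq_div_iff h4.ne' h3.ne']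
    field_simp
    ring

lemma lt_frac {s : ℚ} {u v : ℤ} (hv : 0 < v) :
    s < (u : ℚ) / (v : ℚ) ↔ v * s.num - u * s.den < 0 := by
  have hv' : (0 : ℚ) < v := by exact_mod_cast hv
  have hd : (0 : ℚ) < s.den := by exact_mod_cast s.den_pos
  conv_lhs => rw [← Rat.num_div_den s, div_lt_div_iff₀ hd hv']
  rw [sub_neg, mul_comm v]
  exact_mod_cast Iff.rfl

lemma frac_lt {s : ℚ} {u v : ℤ} (hv : 0 < v) :
    (u : ℚ) / (v : ℚ) < s ↔ 0 < v * s.num - u * s.den := by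
  have hv' : (0 : ℚ) < v := by exact_mod_cast hv
  have hd : (0 : ℚ) < s.den := by exact_mod_cast s.den_pos
  conv_lhs => rw [← Rat.num_div_den s, div_lt_div_iff₀ hv' hd]
  rw [sub_pos, mul_comm v]
  exact_mod_cast Iff.rfl

lemma le_frac {s : ℚ} {u v : ℤ} (hv : 0 < v) :
    s ≤ (u : ℚ) / (v : ℚ) ↔ v * s.num - u * s.den ≤ 0 := by
  rw [← not_lt, frac_lt hv, not_lt]

lemma frac_le {s : ℚ} {u v : ℤ} (hv : 0 < v) :
    (u : ℚ) / (v : ℚ) ≤ s ↔ 0 ≤ v * s.num - u * s.den := by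
  rw [← not_lt, lt_frac hv, not_lt]

lemma bounds_of_mem {M : List ℕ} (hpos : ∀ x ∈ M, 0 < x) (hlast : 2 ≤ M.getLast!)
    {n : ℕ} (hn : 2 ≤ n) {s : ℚ} (hs : memI1 M n s ∨ memI2 M n s) : 0 ≤ s ∧ s ≤ 1 := by
  have h1 : cfQ (M.dropLast ++ [M.getLast! - 1, 2]) ≤ 1 := cfQ_le_one fun x hx => by
    simp only [List.mem_append, List.mem_cons, List.not_mem_nil, or_false] at hx
    rcases hx with hx | rfl | rfl
    · exact hpos x (List.mem_of_mem_dropLast hx)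
    · omega
    · omega
  have h2 : cfQ (M ++ [2 * n - 2]) ≤ 1 := cfQ_le_one fun x hx => by
    simp only [List.mem_append, List.mem_cons, List.not_mem_nil, or_false] at hx
    rcases hx with hx | rfl
    · exact hpos x hx
    · omega
  have h3 := cfQ_nonneg (M.dropLast ++ [M.getLast! - 1, 2])
  have h4 := cfQ_nonneg (M ++ [2 * n - 2])
  unfold memI1 memI2 at hs
  split_ifs at hs
  all_goals
    rcases hs with ⟨h5, h6⟩ | ⟨h5, h6⟩
    · exact ⟨h5, by linarith⟩
    · exact ⟨by linarith, h6⟩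

namespace Farey
variable {f : Farey} {n : ℕ}

lemma dom_of_mem {m : ℕ} {K : List ℕ} {z : ℕ} (hn : 2 ≤ n) (hε : f.ε = (-1) ^ (K.length + 1))
    (h1 : ∀ w : ℕ, 0 < w → cfQ (m :: K ++ [z, w]) =
        (f.qA + w * f.q : ℤ) / (f.pA + w * f.p : ℤ))
    (h2 : cfQ (m :: K ++ [z - 1, 2]) = (f.qB + f.q : ℤ) / (f.pB + f.p : ℤ)) {s : ℚ}
    (hs : memI1 (m :: K ++ [z]) n s ∨ memI2 (m :: K ++ [z]) n s) : f.Dom n s.num s.den := by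
  have hp := f.p_pos
  have hA := f.pA_pos
  have hw : ((2 * n - 2 : ℕ) : ℤ) = 2 * n - 2 := by omega
  have h3 : (m :: K ++ [z]) ++ [2 * n - 2] = m :: K ++ [z, 2 * n - 2] := by simp
  have h4 : 0 < f.pA + (2 * n - 2) * f.p := by
    have : 0 ≤ (2 * (n : ℤ) - 2) * f.p := mul_nonneg (by omega) hp.le
    omega
  have h5 : 0 < f.pB + f.p := by omega
  unfold memI1 memI2 at hs
  rw [List.dropLast_concat, getLast!_concat, h3, h1 _ (by omega), h2, hw] at hs
  unfold Dom
  have hlen : (m :: K ++ [z]).length = K.length + 1 + 1 := by simp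
  rw [hlen] at hs
  simp only [Nat.even_add_one (n := K.length + 1)] at hs
  by_cases he : Even (K.length + 1)
  · rw [if_neg (by simpa using he), if_neg (by simpa using he), lt_frac h4, frac_le h5] at hs
    rw [hε, he.neg_one_pow, one_mul, one_mul]
    exact hs.imp And.right And.left
  · rw [if_pos he, if_pos he, frac_lt h4, le_frac h5] at hs
    rw [hε, (Nat.not_even_iff_odd.1 he).neg_one_pow]
    rcases hs with hs | hs
    · right; linarith
    · left; linarith

lemma between_of_inside {s a b : ℚ} (ha : a = (f.qA : ℤ) / (f.pA : ℤ))
    (hb : b = (f.qB : ℤ) / (f.pB : ℤ)) (h : f.Inside s.num s.den) :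
    a < s ∧ s < b ∨ b < s ∧ s < a := by
  have hA : (0 : ℤ) < f.pA := by exact_mod_cast f.pA_pos
  have hB : (0 : ℤ) < f.pB := by exact_mod_cast f.pB_pos
  rw [ha, hb, lt_frac hA, lt_frac hB, frac_lt hA, frac_lt hB]
  obtain ⟨h1, h2⟩ := h
  rcases f.hε with h | h <;> rw [h] at h1 h2
  · left; constructor <;> linarith
  · right; constructor <;> linarith

end Farey

/-- The value of a continued fraction with first entry `m` and reciprocal tail `y`. -/
def cfHead (m : ℕ) (y : ℚ) : ℚ := 1 / (m + 1 / y)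

lemma cfQ_cons_cons (m l : ℕ) (T : List ℕ) : cfQ (m :: l :: T) = cfHead m (l + cfQ T) := rfl

lemma cfHead_lt {m : ℕ} {y y' : ℚ} (hy : 0 < y) (hy' : 0 < y') :
    cfHead m y < cfHead m y' ↔ y < y' := by
  unfold cfHead
  rw [one_div_lt_one_div (by positivity) (by positivity), add_lt_add_iff_left,
    one_div_lt_one_div hy' hy]

lemma cfHead_le {m : ℕ} {y y' : ℚ} (hy : 0 < y) (hy' : 0 < y') :
    cfHead m y ≤ cfHead m y' ↔ y ≤ y' := by
  rw [← not_lt, cfHead_lt hy' hy, not_lt]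

lemma exists_cfHead {m : ℕ} (hm : 0 < m) {s : ℚ} (h0 : 0 < s) (h1 : s < 1 / m) :
    ∃ y, 0 < y ∧ s = cfHead m y := by
  have hm' : (0 : ℚ) < m := by exact_mod_cast hm
  have : 0 < 1 / s - m := by
    rw [sub_pos, lt_div_iff₀ h0]
    rwa [lt_div_iff₀ hm', mul_comm] at h1
  exact ⟨1 / (1 / s - m), by positivity, by unfold cfHead; simp⟩

lemma cfHead_pos {m : ℕ} {y : ℚ} (hy : 0 < y) : 0 < cfHead m y := by
  unfold cfHead; positivity

lemma cfHead_lt_inv {m : ℕ} (hm : 0 < m) {y : ℚ} (hy : 0 < y) : cfHead m y < 1 / m := by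
  have hm' : (0 : ℚ) < m := by exact_mod_cast hm
  exact one_div_lt_one_div_of_lt hm' (by simpa using hy)

/-- The conclusion for one slope: its expansion can be derived and the derived slope lies in the
domain of the derived continued fraction. -/
def Derivable (M : List ℕ) (n : ℕ) (s : ℚ) : Prop :=
  ∃ Ls : List ℕ, IsCFExp s Ls ∧ 2 ≤ Ls.length ∧ (Ls[1]? = some 1 → 3 ≤ Ls.length) ∧
    (memI1 (deriveCF M) n (cfQ (deriveCF Ls)) ∨ memI2 (deriveCF M) n (cfQ (deriveCF Ls)))

lemma getLast!_cons_cons (a b : ℕ) (L : List ℕ) : (a :: b :: L).getLast! = (b :: L).getLast! := by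
  simp [List.getLast!]

lemma IsCFExp.ne_nil_getLast {s : ℚ} {L : List ℕ} (h : IsCFExp s L) (a : ℕ) :
    2 ≤ (a :: L).getLast! := by
  obtain ⟨b, L, rfl⟩ := List.exists_cons_of_ne_nil h.1
  rw [getLast!_cons_cons]
  exact h.2.2.1

lemma derivable_one {m n : ℕ} {R : List ℕ} {s : ℚ} (hm : 0 < m) (hR : R ≠ [])
    (h1 : cfHead m 1 < s) (h2 : s < cfHead m 2)
    (hs : memI1 (m :: 1 :: R) n s ∨ memI2 (m :: 1 :: R) n s) : Derivable (m :: 1 :: R) n s := by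
  obtain ⟨y, hy, rfl⟩ := exists_cfHead hm ((cfHead_pos one_pos).trans h1)
    (h2.trans (cfHead_lt_inv hm two_pos))
  rw [cfHead_lt one_pos hy] at h1
  rw [cfHead_lt hy two_pos] at h2
  obtain ⟨L, hL⟩ := exists_isCFExp (x := y - 1) (by linarith) (by linarith)
  have hLne := hL.1
  refine ⟨m :: 1 :: L, ⟨by simp, ?_, ?_, ?_⟩, by simp, fun _ => ?_, ?_⟩
  · simp only [List.mem_cons, forall_eq_or_imp]
    exact ⟨hm, one_pos, hL.2.1⟩
  · rw [getLast!_cons_cons]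
    exact hL.ne_nil_getLast 1
  · rw [cfQ_cons_cons, ← hL.2.2.2]; simp
  · have := List.length_pos_of_ne_nil hLne
    simp only [List.length_cons]; omega
  · simp only [deriveCF]
    rw [← hL.2.2.2]
    obtain ⟨b, R, rfl⟩ := List.exists_cons_of_ne_nil hR
    unfold memI1 memI2 at hs ⊢
    rw [getLast!_cons_cons, getLast!_cons_cons] at hs
    have hx1 := cfQ_nonneg ((b :: R).dropLast ++ [(b :: R).getLast! - 1, 2])
    have hx2 := cfQ_nonneg ((b :: R) ++ [2 * n - 2])
    have e1 : cfQ ((m :: 1 :: b :: R).dropLast ++ [(b :: R).getLast! - 1, 2]) =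
      cfHead m (1 + cfQ ((b :: R).dropLast ++ [(b :: R).getLast! - 1, 2])) := by
      simp [cfHead, cfQ]
    have e2 : cfQ ((m :: 1 :: b :: R) ++ [2 * n - 2]) =
      cfHead m (1 + cfQ ((b :: R) ++ [2 * n - 2])) := by simp [cfHead, cfQ]
    have hlen : (m :: 1 :: b :: R).length = (b :: R).length + 1 + 1 := rfl
    rw [e1, e2, hlen] at hs
    simp only [Nat.even_add_one (n := (b :: R).length + 1),
      Nat.even_add_one (n := (b :: R).length), not_not] at hs
    split_ifs at hs ⊢
    · rw [cfHead_le hy (by linarith), cfHead_lt (by linarith) hy] at hs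
      rcases hs with hs | hs
      · left; constructor <;> linarith
      · right; constructor <;> linarith
    · rw [cfHead_lt hy (by linarith), cfHead_le (by linarith) hy] at hs
      rcases hs with hs | hs
      · left; constructor <;> linarith
      · right; constructor <;> linarith

lemma derivable_two {m l n : ℕ} {R : List ℕ} {s : ℚ} (hm : 0 < m) (hl : 2 ≤ l)
    (hR : R = [] → 3 ≤ l) (h1 : cfHead m 2 < s) (h2 : s < 1 / m)
    (hs : memI1 (m :: l :: R) n s ∨ memI2 (m :: l :: R) n s) : Derivable (m :: l :: R) n s := by
  obtain ⟨y, hy, rfl⟩ := exists_cfHead hm ((cfHead_pos two_pos).trans h1) h2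
  rw [cfHead_lt two_pos hy] at h1
  obtain ⟨L, hL⟩ := exists_isCFExp (x := 1 / (y - 1)) (by apply one_div_pos.2; linarith)
    (by rw [div_lt_one (by linarith)]; linarith)
  obtain ⟨h, L, rfl⟩ := List.exists_cons_of_ne_nil hL.1
  obtain ⟨k, rfl⟩ : ∃ k, l = k + 2 := ⟨l - 2, by omega⟩
  have hh : 0 < h := hL.2.1 h (by simp)
  obtain ⟨j, rfl⟩ : ∃ j, h = j + 1 := ⟨h - 1, by omega⟩
  have hLval : y - 1 = j + 1 + cfQ L := by
    have := hL.2.2.2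
    rw [cfQ, one_div, one_div, inv_inj] at this
    rw [this]; push_cast; rfl
  refine ⟨m :: (j + 2) :: L, ⟨by simp, ?_, ?_, ?_⟩, by simp, fun hno => ?_, ?_⟩
  · simp only [List.mem_cons, forall_eq_or_imp]
    exact ⟨hm, by omega, fun x hx => hL.2.1 x (by simp [hx])⟩
  · rw [getLast!_cons_cons]
    have := hL.2.2.1
    cases L with
    | nil => simp [List.getLast!]
    | cons b L => rw [getLast!_cons_cons] at this ⊢; exact this
  · rw [cfQ_cons_cons]
    congr 1
    push_cast
    linarith
  · simp at hno
  · have ed : ∀ (i : ℕ) (T : List ℕ), deriveCF (m :: (i + 2) :: T) = (i + 1) :: T := fun _ _ => rfl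
    rw [ed, ed, ← hL.2.2.2]
    have key : ∀ (i : ℕ) (T : List ℕ),
        (cfHead m y ≤ cfQ (m :: (i + 2) :: T) ↔ cfQ ((i + 1) :: T) ≤ 1 / (y - 1)) ∧
        (cfHead m y < cfQ (m :: (i + 2) :: T) ↔ cfQ ((i + 1) :: T) < 1 / (y - 1)) ∧
        (cfQ (m :: (i + 2) :: T) ≤ cfHead m y ↔ 1 / (y - 1) ≤ cfQ ((i + 1) :: T)) ∧
        (cfQ (m :: (i + 2) :: T) < cfHead m y ↔ 1 / (y - 1) < cfQ ((i + 1) :: T)) := by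
      intro i T
      have hT := cfQ_nonneg T
      have h3 : (0 : ℚ) < ((i + 1 : ℕ) : ℚ) + cfQ T := by push_cast; positivity
      have h4 : (0 : ℚ) < ((i + 2 : ℕ) : ℚ) + cfQ T := by push_cast; positivity
      have h5 : 0 < y - 1 := by linarith
      rw [cfQ_cons_cons, cfQ, cfHead_le hy h4, cfHead_lt hy h4, cfHead_le h4 hy, cfHead_lt h4 hy,
        one_div_le_one_div h3 h5, one_div_lt_one_div h3 h5, one_div_le_one_div h5 h3,
        one_div_lt_one_div h5 h3]
      push_cast
      refine ⟨?_, ?_, ?_, ?_⟩ <;> constructor <;> intro <;> linarith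
    obtain ⟨i, T, hE, hE'⟩ : ∃ (i : ℕ) (T : List ℕ),
        (m :: (k + 2) :: R).dropLast ++ [(m :: (k + 2) :: R).getLast! - 1, 2] =
          m :: (i + 2) :: T ∧
        ((k + 1) :: R).dropLast ++ [((k + 1) :: R).getLast! - 1, 2] = (i + 1) :: T := by
      cases R with
      | nil =>
        have := hR rfl
        exact ⟨k - 1, [2], by simp [List.getLast!]; omega, by simp [List.getLast!]; omega⟩
      | cons b R =>
        rw [getLast!_cons_cons, getLast!_cons_cons, getLast!_cons_cons]
        exact ⟨k, _, rfl, rfl⟩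
    have hpos : 0 ≤ 1 / (y - 1) := by apply one_div_nonneg.2; linarith
    have hle : 1 / (y - 1) ≤ 1 := by rw [div_le_one (by linarith)]; linarith
    unfold memI1 memI2 at hs ⊢
    have hlen : (m :: (k + 2) :: R).length = ((k + 1) :: R).length + 1 := rfl
    rw [hE, hlen, List.cons_append, List.cons_append, (key _ _).1,
      (key _ _).2.1, (key _ _).2.2.1, (key _ _).2.2.2] at hs
    simp only [Nat.even_add_one (n := ((k + 1) :: R).length)] at hs
    rw [hE', List.cons_append]
    split_ifs at hs ⊢
    · exact hs.symm.imp (fun h => ⟨hpos, h.1⟩) (fun h => ⟨h.2, hle⟩)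
    · exact hs.symm.imp (fun h => ⟨hpos, h.1⟩) (fun h => ⟨h.2, hle⟩)

lemma isConj_or_inv_symm {G : Type*} [Group G] {x y : G} (h : IsConj x y ∨ IsConj x y⁻¹) :
    IsConj y x ∨ IsConj y x⁻¹ := by
  refine h.imp IsConj.symm fun h => ?_
  obtain ⟨c, hc⟩ := isConj_iff.1 h
  refine (isConj_iff.2 ⟨c, ?_⟩ : IsConj x⁻¹ y).symm
  rw [← inv_inj, ← hc]
  group

lemma derivable_of_inside {f : Farey} {m z n : ℕ} {K : List ℕ} (hm : 0 < m)
    (hK : ∀ x ∈ K, 0 < x) (hz : 2 ≤ z) (hKz : K = [] → 3 ≤ z)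
    (hA : cfQ (m :: K) = (f.qA : ℤ) / (f.pA : ℤ))
    (hB : cfQ (m :: K ++ [z - 1]) = (f.qB : ℤ) / (f.pB : ℤ)) {s : ℚ}
    (hs : memI1 (m :: K ++ [z]) n s ∨ memI2 (m :: K ++ [z]) n s)
    (h : f.Inside s.num s.den) : Derivable (m :: K ++ [z]) n s := by
  have hbet := Farey.between_of_inside hA hB h
  cases K with
  | nil =>
    have h3 := hKz rfl
    have hz' : (2 : ℚ) ≤ (z - 1 : ℕ) := by exact_mod_cast (by omega : 2 ≤ z - 1)
    have e1 : cfQ [m] = 1 / m := by simp [cfQ]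
    have e2 : cfQ ([m] ++ [z - 1]) = cfHead m (z - 1 : ℕ) := by simp [cfQ, cfHead]
    have h4 := cfHead_lt_inv hm (y := ((z - 1 : ℕ) : ℚ)) (by linarith)
    have h5 := (cfHead_le (m := m) two_pos (by linarith)).2 hz'
    rw [e1, e2] at hbet
    refine derivable_two hm hz (fun _ => h3) ?_ ?_ hs <;> rcases hbet with h | h <;> linarith
  | cons l K =>
    have hl : 0 < l := hK l (by simp)
    have hpos' : ∀ x ∈ K ++ [z - 1], 0 < x := by
      intro x hx
      simp only [List.mem_append, List.mem_singleton] at hx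
      rcases hx with hx | rfl
      · exact hK x (by simp [hx])
      · omega
    have a0 := cfQ_nonneg K
    have a1 : cfQ K ≤ 1 := cfQ_le_one fun x hx => hK x (by simp [hx])
    have b0 := cfQ_nonneg (K ++ [z - 1])
    have b1 := cfQ_le_one hpos'
    rw [List.cons_append, List.cons_append, cfQ_cons_cons, cfQ_cons_cons] at *
    have hl1 : (1 : ℚ) ≤ l := by exact_mod_cast hl
    obtain rfl | hl2 : l = 1 ∨ 2 ≤ l := by omega
    · have c1 := (cfHead_le (m := m) (y := 1) (y' := (1 : ℕ) + cfQ K) one_pos (by linarith)).2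
        (by push_cast; linarith)
      have c2 := (cfHead_le (m := m) (y := (1 : ℕ) + cfQ K) (y' := 2) (by linarith) two_pos).2
        (by push_cast; linarith)
      have c3 := (cfHead_le (m := m) (y := 1) (y' := (1 : ℕ) + cfQ (K ++ [z - 1])) one_pos
        (by linarith)).2 (by push_cast; linarith)
      have c4 := (cfHead_le (m := m) (y := (1 : ℕ) + cfQ (K ++ [z - 1])) (y' := 2) (by linarith)
        two_pos).2 (by push_cast; linarith)
      refine derivable_one hm (by simp) ?_ ?_ hs <;> rcases hbet with h | h <;> linarith
    · have hl2' : (2 : ℚ) ≤ l := by exact_mod_cast hl2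
      have c1 := (cfHead_le (m := m) (y := 2) (y' := l + cfQ K) two_pos (by linarith)).2
        (by linarith)
      have c2 := cfHead_lt_inv hm (y := l + cfQ K) (by linarith)
      have c3 := (cfHead_le (m := m) (y := 2) (y' := l + cfQ (K ++ [z - 1])) two_pos
        (by linarith)).2 (by linarith)
      have c4 := cfHead_lt_inv hm (y := l + cfQ (K ++ [z - 1])) (by linarith)
      refine derivable_two hm hl2 (by simp) ?_ ?_ hs <;> rcases hbet with h | h <;> linarith

/-- Lemma 3.7: if `m ≥ 2`, `r ≠ [m,2]`, and `s ≠ s'` in `I₁(r;n) ∪ I₂(r;n)` are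
such that `u_s` is conjugate in `Heck(r;n)` to `u_{s'}^{±1}`, then the derived
rationals `s̃`, `s̃'` are defined and belong to `I₁(r̃;n) ∪ I₂(r̃;n)`. -/
theorem statement13
    (M : List ℕ) (m n : ℕ) (r : ℚ)
    (hMlen : 2 ≤ M.length) (hMpos : ∀ x ∈ M, 0 < x) (hMlast : 2 ≤ M.getLast!)
    (hm : M.head? = some m) (hn : 2 ≤ n) (hr : r = cfQ M)
    (hm2 : 2 ≤ m) (hrm2 : r ≠ cfQ [m, 2])
    (s s' : ℚ) (hss' : s ≠ s')
    (hs : memI1 M n s ∨ memI2 M n s) (hs' : memI1 M n s' ∨ memI2 M n s')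
    (hconj : IsConj (heckQ r n (uWord s)) (heckQ r n (uWord s')) ∨
      IsConj (heckQ r n (uWord s)) ((heckQ r n (uWord s'))⁻¹)) :
    ∃ Ls Ls' : List ℕ, IsCFExp s Ls ∧ IsCFExp s' Ls' ∧
      2 ≤ Ls.length ∧ 2 ≤ Ls'.length ∧
      (Ls[1]? = some 1 → 3 ≤ Ls.length) ∧ (Ls'[1]? = some 1 → 3 ≤ Ls'.length) ∧
      (memI1 (deriveCF M) n (cfQ (deriveCF Ls)) ∨
        memI2 (deriveCF M) n (cfQ (deriveCF Ls))) ∧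
      (memI1 (deriveCF M) n (cfQ (deriveCF Ls')) ∨
        memI2 (deriveCF M) n (cfQ (deriveCF Ls'))) := by
  obtain ⟨K, z, rfl⟩ : ∃ K z, M = m :: K ++ [z] := by
    cases M with
    | nil => simp at hMlen
    | cons a T =>
      obtain rfl : a = m := by simpa using hm
      obtain rfl | ⟨K, z, rfl⟩ := List.eq_nil_or_concat' T
      · simp at hMlen
      · exact ⟨K, z, rfl⟩
  have hz : 2 ≤ z := by rwa [getLast!_concat] at hMlast
  have hK : ∀ x ∈ K, 0 < x := fun x hx => hMpos x (by simp [hx])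
  have hKz : K = [] → 3 ≤ z := by
    rintro rfl
    rcases hz.lt_or_eq with h | rfl
    · exact h
    · exact absurd hr hrm2
  obtain ⟨b0, b1⟩ := bounds_of_mem hMpos hMlast hn hs
  obtain ⟨b0', b1'⟩ := bounds_of_mem hMpos hMlast hn hs'
  obtain ⟨f, hq, hp, hε, hA, hB, hw, h2⟩ := exists_farey hm2 hK hz
  rw [← hr] at hq hp
  have hd := Farey.dom_of_mem hn hε hw h2 hs
  have hd' := Farey.dom_of_mem hn hε hw h2 hs'
  have hi := Farey.inside_of_conj hq hp hss' b0 b1 b0' b1' hn hd' hconj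
  have hi' := Farey.inside_of_conj hq hp hss'.symm b0' b1' b0 b1 hn hd (isConj_or_inv_symm hconj)
  have hm0 : 0 < m := by omega
  obtain ⟨Ls, x1, x2, x3, x4⟩ := derivable_of_inside hm0 hK hz hKz hA hB hs hi
  obtain ⟨Ls', y1, y2, y3, y4⟩ := derivable_of_inside hm0 hK hz hKz hA hB hs' hi'
  exact ⟨Ls, Ls', x1, y1, x2, y2, x3, y3, x4, y4⟩

end Heckoid
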